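/- Let G be a finitely generated locally graded biminimal non-nilpotent group. Then G is finite, and the order of G is divisible by at most three distinct prime numbers. -/

import Mathlib

/-- A group is *minimal non-nilpotent* if it is not nilpotent but every proper
subgroup of it is nilpotent. -/
def MinimalNonNilpotent (G : Type*) [Group G] : Prop :=
  ¬ Group.IsNilpotent G ∧ ∀ H : Subgroup G, H ≠ ⊤ → Group.IsNilpotent H

/-- A group is *biminimal non-nilpotent* if it is neither nilpotent nor minimal
non-nilpotent, but every proper subgroup of it is nilpotent or minimal non-nilpotent. -/
def BiminimalNonNilpotent (G : Type*) [Group G] : Prop :=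
  ¬ Group.IsNilpotent G ∧ ¬ MinimalNonNilpotent G ∧
    ∀ H : Subgroup G, H ≠ ⊤ → (Group.IsNilpotent H ∨ MinimalNonNilpotent H)

/-- A group is *para-Nil-Hamiltonian* if it is not nilpotent and every non-normal
subgroup of it is either nilpotent or minimal non-nilpotent. -/
def ParaNilHamiltonian (G : Type*) [Group G] : Prop :=
  ¬ Group.IsNilpotent G ∧
    ∀ H : Subgroup G, ¬ H.Normal → (Group.IsNilpotent H ∨ MinimalNonNilpotent H)

/-- A group is *meta-Nil-Hamiltonian* if every non-nilpotent subgroup of it is normal. -/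
def MetaNilHamiltonian (G : Type*) [Group G] : Prop :=
  ∀ H : Subgroup G, ¬ Group.IsNilpotent H → H.Normal

/-- A group is *locally graded* if every non-trivial finitely generated subgroup of it
contains a proper subgroup of finite index. -/
def LocallyGraded (G : Type*) [Group G] : Prop :=
  ∀ H : Subgroup G, H ≠ ⊥ → Group.FG H → ∃ K : Subgroup H, K ≠ ⊤ ∧ K.FiniteIndex

/-- A group is abelian if its multiplication commutes. -/
def Abelian (G : Type*) [Group G] : Prop := ∀ a b : G, a * b = b * a

/-- A group is *minimal non-abelian* if it is not abelian but every proper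
subgroup of it is abelian. -/
def MinimalNonAbelian (G : Type*) [Group G] : Prop :=
  ¬ Abelian G ∧ ∀ H : Subgroup G, H ≠ ⊤ → Abelian H

/-- A group is *biminimal non-abelian* if it is neither abelian nor minimal non-abelian,
but every proper subgroup of it is abelian or minimal non-abelian. -/
def BiminimalNonAbelian (G : Type*) [Group G] : Prop :=
  ¬ Abelian G ∧ ¬ MinimalNonAbelian G ∧
    ∀ H : Subgroup G, H ≠ ⊤ → (Abelian H ∨ MinimalNonAbelian H)

/-- A group is *parahamiltonian* if it is not abelian and every non-normal subgroup
of it is either abelian or minimal non-abelian. -/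
def Parahamiltonian (G : Type*) [Group G] : Prop :=
  ¬ Abelian G ∧ ∀ H : Subgroup G, ¬ H.Normal → (Abelian H ∨ MinimalNonAbelian H)

/-- A group is *locally nilpotent* if every finitely generated subgroup of it is nilpotent. -/
def LocallyNilpotent (G : Type*) [Group G] : Prop :=
  ∀ H : Subgroup G, Group.FG H → Group.IsNilpotent H

section Hall

open Subgroup

variable {G : Type*} [Group G]

theorem commutator_le_iff_map_le_centralizer (X Y N : Subgroup G) [N.Normal] :
    ⁅X, Y⁆ ≤ N ↔ X.map (QuotientGroup.mk' N) ≤ centralizer (Y.map (QuotientGroup.mk' N)) := by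
  rw [← commutator_eq_bot_iff_le_centralizer, ← map_commutator, Subgroup.map_eq_bot_iff,
    QuotientGroup.ker_mk']

theorem commutator_sup_le_of_le {A B K N : Subgroup G} [N.Normal] (hA : ⁅A, K⁆ ≤ N)
    (hB : ⁅B, K⁆ ≤ N) : ⁅A ⊔ B, K⁆ ≤ N := by
  rw [commutator_le_iff_map_le_centralizer] at *
  rw [Subgroup.map_sup]
  exact sup_le hA hB

theorem commutator_commutator_le_of_rotate {X Y Z N : Subgroup G} [N.Normal]
    (h1 : ⁅⁅Y, Z⁆, X⁆ ≤ N) (h2 : ⁅⁅Z, X⁆, Y⁆ ≤ N) : ⁅⁅X, Y⁆, Z⁆ ≤ N := by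
  have key : ∀ H : Subgroup G, H ≤ N ↔ H.map (QuotientGroup.mk' N) = ⊥ := fun H => by
    rw [Subgroup.map_eq_bot_iff, QuotientGroup.ker_mk']
  rw [key, map_commutator, map_commutator] at *
  exact commutator_commutator_eq_bot_of_rotate h1 h2

/-- The iterated commutator of `X` with the whole group. -/
def iterCommTop (X : Subgroup G) : ℕ → Subgroup G
  | 0 => X
  | m + 1 => iterCommTop ⁅X, ⊤⁆ m

theorem iterCommTop_mono {X Y : Subgroup G} (h : X ≤ Y) (m : ℕ) :
    iterCommTop X m ≤ iterCommTop Y m := by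
  induction m generalizing X Y with
  | zero => exact h
  | succ m ih => exact ih (commutator_mono h le_rfl)

theorem iterCommTop_le (X : Subgroup G) [hX : X.Normal] (m : ℕ) : iterCommTop X m ≤ X := by
  induction m generalizing X with
  | zero => exact le_rfl
  | succ m ih => exact (ih ⁅X, ⊤⁆).trans (commutator_le_left X ⊤)

theorem iterCommTop_add (X : Subgroup G) (m n : ℕ) :
    iterCommTop X (m + n) = iterCommTop (iterCommTop X m) n := by
  induction m generalizing X with
  | zero => simp [iterCommTop]
  | succ m ih => rw [Nat.succ_add]; exact ih _

theorem iterCommTop_sup_le {A B N : Subgroup G} [A.Normal] [B.Normal] (m : ℕ)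
    (hA : iterCommTop A m ≤ N) (hB : iterCommTop B m ≤ N) : iterCommTop (A ⊔ B) m ≤ N := by
  induction m generalizing A B with
  | zero => exact sup_le hA hB
  | succ m ih =>
    refine le_trans (iterCommTop_mono ?_ m) (ih (A := ⁅A, ⊤⁆) (B := ⁅B, ⊤⁆) hA hB)
    exact commutator_sup_le_of_le le_sup_left le_sup_right

theorem iterCommTop_commutator_le {p q : ℕ} {X Y X' Y' : Subgroup G} [X.Normal] [Y.Normal]
    [X'.Normal] [Y'.Normal] (hX : iterCommTop X p ≤ X') (hY : iterCommTop Y q ≤ Y') :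
    iterCommTop ⁅X, Y⁆ (p + q) ≤ ⁅X', Y⁆ ⊔ ⁅X, Y'⁆ := by
  obtain ⟨n, hn⟩ : ∃ n, p + q = n := ⟨_, rfl⟩
  induction n generalizing p q X Y with
  | zero =>
    obtain ⟨rfl, rfl⟩ : p = 0 ∧ q = 0 := by omega
    exact le_sup_of_le_left (commutator_mono hX le_rfl)
  | succ n ih =>
    rcases p with _ | p
    · exact (iterCommTop_le _ _).trans (le_sup_of_le_left (commutator_mono hX le_rfl))
    rcases q with _ | q
    · exact (iterCommTop_le _ _).trans (le_sup_of_le_right (commutator_mono le_rfl hY))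
    rw [show p + 1 + (q + 1) = (p + q + 1) + 1 by omega]
    change iterCommTop ⁅⁅X, Y⁆, ⊤⁆ _ ≤ _
    have h3 : ⁅⁅X, Y⁆, (⊤ : Subgroup G)⁆ ≤
        ⁅⁅X, (⊤ : Subgroup G)⁆, Y⁆ ⊔ ⁅X, ⁅Y, (⊤ : Subgroup G)⁆⁆ := by
      apply commutator_commutator_le_of_rotate
      · rw [commutator_comm ⁅Y, ⊤⁆ X]; exact le_sup_right
      · rw [commutator_comm (⊤ : Subgroup G) X]; exact le_sup_left
    refine (iterCommTop_mono h3 _).trans (iterCommTop_sup_le _ ?_ ?_)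
    · have := ih (p := p) (q := q + 1) (X := ⁅X, ⊤⁆) (Y := Y) hX hY (by omega)
      refine le_trans this (sup_le le_sup_left (le_sup_of_le_right ?_))
      exact commutator_mono (commutator_le_left _ _) le_rfl
    · have := ih (p := p + 1) (q := q) (X := X) (Y := ⁅Y, ⊤⁆) hX hY (by omega)
      rw [show p + 1 + q = p + q + 1 by omega] at this
      refine le_trans this (sup_le (le_sup_of_le_left ?_) le_sup_right)
      exact commutator_mono le_rfl (commutator_le_left _ _)

theorem iterCommTop_succ' (X : Subgroup G) (n : ℕ) :
    iterCommTop X (n + 1) = ⁅iterCommTop X n, ⊤⁆ := by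
  rw [iterCommTop_add]; rfl

theorem isNilpotent_iff_iterCommTop :
    Group.IsNilpotent G ↔ ∃ n, iterCommTop (⊤ : Subgroup G) n = ⊥ := by
  rw [Subgroup.nilpotent_iff_lowerCentralSeries]
  have : ∀ n, iterCommTop (⊤ : Subgroup G) n = (⊤ : Subgroup G).lowerCentralSeries n := by
    intro n
    induction n with
    | zero => rfl
    | succ n ih => rw [iterCommTop_succ', ih]; rfl
  simp [this]

theorem isNilpotent_quotient_iff_iterCommTop (N : Subgroup G) [N.Normal] :
    Group.IsNilpotent (G ⧸ N) ↔ ∃ n, iterCommTop (⊤ : Subgroup G) n ≤ N := by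
  rw [isNilpotent_iff_iterCommTop]
  have : ∀ n, iterCommTop (⊤ : Subgroup (G ⧸ N)) n =
      (iterCommTop (⊤ : Subgroup G) n).map (QuotientGroup.mk' N) := by
    intro n
    induction n with
    | zero =>
      exact (Subgroup.map_top_of_surjective _ (QuotientGroup.mk'_surjective N)).symm
    | succ n ih =>
      rw [iterCommTop_succ', iterCommTop_succ', ih, map_commutator,
        Subgroup.map_top_of_surjective _ (QuotientGroup.mk'_surjective N)]
  simp_rw [this, Subgroup.map_eq_bot_iff, QuotientGroup.ker_mk']

/-- P. Hall's nilpotency criterion. -/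
theorem isNilpotent_of_quotient_commutator (N : Subgroup G) [N.Normal] (hN : Group.IsNilpotent N)
    (hG : Group.IsNilpotent (G ⧸ ⁅N, N⁆)) : Group.IsNilpotent G := by
  obtain ⟨m, hm⟩ := (isNilpotent_quotient_iff_iterCommTop _).1 hG
  obtain ⟨c, hc⟩ := (isNilpotent_iff_lowerCentralSeries N).1 hN
  have step : ∀ i, ∃ k, iterCommTop (N.lowerCentralSeries i) k ≤ N.lowerCentralSeries (i + 1) := by
    intro i
    induction i with
    | zero => exact ⟨m, (iterCommTop_mono le_top m).trans hm⟩
    | succ i ih =>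
      obtain ⟨k, hk⟩ := ih
      have h0 : iterCommTop N m ≤ ⁅N, N⁆ := (iterCommTop_mono le_top m).trans hm
      refine ⟨k + m, (iterCommTop_commutator_le hk h0).trans (sup_le le_rfl ?_)⟩
      rw [commutator_comm]
      apply commutator_commutator_le_of_rotate
      · rw [commutator_comm N]; rfl
      · rfl
  have all : ∀ i, ∃ k, iterCommTop (⊤ : Subgroup G) k ≤ N.lowerCentralSeries i := by
    intro i
    induction i with
    | zero => exact ⟨m, hm.trans (commutator_le_left N N)⟩
    | succ i ih =>
      obtain ⟨k, hk⟩ := ih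
      obtain ⟨l, hl⟩ := step i
      exact ⟨k + l, by rw [iterCommTop_add]; exact (iterCommTop_mono hk l).trans hl⟩
  obtain ⟨k, hk⟩ := all c
  exact isNilpotent_iff_iterCommTop.2 ⟨k, le_bot_iff.1 (hc ▸ hk)⟩

end Hall

section Finiteness

open Subgroup

theorem finite_of_finite_abelianization (G : Type*) [Group G] [Group.IsNilpotent G] :
    Finite (Abelianization G) → Finite G := by
  refine Group.nilpotent_center_quotient_ind
    (P := fun G _ _ => Finite (Abelianization G) → Finite G) G ?_ ?_
  · intro G _ _ _
    infer_instance
  · intro G _ _ ih h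
    have h1 : Function.Surjective (Abelianization.map (QuotientGroup.mk' (center G))) := by
      intro x
      induction x using QuotientGroup.induction_on with
      | H x =>
        induction x using QuotientGroup.induction_on with
        | H x => exact ⟨Abelianization.of x, rfl⟩
    have h2 : Finite (G ⧸ center G) := ih (Finite.of_surjective _ h1)
    have h3 : Finite (commutatorSet G) := by
      have : commutatorSet G ⊆ Set.range
          (fun x : (G ⧸ center G) × (G ⧸ center G) => x.1.out * x.2.out * x.1.out⁻¹ * x.2.out⁻¹) := by
        rintro _ ⟨a, b, rfl⟩
        refine ⟨(a, b), ?_⟩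
        obtain ⟨⟨z, hz⟩, hz'⟩ := QuotientGroup.mk_out_eq_mul (center G) a
        obtain ⟨⟨w, hw⟩, hw'⟩ := QuotientGroup.mk_out_eq_mul (center G) b
        simp only [hz', hw', commutatorElement_def, mul_inv_rev]
        rw [mem_center_iff] at hz hw
        have e1 : a * z * (b * w) = z * w * (a * b) := by
          calc a * z * (b * w) = z * a * (w * b) := by rw [hz, hw]
            _ = z * (a * w) * b := by group
            _ = z * w * (a * b) := by rw [hw]; group
        calc a * z * (b * w) * (z⁻¹ * a⁻¹) * (w⁻¹ * b⁻¹)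
            = z * w * (a * b) * (z⁻¹ * a⁻¹) * (w⁻¹ * b⁻¹) := by rw [e1]
          _ = z * (w * (a * b * z⁻¹ * a⁻¹)) * w⁻¹ * b⁻¹ := by group
          _ = z * (a * b * z⁻¹ * a⁻¹) * b⁻¹ := by rw [← hw]; group
          _ = (a * b * z⁻¹ * a⁻¹) * z * b⁻¹ := by rw [hz]
          _ = a * b * (z⁻¹ * (a⁻¹ * z)) * b⁻¹ := by group
          _ = _ := by rw [hz]; group
      exact (Set.finite_range _).subset this
    have h4 : Finite (G ⧸ _root_.commutator G) := h
    exact Finite.of_subgroup_quotient (_root_.commutator G)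

theorem exists_prime_of_infinite_fg (M : Type*) [AddCommGroup M] [Module.Finite ℤ M] [Infinite M]
    (B : ℕ) : ∃ p : ℕ, p.Prime ∧ B < p ∧ (∀ a : M, p • a = 0 → a = 0) ∧
      ∃ m : M, ∀ x : M, m ≠ p • x := by
  have hT : Finite (Submodule.torsion ℤ M) :=
    Module.finite_of_fg_torsion _ (Submodule.torsion_isTorsion)
  obtain ⟨p, hp1, hp⟩ := Nat.exists_infinite_primes (B + Nat.card (Submodule.torsion ℤ M) + 1)
  refine ⟨p, hp, by omega, ?_, ?_⟩
  · intro a ha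
    have hat : a ∈ Submodule.torsion ℤ M := by
      rw [Submodule.mem_torsion_iff]
      refine ⟨⟨(p : ℤ), ?_⟩, ?_⟩
      · exact mem_nonZeroDivisors_of_ne_zero (by exact_mod_cast hp.ne_zero)
      · change (p : ℤ) • a = 0
        simpa using ha
    have h1 := addOrderOf_dvd_natCard (⟨a, hat⟩ : Submodule.torsion ℤ M)
    have h2 : addOrderOf (⟨a, hat⟩ : Submodule.torsion ℤ M) ∣ p := by
      rw [addOrderOf_dvd_iff_nsmul_eq_zero]
      exact Subtype.ext ha
    rcases (Nat.dvd_prime hp).1 h2 with h | h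
    · rw [AddMonoid.addOrderOf_eq_one_iff] at h
      exact congrArg Subtype.val h
    · rw [h] at h1
      have := Nat.le_of_dvd Nat.card_pos h1
      omega
  · by_contra! hcon
    obtain ⟨r, hr, hr0⟩ := Submodule.exists_sub_one_mem_and_smul_eq_zero_of_fg_of_le_smul
      (Ideal.span {(p : ℤ)}) (⊤ : Submodule ℤ M) Module.Finite.fg_top (by
        intro m _
        obtain ⟨x, rfl⟩ := hcon m
        have : (p • x : M) = (p : ℤ) • x := by simp
        rw [this]
        exact Submodule.smul_mem_smul (Ideal.mem_span_singleton_self _) trivial)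
    have hrne : r ≠ 0 := by
      rintro rfl
      rw [Ideal.mem_span_singleton] at hr
      have : (p : ℤ) ∣ 1 := by simpa using hr
      have := Int.natCast_dvd_natCast.1 (by simpa using this : (p : ℤ) ∣ ((1 : ℕ) : ℤ))
      exact hp.one_lt.ne' (Nat.dvd_one.1 this)
    have : Finite M := Module.finite_of_fg_torsion M (by
      intro x
      exact ⟨⟨r, mem_nonZeroDivisors_of_ne_zero hrne⟩, hr0 x trivial⟩)
    exact not_finite M

theorem exists_prime_powMonoidHom (A : Type*) [CommGroup A] [Group.FG A] [Infinite A] (B : ℕ) :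
    ∃ p : ℕ, p.Prime ∧ B < p ∧ (∀ a : A, a ^ p = 1 → a = 1) ∧
      (powMonoidHom p : A →* A).range ≠ ⊤ ∧ Finite (A ⧸ (powMonoidHom p : A →* A).range) := by
  have : Module.Finite ℤ (Additive A) := Module.Finite.iff_addGroup_fg.2 inferInstance
  obtain ⟨p, hp, hB, h1, m, hm⟩ := exists_prime_of_infinite_fg (Additive A) B
  refine ⟨p, hp, hB, fun a ha => h1 (Additive.ofMul a) ha, ?_, ?_⟩
  · intro h
    obtain ⟨x, hx⟩ := (h ▸ mem_top (Additive.toMul m) :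
      Additive.toMul m ∈ (powMonoidHom p : A →* A).range)
    exact hm (Additive.ofMul x) hx.symm
  · apply CommGroup.finite_of_fg_isMulTorsion
    intro x
    induction x using QuotientGroup.induction_on with
    | H x =>
      rw [isOfFinOrder_iff_pow_eq_one]
      refine ⟨p, hp.pos, ?_⟩
      rw [← QuotientGroup.mk_pow, QuotientGroup.eq_one_iff]
      exact ⟨x, rfl⟩

end Finiteness

section FinitenessAbelian

open Subgroup
open scoped commutatorElement

variable {G : Type*} [Group G]

theorem isNilpotent_of_supplement {A H : Subgroup G} [A.Normal] {p : ℕ}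
    (hA : ∀ a ∈ A, ∀ b ∈ A, a * b = b * a) (hAH : A ⊔ H = ⊤)
    (hH : Group.IsNilpotent H) (hpow : ∀ a ∈ A, a ^ p ∈ H)
    (htor : ∀ a ∈ A, a ^ p = 1 → a = 1) : Group.IsNilpotent G := by
  have hdec : ∀ g : G, ∃ a ∈ A, ∃ h ∈ H, a * h = g := fun g =>
    mem_sup_of_normal_left.1 (hAH ▸ mem_top g)
  have hquot : Group.IsNilpotent (G ⧸ A) := by
    apply Group.nilpotent_of_surjective ((QuotientGroup.mk' A).comp H.subtype)
    intro x
    induction x using QuotientGroup.induction_on with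
    | H g =>
      obtain ⟨a, ha, h, hh, rfl⟩ := hdec g
      refine ⟨⟨h, hh⟩, ?_⟩
      change ((h : G) : G ⧸ A) = _
      rw [QuotientGroup.mk_mul, (QuotientGroup.eq_one_iff a).2 ha, one_mul]
  obtain ⟨n, hn⟩ := (isNilpotent_quotient_iff_iterCommTop A).1 hquot
  obtain ⟨k, hk⟩ := (isNilpotent_iff_lowerCentralSeries H).1 hH
  have hmulpow : ∀ a ∈ A, ∀ b ∈ A, (a * b) ^ p = a ^ p * b ^ p := fun a ha b hb =>
    Commute.mul_pow (hA a ha b hb) p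
  let S : ℕ → Subgroup G := fun j =>
    { carrier := {a | a ∈ A ∧ a ^ p ∈ H.lowerCentralSeries j}
      mul_mem' := by
        rintro a b ⟨ha, ha'⟩ ⟨hb, hb'⟩
        exact ⟨mul_mem ha hb, by rw [hmulpow a ha b hb]; exact mul_mem ha' hb'⟩
      one_mem' := ⟨one_mem _, by rw [one_pow]; exact one_mem _⟩
      inv_mem' := by
        rintro a ⟨ha, ha'⟩
        exact ⟨inv_mem ha, by rw [inv_pow]; exact inv_mem ha'⟩ }
  have hS : ∀ j, iterCommTop A j ≤ S j := by
    intro j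
    induction j with
    | zero => exact fun a ha => ⟨ha, hpow a ha⟩
    | succ j ih =>
      rw [iterCommTop_succ', commutator_le]
      intro a ha g _
      obtain ⟨haA, hap⟩ := ih ha
      obtain ⟨b, hb, h, hh, rfl⟩ := hdec g
      have hc : h * a⁻¹ * h⁻¹ ∈ A := Subgroup.Normal.conj_mem inferInstance _ (inv_mem haA) h
      have e : ⁅a, b * h⁆ = a * (h * a⁻¹ * h⁻¹) := by
        rw [commutatorElement_def]
        calc a * (b * h) * a⁻¹ * (b * h)⁻¹ = (a * b) * (h * a⁻¹ * h⁻¹) * b⁻¹ := by group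
          _ = a * (b * (h * a⁻¹ * h⁻¹)) * b⁻¹ := by group
          _ = a * (h * a⁻¹ * h⁻¹) := by rw [hA b hb _ hc]; group
      refine ⟨?_, ?_⟩
      · rw [e]; exact mul_mem haA hc
      · rw [e, hmulpow _ haA _ hc, conj_pow, inv_pow]
        have : a ^ p * (h * (a ^ p)⁻¹ * h⁻¹) = ⁅a ^ p, h⁆ := by
          rw [commutatorElement_def]; group
        rw [this]
        exact commutator_mem_commutator hap hh
  refine isNilpotent_iff_iterCommTop.2 ⟨n + k, ?_⟩
  rw [iterCommTop_add, eq_bot_iff]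
  refine (iterCommTop_mono hn k).trans ((hS k).trans ?_)
  rintro a ⟨ha, ha'⟩
  rw [hk, mem_bot] at ha'
  exact htor a ha ha'

theorem isNilpotent_of_abelian_finiteIndex [Infinite G] (A : Subgroup G) [A.Normal]
    [A.FiniteIndex] [Group.FG A] (hA : ∀ a ∈ A, ∀ b ∈ A, a * b = b * a)
    (hsub : ∀ H : Subgroup G, H ≠ ⊤ → H.FiniteIndex → Group.IsNilpotent H) :
    Group.IsNilpotent G := by
  let _ : CommGroup A := { (inferInstance : Group A) with
    mul_comm := fun a b => Subtype.ext (hA a a.2 b b.2) }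
  have hinf : Infinite A := by
    by_contra h
    rw [not_infinite_iff_finite] at h
    have : Finite (G ⧸ A) := inferInstance
    have := Finite.of_subgroup_quotient A
    exact not_finite G
  obtain ⟨p, hp, hpB, htor, hne, hfin⟩ := exists_prime_powMonoidHom A A.index
  let P : Subgroup G := ((powMonoidHom p : A →* A).range).map A.subtype
  have hPmem : ∀ x, x ∈ P ↔ ∃ a ∈ A, a ^ p = x := by
    intro x
    simp only [P, Subgroup.mem_map, MonoidHom.mem_range]
    constructor
    · rintro ⟨_, ⟨a, rfl⟩, rfl⟩
      exact ⟨a, a.2, rfl⟩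
    · rintro ⟨a, ha, rfl⟩
      exact ⟨_, ⟨⟨a, ha⟩, rfl⟩, rfl⟩
  have hPA : P ≤ A := by
    intro x hx
    obtain ⟨a, ha, rfl⟩ := (hPmem x).1 hx
    exact pow_mem ha p
  have hPn : P.Normal := ⟨by
    intro x hx g
    obtain ⟨a, ha, rfl⟩ := (hPmem x).1 hx
    exact (hPmem _).2 ⟨g * a * g⁻¹, Subgroup.Normal.conj_mem inferInstance _ ha g, conj_pow⟩⟩
  have hPf : P.FiniteIndex := by
    have h1 : P.relIndex A ≠ 0 := by
      have : P.subgroupOf A = (powMonoidHom p : A →* A).range :=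
        Subgroup.comap_map_eq_self_of_injective A.subtype_injective _
      rw [relIndex, this]
      have : ((powMonoidHom p : A →* A).range).FiniteIndex := finiteIndex_of_finite_quotient
      exact FiniteIndex.index_ne_zero
    constructor
    rw [← relIndex_mul_index hPA]
    exact mul_ne_zero h1 FiniteIndex.index_ne_zero
  have : Fact p.Prime := ⟨hp⟩
  have hker : (QuotientGroup.mk' P).ker = P := QuotientGroup.ker_mk' P
  have hsurj := QuotientGroup.mk'_surjective P
  have hn : (A.map (QuotientGroup.mk' P)).Normal := Normal.map inferInstance _ hsurj
  have hcop : (Nat.card (A.map (QuotientGroup.mk' P))).Coprime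
      (A.map (QuotientGroup.mk' P)).index := by
    have hpg : IsPGroup p (A.map (QuotientGroup.mk' P)) := by
      rintro ⟨_, a, ha, rfl⟩
      refine ⟨1, Subtype.ext ?_⟩
      change (QuotientGroup.mk' P a) ^ (p ^ 1) = 1
      rw [pow_one, ← map_pow]
      exact (QuotientGroup.eq_one_iff _).2 ((hPmem _).2 ⟨a, ha, rfl⟩)
    have hff : Finite (G ⧸ P) := inferInstance
    obtain ⟨n, hn⟩ := IsPGroup.iff_card.1 hpg
    rw [hn, index_map_eq A hsurj (hker.le.trans hPA)]
    apply Nat.Coprime.pow_left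
    rw [hp.coprime_iff_not_dvd]
    intro hd
    exact absurd (Nat.le_of_dvd (Nat.pos_of_ne_zero FiniteIndex.index_ne_zero) hd) (by omega)
  obtain ⟨K, hK⟩ := exists_right_complement'_of_coprime hcop
  let H := K.comap (QuotientGroup.mk' P)
  have hPH : P ≤ H := fun x hx => by
    change QuotientGroup.mk' P x ∈ K
    have : QuotientGroup.mk' P x = 1 := (QuotientGroup.eq_one_iff x).2 hx
    rw [this]
    exact one_mem _
  have hAH : A ⊔ H = ⊤ := by
    have h1 := hK.sup_eq_top
    have h2 : (A ⊔ H).map (QuotientGroup.mk' P) = ⊤ := by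
      rw [Subgroup.map_sup, Subgroup.map_comap_eq_self_of_surjective hsurj, h1]
    have h3 := Subgroup.comap_map_eq_self (f := QuotientGroup.mk' P) (H := A ⊔ H)
      (hker.le.trans (hPA.trans le_sup_left))
    rw [← h3, h2, comap_top]
  have hHne : H ≠ ⊤ := by
    intro h
    apply hne
    have hKt : K = ⊤ := by
      rw [← Subgroup.map_comap_eq_self_of_surjective hsurj K]
      change Subgroup.map _ H = ⊤
      rw [h, Subgroup.map_top_of_surjective _ hsurj]
    have hAb : A.map (QuotientGroup.mk' P) = ⊥ := by
      have := hK.isCompl.inf_eq_bot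
      rwa [hKt, inf_top_eq] at this
    rw [Subgroup.map_eq_bot_iff, hker] at hAb
    rw [eq_top_iff]
    intro x _
    obtain ⟨a, ha, hax⟩ := (hPmem x).1 (hAb x.2)
    exact ⟨⟨a, ha⟩, Subtype.ext hax⟩
  have hHf : H.FiniteIndex := finiteIndex_of_le hPH
  exact isNilpotent_of_supplement hA hAH (hsub H hHne hHf)
    (fun a ha => hPH ((hPmem _).2 ⟨a, ha, rfl⟩))
    (fun a ha h => congrArg Subtype.val (htor ⟨a, ha⟩ (Subtype.ext h)))

theorem isNilpotent_of_nilpotent_finiteIndex [Infinite G] [Group.FG G] (N : Subgroup G) [N.Normal]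
    [N.FiniteIndex] (hN : Group.IsNilpotent N)
    (hsub : ∀ H : Subgroup G, H ≠ ⊤ → H.FiniteIndex → Group.IsNilpotent H) :
    Group.IsNilpotent G := by
  apply isNilpotent_of_quotient_commutator N hN
  have hNfg : Group.FG N := inferInstance
  have hsurj := QuotientGroup.mk'_surjective ⁅N, N⁆
  have hle : (QuotientGroup.mk' ⁅N, N⁆).ker ≤ N := by
    rw [QuotientGroup.ker_mk']; exact commutator_le_left N N
  let A := N.map (QuotientGroup.mk' ⁅N, N⁆)
  have hAn : A.Normal := Normal.map inferInstance _ hsurj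
  have hAf : A.FiniteIndex := ⟨by
    rw [index_map_eq N hsurj hle]; exact FiniteIndex.index_ne_zero⟩
  have hAfg : Group.FG A :=
    Group.fg_of_surjective (f := (QuotientGroup.mk' ⁅N, N⁆).subgroupMap N)
      (MonoidHom.subgroupMap_surjective _ _)
  have hAc : ∀ a ∈ A, ∀ b ∈ A, a * b = b * a := by
    rintro _ ⟨a, ha, rfl⟩ _ ⟨b, hb, rfl⟩
    rw [← commutatorElement_eq_one_iff_mul_comm, ← map_commutatorElement]
    exact (QuotientGroup.eq_one_iff _).2 (commutator_mem_commutator ha hb)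
  have hinf : Infinite (G ⧸ ⁅N, N⁆) := by
    by_contra h
    rw [not_infinite_iff_finite] at h
    have h1 : Finite (N ⧸ _root_.commutator N) := by
      refine Finite.of_injective (QuotientGroup.map (_root_.commutator N) ⁅N, N⁆ N.subtype ?_) ?_
      · rw [← map_le_iff_le_comap, _root_.commutator_def, map_commutator,
          ← MonoidHom.range_eq_map, range_subtype]
      · rw [← MonoidHom.ker_eq_bot_iff, eq_bot_iff]
        intro x hx
        induction x using QuotientGroup.induction_on with
        | H x =>
          have : (x : G) ∈ ⁅N, N⁆ := (QuotientGroup.eq_one_iff _).1 hx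
          have h2 : ⁅N, N⁆ = (_root_.commutator N).map N.subtype := by
            rw [_root_.commutator_def, map_commutator, ← MonoidHom.range_eq_map,
              range_subtype]
          rw [h2] at this
          obtain ⟨y, hy, hyx⟩ := this
          rw [mem_bot]
          refine (QuotientGroup.eq_one_iff _).2 ?_
          rwa [← Subtype.ext hyx]
    have h2 : Finite N := finite_of_finite_abelianization N h1
    have := Finite.of_subgroup_quotient N
    exact not_finite G
  apply isNilpotent_of_abelian_finiteIndex A hAc
  intro H hH hHf
  have h1 : Group.IsNilpotent (H.comap (QuotientGroup.mk' ⁅N, N⁆)) := by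
    apply hsub
    · intro h
      apply hH
      rw [← Subgroup.map_comap_eq_self_of_surjective hsurj H, h,
        Subgroup.map_top_of_surjective _ hsurj]
    · exact ⟨by rw [index_comap_of_surjective _ hsurj]; exact FiniteIndex.index_ne_zero⟩
  refine Group.nilpotent_of_surjective ((QuotientGroup.mk' ⁅N, N⁆).subgroupComap H) ?_
  rintro ⟨x, hx⟩
  obtain ⟨y, rfl⟩ := hsurj x
  exact ⟨⟨y, hx⟩, rfl⟩

theorem finite_of_minimalNonNilpotent [Group.FG G] (h : MinimalNonNilpotent G)
    {K : Subgroup G} (hK : K ≠ ⊤) [K.FiniteIndex] : Finite G := by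
  by_contra hf
  rw [not_finite_iff_infinite] at hf
  apply h.1
  have : Group.IsNilpotent K.normalCore := h.2 _ (fun ht => hK (top_le_iff.1 (ht ▸ K.normalCore_le)))
  exact isNilpotent_of_nilpotent_finiteIndex K.normalCore this (fun H hH _ => h.2 H hH)

theorem finite_of_biminimalNonNilpotent [hfg : Group.FG G] (hlg : LocallyGraded G)
    (h : BiminimalNonNilpotent G) : Finite G := by
  by_contra hf
  rw [not_finite_iff_infinite] at hf
  apply h.1
  have key : ∀ H : Subgroup G, H ≠ ⊤ → H.FiniteIndex → Group.IsNilpotent H := by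
    intro H hH hHf
    refine (h.2.2 H hH).resolve_right ?_
    intro hm
    have hHfg : Group.FG H := inferInstance
    have hinf : Infinite H := by
      by_contra hfin
      rw [not_infinite_iff_finite] at hfin
      have := Finite.of_subgroup_quotient H
      exact not_finite G
    obtain ⟨K, hK, _⟩ := hlg H (by
      rintro rfl
      exact not_finite (⊥ : Subgroup G)) hHfg
    have := finite_of_minimalNonNilpotent hm hK
    exact not_finite H
  have hT : ∃ K : Subgroup G, K ≠ ⊤ ∧ K.FiniteIndex := by
    obtain ⟨K, hK, hKf⟩ := hlg ⊤ (by
      intro ht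
      have : Subsingleton G := subsingleton_iff.1 (subsingleton_of_bot_eq_top ht.symm)
      exact not_finite G) (Group.fg_iff_subgroup_fg _ |>.2 (Group.fg_def.1 hfg))
    refine ⟨K.map (⊤ : Subgroup G).subtype, ?_, ?_⟩
    · intro ht
      apply hK
      rw [eq_top_iff]
      intro x _
      obtain ⟨y, hy, hyx⟩ := (by rw [ht]; exact mem_top _ : (x : G) ∈ K.map (⊤ : Subgroup G).subtype)
      rwa [← Subtype.ext hyx]
    · constructor
      have : (K.map (⊤ : Subgroup G).subtype).index = K.index * (⊤ : Subgroup G).index :=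
        index_map_subtype K
      rw [this, index_top, mul_one]
      exact FiniteIndex.index_ne_zero
  obtain ⟨K, hK, hKf⟩ := hT
  have hKne : K.normalCore ≠ ⊤ := fun ht => hK (top_le_iff.1 (ht ▸ K.normalCore_le))
  exact isNilpotent_of_nilpotent_finiteIndex K.normalCore (key _ hKne inferInstance) key

end FinitenessAbelian

section SylowTools

open Subgroup
open scoped commutatorElement

variable {G : Type*} [Group G] [Finite G]

theorem exists_max_pSubgroup_of_isNilpotent {H : Subgroup G} (hH : Group.IsNilpotent H) (p : ℕ)
    [Fact p.Prime] : ∃ T : Subgroup G, T ≤ H ∧ IsPGroup p T ∧ H ≤ normalizer (T : Set G) ∧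
      ∀ Q : Subgroup G, Q ≤ H → IsPGroup p Q → Q ≤ T := by
  obtain ⟨P⟩ : Nonempty (Sylow p H) := inferInstance
  have hP : (P : Subgroup H).Normal := inferInstance
  refine ⟨(P : Subgroup H).map H.subtype, map_subtype_le _, P.2.map _, ?_, ?_⟩
  · rw [le_normalizer_iff]
    rintro h hh _ ⟨k, hk, rfl⟩
    exact ⟨⟨h, hh⟩ * k * ⟨h, hh⟩⁻¹, hP.conj_mem _ hk _, rfl⟩
  · intro Q hQH hQ
    obtain ⟨P', hP'⟩ := (hQ.comap_subtype (K := H)).exists_le_sylow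
    have huniq : P' = P := by
      have := Sylow.unique_of_normal P hP
      exact Subsingleton.elim _ _
    intro x hx
    exact ⟨⟨x, hQH hx⟩, huniq ▸ hP' hx, rfl⟩

theorem commute_of_isNilpotent {H A B : Subgroup G} (hH : Group.IsNilpotent H) {p q : ℕ}
    [Fact p.Prime] [Fact q.Prime] (hpq : p ≠ q) (hA : IsPGroup p A) (hB : IsPGroup q B)
    (hAH : A ≤ H) (hBH : B ≤ H) {a b : G} (ha : a ∈ A) (hb : b ∈ B) : a * b = b * a := by
  obtain ⟨T, hTH, hT, hTn, hTm⟩ := exists_max_pSubgroup_of_isNilpotent hH p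
  obtain ⟨U, hUH, hU, hUn, hUm⟩ := exists_max_pSubgroup_of_isNilpotent hH q
  have haT := hTm A hAH hA ha
  have hbU := hUm B hBH hB hb
  have hd := IsPGroup.disjoint_of_ne p q hpq T U hT hU
  rw [← commutatorElement_eq_one_iff_mul_comm]
  have h1 : ⁅a, b⁆ ∈ T := by
    rw [commutatorElement_def, mul_assoc, mul_assoc]
    refine mul_mem haT ?_
    rw [← mul_assoc]
    exact le_normalizer_iff.1 hTn b (hUH hbU) _ (inv_mem haT)
  have h2 : ⁅a, b⁆ ∈ U := by
    rw [commutatorElement_def]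
    exact mul_mem (le_normalizer_iff.1 hUn a (hTH haT) _ hbU) (inv_mem hbU)
  exact (Subgroup.disjoint_def.1 hd) h1 h2

theorem isNilpotent_of_sylow_normal
    (h : ∀ (p : ℕ) (_ : Fact p.Prime), ∃ P : Sylow p G, (P : Subgroup G).Normal) :
    Group.IsNilpotent G := by
  refine (Group.isNilpotent_of_finite_tfae (G := G)).out 3 0 |>.1 ?_
  intro p hp P
  obtain ⟨P', hP'⟩ := h p hp
  have := Sylow.unique_of_normal P' hP'
  rwa [Subsingleton.elim P P']

theorem eq_top_of_sylow_le {H : Subgroup G}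
    (h : ∀ (p : ℕ) (_ : Fact p.Prime), ∃ P : Sylow p G, (P : Subgroup G) ≤ H) : H = ⊤ := by
  rw [← index_eq_one]
  by_contra hne
  obtain ⟨p, hp, hd⟩ := Nat.exists_prime_and_dvd hne
  have := Fact.mk hp
  obtain ⟨P, hP⟩ := h p this
  exact P.not_dvd_index (hd.trans (index_dvd_of_le hP))

/-- If distinct Sylow subgroups do not intersect trivially, then there is a nontrivial
`p`-subgroup whose normalizer has no largest `p`-subgroup. -/
theorem exists_normalizer_of_sylow_inf_ne_bot {p : ℕ} [Fact p.Prime] {P₁ P₂ : Sylow p G}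
    (hne : P₁ ≠ P₂) (hinf : (P₁ ⊓ P₂ : Subgroup G) ≠ ⊥) :
    ∃ (P : Sylow p G) (D : Subgroup G), D ≠ ⊥ ∧ D ≤ P ∧
      (¬ ∃ T : Subgroup G, IsPGroup p T ∧
        ∀ Q : Subgroup G, Q ≤ normalizer (D : Set G) → IsPGroup p Q → Q ≤ T) ∧
      ∀ Q : Subgroup G, IsPGroup p Q → (P ⊓ normalizer (D : Set G) : Subgroup G) ≤ Q → Q ≤ P := by
  classical
  let S : Set (Subgroup G) := {D | ∃ P₁ P₂ : Sylow p G, P₁ ≠ P₂ ∧ D = (P₁ ⊓ P₂ : Subgroup G)}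
  have hS : S.Finite := Set.toFinite _
  obtain ⟨D, hDle, hD⟩ := hS.exists_le_maximal (⟨P₁, P₂, hne, rfl⟩ : (P₁ ⊓ P₂ : Subgroup G) ∈ S)
  have hDne : D ≠ ⊥ := fun h => hinf (le_bot_iff.1 (h ▸ hDle))
  obtain ⟨⟨P, Q, hPQ, hDPQ⟩, hmax⟩ := hD
  have grow : ∀ P Q : Sylow p G, P ≠ Q → D = (P ⊓ Q : Subgroup G) →
      D < (P ⊓ normalizer (D : Set G) : Subgroup G) := by
    intro P Q hPQ hDPQ
    have hDP : D < P := by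
      refine lt_of_le_of_ne (hDPQ ▸ inf_le_left) ?_
      intro h
      apply hPQ
      have : (P : Subgroup G) ≤ Q := by rw [← h, hDPQ]; exact inf_le_right
      exact Sylow.ext (P.is_maximal' Q.2 this).symm
    have hn : NormalizerCondition P := by
      have := P.2.isNilpotent
      exact Group.normalizerCondition_of_isNilpotent
    have h1 := hn (D.subgroupOf P) (by
      rw [lt_top_iff_ne_top, Ne, subgroupOf_eq_top]
      exact not_le_of_gt hDP)
    obtain ⟨x, hx, hxD⟩ := SetLike.exists_of_lt h1
    refine lt_of_le_of_ne (le_inf hDP.le le_normalizer) ?_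
    intro h
    apply hxD
    rw [mem_subgroupOf, h]
    refine mem_inf.2 ⟨x.2, ?_⟩
    rw [mem_normalizer_iff] at hx ⊢
    intro y
    constructor
    · intro hy
      exact (hx ⟨y, hDP.le hy⟩).1 hy
    · intro hy
      have hyP : y ∈ (P : Subgroup G) := by
        have h2 := mul_mem (mul_mem (inv_mem x.2) (hDP.le hy)) x.2
        have e : (x : G)⁻¹ * (x * y * (x : G)⁻¹) * x = y := by group
        rwa [e] at h2
      exact (hx ⟨y, hyP⟩).2 hy
  have key : ∀ P Q : Sylow p G, P ≠ Q → D = (P ⊓ Q : Subgroup G) → ∀ R : Subgroup G,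
      IsPGroup p R → (P ⊓ normalizer (D : Set G) : Subgroup G) ≤ R → R ≤ P := by
    intro P Q hPQ hDPQ R hR hle
    obtain ⟨P', hP'⟩ := hR.exists_le_sylow
    have hlt := grow P Q hPQ hDPQ
    by_cases hPP : P = P'
    · rw [hPP]; exact hP'
    · exfalso
      have h2 : (P ⊓ normalizer (D : Set G) : Subgroup G) ≤ (P ⊓ P' : Subgroup G) :=
        le_inf inf_le_left (hle.trans hP')
      exact not_lt_of_ge (hmax ⟨P, P', hPP, rfl⟩ (hlt.le.trans h2)) (hlt.trans_le h2)
  refine ⟨P, D, hDne, hDPQ ▸ inf_le_left, ?_, key P Q hPQ hDPQ⟩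
  rintro ⟨T, hT, hTmax⟩
  have h1 := hTmax _ inf_le_right (P.2.to_le inf_le_left)
  have h2 := hTmax _ inf_le_right (Q.2.to_le inf_le_left)
  have h3 := key P Q hPQ hDPQ T hT h1
  have h5 := grow Q P hPQ.symm (by rw [hDPQ, inf_comm])
  have h6 : (Q ⊓ normalizer (D : Set G) : Subgroup G) ≤ D := by
    rw [hDPQ]
    rw [hDPQ] at h2
    exact le_inf (h2.trans h3) inf_le_left
  exact not_lt_of_ge h6 h5

theorem commutator_ne_top_of_sylow {p : ℕ} [Fact p.Prime] {P : Sylow p G}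
    (hP : (P : Subgroup G) ≠ ⊥)
    (hTI : ∀ Q : Sylow p G, P ≠ Q → (P ⊓ Q : Subgroup G) = ⊥)
    (hN : Group.IsNilpotent (normalizer (P : Set G))) : _root_.commutator G ≠ ⊤ := by
  intro htop
  have h1 := Subgroup.commutator_inf_eq_focalSubgroup P
  rw [htop, top_inf_eq] at h1
  have h2 : (P : Subgroup G) ≤ ⁅(P : Subgroup G), normalizer (P : Set G)⁆ := by
    conv_lhs => rw [h1]
    rw [focalSubgroup_def, closure_le]
    rintro g ⟨hg, x, hx, u, rfl⟩
    by_cases hx1 : x = 1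
    · subst hx1
      rw [commutatorElement_one_left]
      exact one_mem _
    refine commutator_mem_commutator hx ?_
    have h3 : u * x⁻¹ * u⁻¹ ∈ (P : Subgroup G) := by
      have h4 := mul_mem (inv_mem hx) hg
      rwa [commutatorElement_def, show x⁻¹ * (x * u * x⁻¹ * u⁻¹) = u * x⁻¹ * u⁻¹ by group] at h4
    by_cases hPu : P = u • P
    · rw [← Sylow.smul_eq_iff_mem_normalizer, ← hPu]
    · exfalso
      have h5 := hTI (u • P) hPu
      have h6 : u * x⁻¹ * u⁻¹ ∈ (P ⊓ (u • P : Sylow p G) : Subgroup G) := by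
        refine mem_inf.2 ⟨h3, ?_⟩
        rw [Sylow.smul_def, Sylow.pointwise_smul_def]
        exact ⟨x⁻¹, inv_mem hx, rfl⟩
      rw [h5, mem_bot] at h6
      apply hx1
      rw [mul_inv_eq_one] at h6
      have : x⁻¹ = 1 := by simpa using h6
      simpa using this
  obtain ⟨k, hk⟩ := (isNilpotent_iff_lowerCentralSeries _).1 hN
  have h3 : ∀ k, (P : Subgroup G) ≤ (normalizer (P : Set G)).lowerCentralSeries k := by
    intro k
    induction k with
    | zero => exact le_normalizer
    | succ k ih => exact h2.trans (commutator_mono ih le_rfl)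
  exact hP (le_bot_iff.1 (hk ▸ h3 k))

omit [Finite G] in
theorem exists_isSimpleGroup_quotient (G : Type*) [Group G] [Finite G] [Nontrivial G] :
    ∃ (M : Subgroup G) (_ : M.Normal), IsSimpleGroup (G ⧸ M) := by
  let S : Set (Subgroup G) := {M | M.Normal ∧ M ≠ ⊤}
  obtain ⟨M, -, hM⟩ := (Set.toFinite S).exists_le_maximal
    (⟨inferInstance, bot_ne_top⟩ : (⊥ : Subgroup G) ∈ S)
  obtain ⟨⟨hMn, hMt⟩, hmax⟩ := hM
  refine ⟨M, hMn, ?_⟩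
  have hnt : Nontrivial (G ⧸ M) := by rwa [QuotientGroup.nontrivial_iff]
  refine ⟨fun H hH => ?_⟩
  have hsurj := QuotientGroup.mk'_surjective M
  have hle : M ≤ H.comap (QuotientGroup.mk' M) := by
    conv_lhs => rw [← QuotientGroup.ker_mk' M]
    exact ker_le_comap _ _
  by_cases hH1 : H.comap (QuotientGroup.mk' M) = ⊤
  · right
    rw [← Subgroup.map_comap_eq_self_of_surjective hsurj H, hH1, map_top_of_surjective _ hsurj]
  · left
    have h1 := hmax (⟨inferInstance, hH1⟩ : H.comap (QuotientGroup.mk' M) ∈ S) hle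
    rw [← Subgroup.map_comap_eq_self_of_surjective hsurj H, Subgroup.map_eq_bot_iff,
      QuotientGroup.ker_mk']
    exact h1

omit [Finite G] in
theorem exists_normal_index_prime (G : Type*) [Group G] [Finite G]
    (h : _root_.commutator G ≠ ⊤) : ∃ K : Subgroup G, K.Normal ∧ K.index.Prime := by
  have : Nontrivial (Abelianization G) := by
    change Nontrivial (G ⧸ _root_.commutator G)
    rwa [QuotientGroup.nontrivial_iff]
  obtain ⟨M, hM, hS⟩ := exists_isSimpleGroup_quotient (Abelianization G)
  have hsurj : Function.Surjective (Abelianization.of (G := G)) := QuotientGroup.mk_surjective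
  refine ⟨M.comap Abelianization.of, inferInstance, ?_⟩
  rw [index_comap_of_surjective _ hsurj, index_eq_card]
  exact IsSimpleGroup.prime_card

end SylowTools

section Schmidt

open Subgroup

theorem normalizer_ne_top_of_isSimpleGroup {G : Type*} [Group G] [IsSimpleGroup G]
    {D : Subgroup G} (hD : D ≠ ⊥) (hDt : D ≠ ⊤) : normalizer (D : Set G) ≠ ⊤ := fun h =>
  ((normalizer_eq_top_iff.1 h).eq_bot_or_eq_top).elim hD hDt

theorem isNilpotent_quotient_of_isNilpotent {G : Type*} [Group G] {M : Subgroup G} [M.Normal]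
    {H : Subgroup (G ⧸ M)} (hH : Group.IsNilpotent (H.comap (QuotientGroup.mk' M))) :
    Group.IsNilpotent H := by
  refine Group.nilpotent_of_surjective ((QuotientGroup.mk' M).subgroupComap H) ?_
  rintro ⟨x, hx⟩
  obtain ⟨y, rfl⟩ := QuotientGroup.mk'_surjective M x
  exact ⟨⟨y, hx⟩, rfl⟩

theorem comap_mk'_ne_top {G : Type*} [Group G] {M : Subgroup G} [M.Normal]
    {H : Subgroup (G ⧸ M)} (hH : H ≠ ⊤) : H.comap (QuotientGroup.mk' M) ≠ ⊤ := by
  intro h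
  apply hH
  have hsurj := QuotientGroup.mk'_surjective M
  rw [← Subgroup.map_comap_eq_self_of_surjective hsurj H, h, map_top_of_surjective _ hsurj]

theorem commutator_ne_top_of_isNilpotent_proper (G : Type*) [Group G] [Finite G] [Nontrivial G]
    (h : ∀ H : Subgroup G, H ≠ ⊤ → Group.IsNilpotent H) : _root_.commutator G ≠ ⊤ := by
  intro htop
  obtain ⟨M, hM, hS⟩ := exists_isSimpleGroup_quotient G
  have hsurj := QuotientGroup.mk'_surjective M
  have h' : ∀ H : Subgroup (G ⧸ M), H ≠ ⊤ → Group.IsNilpotent H := fun H hH =>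
    isNilpotent_quotient_of_isNilpotent (h _ (comap_mk'_ne_top hH))
  have htop' : _root_.commutator (G ⧸ M) = ⊤ := by
    have h1 : (_root_.commutator G).map (QuotientGroup.mk' M) = _root_.commutator (G ⧸ M) := by
      rw [_root_.commutator_def, map_commutator, map_top_of_surjective _ hsurj]; rfl
    rw [← h1, htop, map_top_of_surjective _ hsurj]
  have hnonil : ¬ Group.IsNilpotent (G ⧸ M) := by
    intro hn
    have : Group.IsSolvable (G ⧸ M) := inferInstance
    exact absurd htop' (ne_of_lt (Group.IsSolvable.commutator_lt_top_of_nontrivial _))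
  have hp : ∀ (p : ℕ), Fact p.Prime → ∀ D : Subgroup (G ⧸ M), IsPGroup p D → D ≠ ⊤ := by
    rintro p hp D hD rfl
    have := hD.isNilpotent
    exact hnonil (Group.isNilpotent_top.1 this)
  obtain ⟨p, hpp, hpd⟩ := Nat.exists_prime_and_dvd (Finite.one_lt_card (α := G ⧸ M)).ne'
  have := Fact.mk hpp
  obtain ⟨P⟩ : Nonempty (Sylow p (G ⧸ M)) := inferInstance
  have hPb : (P : Subgroup (G ⧸ M)) ≠ ⊥ := P.ne_bot_of_dvd_card hpd
  refine commutator_ne_top_of_sylow (P := P) hPb ?_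
    (h' _ (normalizer_ne_top_of_isSimpleGroup hPb (hp p this _ P.2))) htop'
  intro Q hPQ
  by_contra hinf
  obtain ⟨P', D, hDb, hDP, hno, -⟩ := exists_normalizer_of_sylow_inf_ne_bot hPQ hinf
  apply hno
  obtain ⟨T, -, hT, -, hmax⟩ := exists_max_pSubgroup_of_isNilpotent
    (h' _ (normalizer_ne_top_of_isSimpleGroup hDb (hp p this _ (P'.2.to_le hDP)))) p
  exact ⟨T, hT, hmax⟩

theorem mem_normalizer_of_finite {G : Type*} [Group G] [Finite G] {R : Subgroup G} {x : G}
    (h : ∀ r ∈ R, x * r * x⁻¹ ∈ R) : x ∈ normalizer (R : Set G) := by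
  have h1 : R.map (MulAut.conj x).toMonoidHom ≤ R := by
    rintro _ ⟨r, hr, rfl⟩
    exact h r hr
  have h2 : R.map (MulAut.conj x).toMonoidHom = R :=
    Subgroup.eq_of_le_of_card_ge h1
      (Nat.card_congr (R.equivMapOfInjective _ (MulAut.conj x).injective).toEquiv).le
  rw [mem_normalizer_iff]
  intro r
  refine ⟨h r, fun hr => ?_⟩
  rw [← h2] at hr
  obtain ⟨s, hs, hsr⟩ := hr
  have : s = r := by
    have : x * s * x⁻¹ = x * r * x⁻¹ := hsr
    simpa using this
  rwa [← this]

/-- The structure of a finite minimal non-nilpotent group. -/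
theorem exists_structure_of_minimalNonNilpotent {S : Type*} [Group S] [Finite S]
    (h : MinimalNonNilpotent S) : ∃ (p q : ℕ) (P : Subgroup S) (x : S) (a b : ℕ),
      p.Prime ∧ q.Prime ∧ p ≠ q ∧ P.Normal ∧ Nat.card P = p ^ a ∧ orderOf x = q ^ b ∧
      Nat.card S = p ^ a * q ^ b ∧ P ⊔ zpowers x = ⊤ ∧ x ^ q ∈ center S ∧
      (∀ R ≤ P, (∀ r ∈ R, x * r * x⁻¹ ∈ R) → R ≠ P → ∀ r ∈ R, x * r = r * x) ∧
      ¬ ∀ r ∈ P, x * r = r * x := by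
  obtain ⟨hnn, hsub⟩ := h
  have hnt : Nontrivial S := by
    by_contra hc
    rw [not_nontrivial_iff_subsingleton] at hc
    exact hnn inferInstance
  obtain ⟨K, hK, hKi⟩ := exists_normal_index_prime S (commutator_ne_top_of_isNilpotent_proper S hsub)
  set q := K.index with hq
  have hqf : Fact q.Prime := ⟨hKi⟩
  have hKt : K ≠ ⊤ := fun h => hKi.one_lt.ne' (by rw [hq, h, index_top])
  have hKnil := hsub K hKt
  have hsn : ∀ s : ℕ, Fact s.Prime → s ≠ q → ∀ P : Sylow s S, (P : Subgroup S).Normal := by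
    intro s hs hsq P
    have hPK : (P : Subgroup S) ≤ K := by
      have h1 : (P : Subgroup S).map (QuotientGroup.mk' K) = ⊥ := by
        have h2 := P.2.map (QuotientGroup.mk' K)
        have h3 : IsPGroup q ((P : Subgroup S).map (QuotientGroup.mk' K)) := by
          have : IsPGroup q (S ⧸ K) := IsPGroup.of_card (n := 1) (by
            rw [pow_one, hq, index_eq_card])
          exact this.to_subgroup _
        exact disjoint_self.1 (IsPGroup.disjoint_of_ne s q hsq _ _ h2 h3)
      rwa [Subgroup.map_eq_bot_iff, QuotientGroup.ker_mk'] at h1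
    have h1 : ((P.subtype hPK : Sylow s K) : Subgroup K).Characteristic :=
      Sylow.characteristic_of_normal _ inferInstance
    have h2 : (((P.subtype hPK : Sylow s K) : Subgroup K).map K.subtype).Normal :=
      ConjAct.normal_of_characteristic_of_normal
    have h3 : ((P.subtype hPK : Sylow s K) : Subgroup K).map K.subtype = P := by
      rw [Sylow.coe_subtype, subgroupOf_map_subtype, inf_eq_left.2 hPK]
    rwa [h3] at h2
  obtain ⟨Q⟩ : Nonempty (Sylow q S) := inferInstance
  have hQn : ¬ (Q : Subgroup S).Normal := by
    intro hQn
    apply hnn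
    apply isNilpotent_of_sylow_normal
    intro p hp
    by_cases hpq : p = q
    · subst hpq
      exact ⟨Q, hQn⟩
    · exact ⟨default, hsn p hp hpq _⟩
  have hcent : ∀ H P : Subgroup S, ∀ p : ℕ, Fact p.Prime → p ≠ q → IsPGroup p P →
      ∀ Q' : Subgroup S, IsPGroup q Q' → H ≠ ⊤ → P ≤ H → Q' ≤ H →
      ∀ y ∈ Q', ∀ r ∈ P, y * r = r * y := by
    intro H P p hp hpq hP Q' hQ' hH hPH hQH y hy r hr
    exact (commute_of_isNilpotent (hsub H hH) hpq hP hQ' hPH hQH hr hy).symm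
  obtain ⟨p, hp, hpq, P, hPQ⟩ : ∃ (p : ℕ) (_ : Fact p.Prime) (_ : p ≠ q) (P : Sylow p S),
      ¬ ∀ y ∈ (Q : Subgroup S), ∀ r ∈ (P : Subgroup S), y * r = r * y := by
    by_contra! hcon
    apply hQn
    rw [← normalizer_eq_top_iff]
    apply eq_top_of_sylow_le
    intro p hp
    by_cases hpq : p = q
    · subst hpq
      exact ⟨Q, le_normalizer⟩
    · refine ⟨default, ?_⟩
      rw [le_normalizer_iff]
      intro r hr y hy
      rw [← hcon p hp hpq default y hy r hr, mul_inv_cancel_right]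
      exact hy
  have hPn := hsn p hp hpq P
  obtain ⟨x, hxQ, hx⟩ : ∃ x ∈ (Q : Subgroup S), ¬ ∀ r ∈ (P : Subgroup S), x * r = r * x := by
    by_contra! hcon
    exact hPQ hcon
  have hdisj : Disjoint (P : Subgroup S) Q := IsPGroup.disjoint_of_ne p q hpq _ _ P.2 Q.2
  have hzQ : zpowers x ≤ Q := by rwa [zpowers_le]
  have hzP : IsPGroup q (zpowers x) := Q.2.to_le hzQ
  have hPz : (P : Subgroup S) ⊔ zpowers x = ⊤ := by
    by_contra hne
    exact hx (hcent _ P p hp hpq P.2 (zpowers x) hzP hne le_sup_left le_sup_right x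
      (mem_zpowers x))
  have hQz : (Q : Subgroup S) = zpowers x := by
    refine le_antisymm ?_ hzQ
    intro y hy
    obtain ⟨r, hr, z, hz, hrz⟩ := mem_sup_of_normal_left.1 (hPz ▸ mem_top y)
    have : r ∈ (Q : Subgroup S) := by
      have : r = y * z⁻¹ := by rw [← hrz]; group
      rw [this]
      exact mul_mem hy (inv_mem (hzQ hz))
    have hr1 : r = 1 := Subgroup.disjoint_def.1 hdisj hr this
    rw [← hrz, hr1, one_mul]
    exact hz
  obtain ⟨a, ha⟩ := IsPGroup.iff_card.1 P.2
  obtain ⟨b, hb⟩ := IsPGroup.iff_card.1 hzP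
  have hx1 : x ≠ 1 := by
    rintro rfl
    exact hx (by simp)
  have sup_top : ∀ R ≤ (P : Subgroup S), ∀ y ∈ zpowers x, y ∈ normalizer (R : Set S) →
      R ⊔ zpowers y = ⊤ → R = P ∧ zpowers y = zpowers x := by
    intro R hRP y hyx hy htop
    have hzy : zpowers y ≤ zpowers x := by rwa [zpowers_le]
    have hzn : zpowers y ≤ normalizer (R : Set S) := by rwa [zpowers_le]
    have hdec : ∀ g : S, ∃ r ∈ R, ∃ z ∈ zpowers y, r * z = g := by
      intro g
      have : g ∈ ((R ⊔ zpowers y : Subgroup S) : Set S) := by rw [htop]; exact mem_top g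
      rw [Subgroup.coe_mul_of_right_le_normalizer_left _ _ hzn] at this
      exact Set.mem_mul.1 this
    constructor
    · refine le_antisymm hRP ?_
      intro g hg
      obtain ⟨r, hr, z, hz, rfl⟩ := hdec g
      have h1 : z ∈ (P : Subgroup S) := (mul_mem_cancel_left (hRP hr)).1 hg
      have : z = 1 := Subgroup.disjoint_def.1 hdisj h1 (hzQ (hzy hz))
      rwa [this, mul_one]
    · refine le_antisymm hzy ?_
      intro g hg
      obtain ⟨r, hr, z, hz, rfl⟩ := hdec g
      have h1 : r ∈ zpowers x := (mul_mem_cancel_right (hzy hz)).1 hg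
      have : r = 1 := Subgroup.disjoint_def.1 hdisj (hRP hr) (hzQ h1)
      rwa [this, one_mul]
  refine ⟨p, q, P, x, a, b, hp.1, hKi, hpq, hPn, ha, by rw [← Nat.card_zpowers, hb], ?_, hPz,
    ?_, ?_, hx⟩
  · rw [← ha, ← hb, ← hQz]
    have : IsComplement' (P : Subgroup S) Q :=
      isComplement'_of_disjoint_and_mul_eq_univ hdisj (by
        refine Set.eq_univ_of_forall fun g => ?_
        obtain ⟨r, hr, z, hz, rfl⟩ := mem_sup_of_normal_left.1 (hPz ▸ mem_top g)
        exact Set.mul_mem_mul hr (hzQ hz))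
    exact this.card_mul_card.symm
  · have hy : x ^ q ∈ zpowers x := pow_mem (mem_zpowers x) q
    have hne : zpowers (x ^ q) ≠ zpowers x := by
      intro heq
      have h1 : orderOf (x ^ q) = orderOf x := by
        rw [← Nat.card_zpowers, heq, Nat.card_zpowers]
      have h2 : orderOf x = q ^ b := by rw [← Nat.card_zpowers, hb]
      have hb0 : b ≠ 0 := by
        rintro rfl
        rw [pow_zero, orderOf_eq_one_iff] at h2
        exact hx1 h2
      have h3 : q ∣ orderOf x := by rw [h2]; exact dvd_pow_self q hb0
      rw [orderOf_pow_of_dvd hKi.ne_zero h3] at h1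
      exact absurd h1 (Nat.div_lt_self (orderOf_pos x) hKi.one_lt).ne
    have hPy : (P : Subgroup S) ⊔ zpowers (x ^ q) ≠ ⊤ := fun htop =>
      hne (sup_top P le_rfl _ hy (by rw [normalizer_eq_top_iff.2 hPn]; exact mem_top _) htop).2
    rw [mem_center_iff]
    intro g
    obtain ⟨r, hr, z, hz, rfl⟩ := mem_sup_of_normal_left.1 (hPz ▸ mem_top g)
    have h1 := hcent _ P p hp hpq P.2 (zpowers (x ^ q)) (hzP.to_le (by rwa [zpowers_le])) hPy
      le_sup_left le_sup_right _ (mem_zpowers _) r hr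
    obtain ⟨k, rfl⟩ := mem_zpowers_iff.1 hz
    have h2 : x ^ q * x ^ k = x ^ k * x ^ q := ((Commute.refl x).pow_left q).zpow_right k
    rw [mul_assoc, ← h2, ← mul_assoc, ← mul_assoc, h1]
  · intro R hRP hRx hRne r hr
    have hne : R ⊔ zpowers x ≠ ⊤ := fun htop =>
      hRne (sup_top R hRP x (mem_zpowers x) (mem_normalizer_of_finite hRx) htop).1
    exact hcent _ R p hp hpq (P.2.to_le hRP) (zpowers x) hzP hne le_sup_left le_sup_right x
      (mem_zpowers x) r hr

end Schmidt

section NonPerfect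

open Subgroup

/-- Every proper subgroup is nilpotent or minimal non-nilpotent. -/
def ProperNilpotentOrMinimal (G : Type*) [Group G] : Prop :=
  ∀ H : Subgroup G, H ≠ ⊤ → (Group.IsNilpotent H ∨ MinimalNonNilpotent H)

theorem ProperNilpotentOrMinimal.isNilpotent_of_lt {G : Type*} [Group G]
    (hsub : ProperNilpotentOrMinimal G) {H L : Subgroup G} (hHL : H < L) (hL : L ≠ ⊤) :
    Group.IsNilpotent H := by
  have h1 : Group.IsNilpotent (H.subgroupOf L) := by
    rcases hsub L hL with h | h
    · infer_instance
    · refine h.2 _ ?_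
      rw [Ne, subgroupOf_eq_top]
      exact not_le_of_gt hHL
  exact Group.nilpotent_of_surjective (subgroupOfEquivOfLe hHL.le).toMonoidHom
    (subgroupOfEquivOfLe hHL.le).surjective

theorem ProperNilpotentOrMinimal.eq_of_le {G : Type*} [Group G]
    (hsub : ProperNilpotentOrMinimal G) {H L : Subgroup G} (hH : ¬ Group.IsNilpotent H)
    (hHL : H ≤ L) (hL : L ≠ ⊤) : H = L := by
  by_contra hne
  exact hH (hsub.isNilpotent_of_lt (lt_of_le_of_ne hHL hne) hL)

theorem dvd_card_sup_normal {G : Type*} [Group G] [Finite G] {N H : Subgroup G} [N.Normal] {p : ℕ}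
    (hp : p.Prime) (h : p ∣ Nat.card (H ⊔ N : Subgroup G)) : p ∣ Nat.card H ∨ p ∣ Nat.card N := by
  rw [← relIndex_bot_left, ← relIndex_mul_relIndex ⊥ N (H ⊔ N) bot_le le_sup_right,
    relIndex_bot_left, relIndex_sup_right] at h
  rcases (Nat.Prime.dvd_mul hp).1 h with h | h
  · exact Or.inr h
  · exact Or.inl (h.trans (relIndex_dvd_card N H))

theorem sylow_normal_of_nilpotent_index_prime {S : Type*} [Group S] [Finite S] {K : Subgroup S}
    [hK : K.Normal] (hKi : K.index.Prime) (hKnil : Group.IsNilpotent K) {s : ℕ} [hs : Fact s.Prime]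
    (hsq : s ≠ K.index) (P : Sylow s S) : (P : Subgroup S).Normal := by
  have hqf : Fact K.index.Prime := ⟨hKi⟩
  have hPK : (P : Subgroup S) ≤ K := by
    have h1 : (P : Subgroup S).map (QuotientGroup.mk' K) = ⊥ := by
      have h2 := P.2.map (QuotientGroup.mk' K)
      have h3 : IsPGroup K.index ((P : Subgroup S).map (QuotientGroup.mk' K)) := by
        have : IsPGroup K.index (S ⧸ K) := IsPGroup.of_card (n := 1) (by
          rw [pow_one, index_eq_card])
        exact this.to_subgroup _
      exact disjoint_self.1 (IsPGroup.disjoint_of_ne s K.index hsq _ _ h2 h3)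
    rwa [Subgroup.map_eq_bot_iff, QuotientGroup.ker_mk'] at h1
  have h1 : ((P.subtype hPK : Sylow s K) : Subgroup K).Characteristic :=
    Sylow.characteristic_of_normal _ inferInstance
  have h2 : (((P.subtype hPK : Sylow s K) : Subgroup K).map K.subtype).Normal :=
    ConjAct.normal_of_characteristic_of_normal
  have h3 : ((P.subtype hPK : Sylow s K) : Subgroup K).map K.subtype = P := by
    rw [Sylow.coe_subtype, subgroupOf_map_subtype, inf_eq_left.2 hPK]
  rwa [h3] at h2

theorem card_primeFactors_le_three_of_commutator_ne_top {G : Type*} [Group G] [Finite G]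
    (hnn : ¬ Group.IsNilpotent G) (hsub : ProperNilpotentOrMinimal G) (hc : commutator G ≠ ⊤) :
    (Nat.card G).primeFactors.card ≤ 3 := by
  obtain ⟨K, hK, hKi⟩ := exists_normal_index_prime G hc
  have hKt : K ≠ ⊤ := fun h => hKi.one_lt.ne' (by rw [h, index_top])
  rcases hsub K hKt with hnil | hmin
  · have hrf : Fact K.index.Prime := ⟨hKi⟩
    have hsn := @sylow_normal_of_nilpotent_index_prime _ _ _ K hK hKi hnil
    obtain ⟨R⟩ : Nonempty (Sylow K.index G) := inferInstance
    obtain ⟨s, hs, hsr, S, hSR⟩ : ∃ (s : ℕ) (_ : Fact s.Prime) (_ : s ≠ K.index) (S : Sylow s G),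
        ¬ Group.IsNilpotent ((R : Subgroup G) ⊔ S : Subgroup G) := by
      by_contra! hcon
      apply hnn
      apply isNilpotent_of_sylow_normal
      intro p hp
      by_cases hpq : p = K.index
      · subst hpq
        refine ⟨R, ?_⟩
        rw [← normalizer_eq_top_iff]
        apply eq_top_of_sylow_le
        intro s hs
        by_cases hsr : s = K.index
        · subst hsr
          exact ⟨R, le_normalizer⟩
        · refine ⟨default, ?_⟩
          rw [le_normalizer_iff]
          intro x hx y hy
          rw [commute_of_isNilpotent (hcon s hs hsr default) hsr (default : Sylow s G).2 R.2
            le_sup_right le_sup_left hx hy, mul_inv_cancel_right]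
          exact hy
      · exact ⟨default, hsn hpq _⟩
    have hSn := hsn hsr S
    by_contra! hcard
    have hpdvd : ∀ {u t : ℕ}, u.Prime → ∀ [Fact t.Prime] (T : Sylow t G),
        u ∣ Nat.card T → u = t := by
      intro u t hu ht T h
      obtain ⟨n, hn⟩ := IsPGroup.iff_card.1 T.2
      rw [hn] at h
      exact (Nat.prime_dvd_prime_iff_eq hu ht.1).1 (hu.dvd_of_dvd_pow h)
    obtain ⟨t, ht, ht2⟩ : ∃ t ∈ (Nat.card G).primeFactors, t ∉ ({K.index, s} : Finset ℕ) := by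
      by_contra! hcon
      have := (Finset.card_le_card hcon).trans Finset.card_le_two
      omega
    obtain ⟨u, hu, hu2⟩ : ∃ v ∈ (Nat.card G).primeFactors, v ∉ ({K.index, s, t} : Finset ℕ) := by
      by_contra! hcon
      have := (Finset.card_le_card hcon).trans Finset.card_le_three
      omega
    simp only [Finset.mem_insert, Finset.mem_singleton, not_or] at ht2 hu2
    have htp := Nat.prime_of_mem_primeFactors ht
    have hup := Nat.prime_of_mem_primeFactors hu
    have htf : Fact t.Prime := ⟨htp⟩
    obtain ⟨T⟩ : Nonempty (Sylow t G) := inferInstance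
    have hTn := hsn ht2.1 T
    have h1 : ((R : Subgroup G) ⊔ S) ⊔ T ≠ ⊤ := by
      intro htop
      have h2 : u ∣ Nat.card (((R : Subgroup G) ⊔ S) ⊔ T : Subgroup G) := by
        rw [htop, Subgroup.card_top]
        exact Nat.dvd_of_mem_primeFactors hu
      rcases dvd_card_sup_normal hup h2 with h | h
      · rcases dvd_card_sup_normal hup h with h | h
        · exact hu2.1 (hpdvd hup R h)
        · exact hu2.2.1 (hpdvd hup S h)
      · exact hu2.2.2 (hpdvd hup T h)
    have h3 := hsub.eq_of_le hSR le_sup_left h1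
    have h4 : t ∣ Nat.card ((R : Subgroup G) ⊔ S : Subgroup G) := by
      rw [h3]
      exact (T.dvd_card_of_dvd_card (Nat.dvd_of_mem_primeFactors ht)).trans
        (Subgroup.card_dvd_of_le le_sup_right)
    rcases dvd_card_sup_normal htp h4 with h | h
    · exact ht2.1 (hpdvd htp R h)
    · exact ht2.2 (hpdvd htp S h)
  · obtain ⟨p, q, -, -, a, b, hp, hq, -, -, -, -, hcK, -⟩ :=
      exists_structure_of_minimalNonNilpotent hmin
    have h1 : (Nat.card G).primeFactors ⊆ {p, q, K.index} := by
      intro s hs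
      have hsp := Nat.prime_of_mem_primeFactors hs
      have h2 := Nat.dvd_of_mem_primeFactors hs
      rw [← K.card_mul_index, hcK] at h2
      simp only [Finset.mem_insert, Finset.mem_singleton]
      rcases hsp.dvd_mul.1 h2 with h | h
      · rcases hsp.dvd_mul.1 h with h | h
        · exact Or.inl ((Nat.prime_dvd_prime_iff_eq hsp hp).1 (hsp.dvd_of_dvd_pow h))
        · exact Or.inr (Or.inl ((Nat.prime_dvd_prime_iff_eq hsp hq).1 (hsp.dvd_of_dvd_pow h)))
      · exact Or.inr (Or.inr ((Nat.prime_dvd_prime_iff_eq hsp hKi).1 h))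
    exact (Finset.card_le_card h1).trans Finset.card_le_three

end NonPerfect

section Perfect

open Subgroup

theorem ProperNilpotentOrMinimal.quotient {G : Type*} [Group G] (hsub : ProperNilpotentOrMinimal G)
    (M : Subgroup G) [M.Normal] : ProperNilpotentOrMinimal (G ⧸ M) := by
  intro H hH
  by_cases hn : Group.IsNilpotent H
  · exact Or.inl hn
  refine Or.inr ⟨hn, fun K hK => ?_⟩
  have hlt : K.map H.subtype < H := by
    refine lt_of_le_of_ne (map_subtype_le K) fun h => hK ?_
    apply map_injective H.subtype_injective
    rw [h, ← MonoidHom.range_eq_map, range_subtype]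
  have h1 : Group.IsNilpotent (K.map H.subtype) := by
    apply isNilpotent_quotient_of_isNilpotent
    refine hsub.isNilpotent_of_lt ?_ (comap_mk'_ne_top hH)
    refine lt_of_le_of_ne (comap_mono hlt.le) fun h => hlt.ne ?_
    exact comap_injective (QuotientGroup.mk'_surjective M) h
  exact Group.nilpotent_of_surjective
    (K.equivMapOfInjective H.subtype H.subtype_injective).symm.toMonoidHom
    (K.equivMapOfInjective H.subtype H.subtype_injective).symm.surjective

theorem isSolvable_of_normal {G : Type*} [Group G] (N : Subgroup G) [N.Normal]
    (h1 : Group.IsSolvable N) (h2 : Group.IsSolvable (G ⧸ N)) : Group.IsSolvable G :=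
  Group.isSolvable_of_ker_le_range N.subtype (QuotientGroup.mk' N) (by simp)

theorem isSolvable_of_minimalNonNilpotent {S : Type*} [Group S] [Finite S]
    (h : MinimalNonNilpotent S) : Group.IsSolvable S := by
  have hnt : Nontrivial S := by
    by_contra hc
    rw [not_nontrivial_iff_subsingleton] at hc
    exact h.1 inferInstance
  have h1 := h.2 _ (commutator_ne_top_of_isNilpotent_proper S h.2)
  have h2 : Group.IsSolvable (_root_.commutator S) := inferInstance
  have h3 : Group.IsSolvable (S ⧸ _root_.commutator S) :=
    inferInstanceAs (Group.IsSolvable (Abelianization S))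
  exact isSolvable_of_normal _ h2 h3

theorem ProperNilpotentOrMinimal.isSolvable {G : Type*} [Group G] [Finite G]
    (hsub : ProperNilpotentOrMinimal G) {H : Subgroup G} (hH : H ≠ ⊤) : Group.IsSolvable H := by
  rcases hsub H hH with h | h
  · infer_instance
  · exact isSolvable_of_minimalNonNilpotent h

theorem isSolvable_quotient_of_sup_eq_top {G : Type*} [Group G] {H N : Subgroup G} [N.Normal]
    (h : H ⊔ N = ⊤) (hH : Group.IsSolvable H) : Group.IsSolvable (G ⧸ N) := by
  refine Group.isSolvable_of_surjective (f := (QuotientGroup.mk' N).comp H.subtype) ?_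
  intro y
  obtain ⟨g, rfl⟩ := QuotientGroup.mk'_surjective N y
  obtain ⟨r, hr, z, hz, rfl⟩ := mem_sup_of_normal_right.1 (h ▸ mem_top g)
  refine ⟨⟨r, hr⟩, ?_⟩
  simpa [QuotientGroup.eq] using hz

theorem commutator_quotient_eq_top {G : Type*} [Group G] (M : Subgroup G) [M.Normal]
    (h : commutator G = ⊤) : commutator (G ⧸ M) = ⊤ := by
  have hsurj := QuotientGroup.mk'_surjective M
  have h1 : (_root_.commutator G).map (QuotientGroup.mk' M) = _root_.commutator (G ⧸ M) := by
    rw [_root_.commutator_def, map_commutator, map_top_of_surjective _ hsurj]; rfl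
  rw [← h1, h, map_top_of_surjective _ hsurj]

theorem not_isSolvable_of_commutator_eq_top {G : Type*} [Group G] [Nontrivial G]
    (h : commutator G = ⊤) : ¬ Group.IsSolvable G := fun _ =>
  absurd h (ne_of_lt (Group.IsSolvable.commutator_lt_top_of_nontrivial _))

theorem primeFactors_subset_quotient {G : Type*} [Group G] [Finite G] [Nontrivial G]
    (hsub : ProperNilpotentOrMinimal G) (hc : commutator G = ⊤) (M : Subgroup G) [M.Normal]
    [Nontrivial (G ⧸ M)] : (Nat.card G).primeFactors ⊆ (Nat.card (G ⧸ M)).primeFactors := by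
  intro p hp
  have hpp := Nat.prime_of_mem_primeFactors hp
  have hpf : Fact p.Prime := ⟨hpp⟩
  by_contra hpd
  have hpd : ¬ p ∣ Nat.card (G ⧸ M) := fun h =>
    hpd (Nat.mem_primeFactors.2 ⟨hpp, h, Nat.card_pos.ne'⟩)
  obtain ⟨P⟩ : Nonempty (Sylow p G) := inferInstance
  have hPM : (P : Subgroup G) ≤ M := by
    have h1 : (P : Subgroup G).map (QuotientGroup.mk' M) = ⊥ := by
      obtain ⟨k, hk⟩ := IsPGroup.iff_card.1 (P.2.map (QuotientGroup.mk' M))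
      rw [eq_bot_iff_card, hk]
      rcases Nat.eq_zero_or_pos k with rfl | hk0
      · rfl
      · exact absurd (((dvd_pow_self p hk0.ne').trans hk.symm.dvd).trans (card_subgroup_dvd_card _))
          hpd
    rwa [Subgroup.map_eq_bot_iff, QuotientGroup.ker_mk'] at h1
  have hfrat := Sylow.normalizer_sup_eq_top' P hPM
  by_cases hN : normalizer ((P : Subgroup G) : Set G) = ⊤
  · have hPn : (P : Subgroup G).Normal := normalizer_eq_top_iff.1 hN
    have hcop : (Nat.card P).Coprime (P : Subgroup G).index := P.card_coprime_index
    obtain ⟨H, hH⟩ := exists_right_complement'_of_coprime hcop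
    have hHt : H ≠ ⊤ := by
      rintro rfl
      exact P.ne_bot_of_dvd_card (Nat.dvd_of_mem_primeFactors hp)
        (isComplement'_top_right.1 hH)
    have h1 := isSolvable_quotient_of_sup_eq_top ((sup_comm H (P : Subgroup G)).trans hH.sup_eq_top)
      (hsub.isSolvable hHt)
    have := P.2.isNilpotent
    exact not_isSolvable_of_commutator_eq_top hc (isSolvable_of_normal _ inferInstance h1)
  · exact not_isSolvable_of_commutator_eq_top (commutator_quotient_eq_top M hc)
      (isSolvable_quotient_of_sup_eq_top hfrat (hsub.isSolvable hN))

end Perfect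

section SimpleTI

open Subgroup

theorem le_of_isPGroup_of_coprime_index {S : Type*} [Group S] [Finite S] {R Q : Subgroup S}
    [R.Normal] {p q b : ℕ} [hp : Fact p.Prime] [hq : Fact q.Prime] (hpq : p ≠ q)
    (hR : R.index = q ^ b) (hQ : IsPGroup p Q) : Q ≤ R := by
  have h1 : Q.map (QuotientGroup.mk' R) = ⊥ := by
    have h2 := hQ.map (QuotientGroup.mk' R)
    have h3 : IsPGroup q (Q.map (QuotientGroup.mk' R)) := by
      have : IsPGroup q (S ⧸ R) := IsPGroup.of_card (n := b) (by
        rw [← hR, index_eq_card])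
      exact this.to_subgroup _
    exact disjoint_self.1 (IsPGroup.disjoint_of_ne p q hpq _ _ h2 h3)
  rwa [Subgroup.map_eq_bot_iff, QuotientGroup.ker_mk'] at h1

theorem sylow_isCyclic_of_minimalNonNilpotent {S : Type*} [Group S] [Finite S]
    (h : MinimalNonNilpotent S) {p : ℕ} [hp : Fact p.Prime]
    (hno : ¬ ∃ T : Subgroup S, IsPGroup p T ∧ ∀ Q : Subgroup S, IsPGroup p Q → Q ≤ T)
    (T : Sylow p S) : (∃ y, (T : Subgroup S) = zpowers y) ∧
      ∀ g ∈ normalizer ((T : Subgroup S) : Set S), ∀ y ∈ (T : Subgroup S), g * y = y * g := by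
  obtain ⟨p0, q, R, x, a, b, hp0, hq, hpq, hRn, hR, hx, hS, hsup, -, -, -⟩ :=
    exists_structure_of_minimalNonNilpotent h
  have hqf : Fact q.Prime := ⟨hq⟩
  have hp0f : Fact p0.Prime := ⟨hp0⟩
  have hRi : R.index = q ^ b := by
    have := R.card_mul_index
    rw [hS, hR] at this
    exact Nat.eq_of_mul_eq_mul_left (pow_pos hp0.pos a) this
  have hRp : IsPGroup p0 R := IsPGroup.of_card hR
  have hpq : p = q := by
    by_contra hne
    apply hno
    by_cases hpp : p = p0
    · subst hpp
      exact ⟨R, hRp, fun Q hQ => le_of_isPGroup_of_coprime_index hne hRi hQ⟩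
    · refine ⟨⊥, IsPGroup.of_bot, fun Q hQ => ?_⟩
      have h1 : Q ≤ R := le_of_isPGroup_of_coprime_index hne hRi hQ
      have h2 := IsPGroup.disjoint_of_ne p p0 hpp Q R hQ hRp
      exact h2 le_rfl h1
  subst hpq
  have hfac : (Nat.card S).factorization p = b := by
    rw [hS, Nat.factorization_mul (pow_pos hp0.pos a).ne' (pow_pos hq.pos b).ne',
      hp0.factorization_pow, hq.factorization_pow]
    simp [‹p0 ≠ p›]
  let X : Sylow p S := Sylow.ofCard (zpowers x) (by rw [Nat.card_zpowers, hx, hfac])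
  obtain ⟨g, hg⟩ := MulAction.exists_smul_eq S X T
  have hT : (T : Subgroup S) = zpowers (g * x * g⁻¹) := by
    rw [← hg, Sylow.smul_def, Sylow.pointwise_smul_def]
    change (zpowers x).map (MulAut.conj g).toMonoidHom = _
    rw [MonoidHom.map_zpowers]
    rfl
  have hdisj : Disjoint R (T : Subgroup S) :=
    IsPGroup.disjoint_of_ne p0 p ‹p0 ≠ p› _ _ hRp T.2
  have hsupT : R ⊔ T = ⊤ := by
    have h1 : (R ⊔ zpowers x).map (MulAut.conj g).toMonoidHom = ⊤ := by
      rw [hsup, map_top_of_surjective _ (MulAut.conj g).surjective]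
    rw [Subgroup.map_sup, MonoidHom.map_zpowers] at h1
    rw [hT, eq_top_iff, ← h1]
    refine sup_le_sup ?_ (by rfl)
    rintro _ ⟨r, hr, rfl⟩
    exact hRn.conj_mem r hr g
  refine ⟨⟨_, hT⟩, fun c hc y hy => ?_⟩
  obtain ⟨r, hr, t, ht, rfl⟩ := mem_sup_of_normal_left.1 (hsupT ▸ mem_top c)
  have hty : t * y = y * t := by
    rw [hT] at ht hy
    obtain ⟨i, rfl⟩ := mem_zpowers_iff.1 ht
    obtain ⟨j, rfl⟩ := mem_zpowers_iff.1 hy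
    rw [← zpow_add, ← zpow_add, add_comm]
  have hrn : r ∈ normalizer ((T : Subgroup S) : Set S) := by
    have := mul_mem hc (inv_mem (le_normalizer ht))
    rwa [mul_inv_cancel_right] at this
  have h1 : r * y * r⁻¹ * y⁻¹ ∈ (T : Subgroup S) :=
    mul_mem ((mem_normalizer_iff.1 hrn y).1 hy) (inv_mem hy)
  have h2 : r * y * r⁻¹ * y⁻¹ ∈ R := by
    have := mul_mem hr (hRn.conj_mem _ (inv_mem hr) y)
    simpa only [mul_assoc] using this
  have h3 : r * y = y * r := by
    have := Subgroup.disjoint_def.1 hdisj h2 h1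
    rw [mul_inv_eq_one, mul_inv_eq_iff_eq_mul] at this
    exact this
  rw [mul_assoc, hty, ← mul_assoc, h3, mul_assoc]

variable {G : Type*} [Group G] [Finite G]

theorem normalizer_zpowers_le {D : Subgroup G} {y : G} (hD : D ≤ zpowers y) :
    normalizer ((zpowers y : Subgroup G) : Set G) ≤ normalizer (D : Set G) := by
  intro g hg
  apply mem_normalizer_of_finite
  intro d hd
  obtain ⟨k, rfl⟩ := mem_zpowers_iff.1 (hD hd)
  obtain ⟨m, hm⟩ := mem_zpowers_iff.1 ((mem_normalizer_iff.1 hg y).1 (mem_zpowers y))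
  rw [← conj_zpow, ← hm, zpow_comm]
  exact zpow_mem hd m

theorem isSimpleGroup_sylow_inf_eq_bot [IsSimpleGroup G] (hsub : ProperNilpotentOrMinimal G)
    (hc : commutator G = ⊤) {p : ℕ} [hp : Fact p.Prime] (P Q : Sylow p G) (hPQ : P ≠ Q) :
    ((P : Subgroup G) ⊓ Q : Subgroup G) = ⊥ := by
  by_contra hinf
  obtain ⟨P, D, hDb, hDP, hno, hmax⟩ := exists_normalizer_of_sylow_inf_ne_bot hPQ hinf
  have hPt : (P : Subgroup G) ≠ ⊤ := by
    intro h
    have h1 := P.2.isNilpotent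
    rw [h] at h1
    have h2 := Group.isNilpotent_top.1 h1
    exact not_isSolvable_of_commutator_eq_top hc inferInstance
  have hDt : D ≠ ⊤ := fun h => hPt (top_le_iff.1 (h ▸ hDP))
  have hND := normalizer_ne_top_of_isSimpleGroup hDb hDt
  set N := normalizer (D : Set G) with hN
  rcases hsub N hND with hnil | hmin
  · obtain ⟨T, -, hT, -, hm⟩ := exists_max_pSubgroup_of_isNilpotent hnil p
    exact hno ⟨T, hT, hm⟩
  have hno' : ¬ ∃ T : Subgroup N, IsPGroup p T ∧ ∀ Q : Subgroup N, IsPGroup p Q → Q ≤ T := by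
    rintro ⟨T, hT, hm⟩
    refine hno ⟨T.map N.subtype, hT.map _, fun Q hQN hQ => ?_⟩
    have h1 := hm (Q.subgroupOf N) (hQ.comap_subtype)
    have h2 := map_mono (f := N.subtype) h1
    rwa [subgroupOf_map_subtype, inf_eq_left.2 hQN] at h2
  let T : Sylow p N := ⟨(P : Subgroup G).subgroupOf N, P.2.comap_subtype, by
    intro Q hQ hPQ
    refine le_antisymm ?_ hPQ
    have h1 : (P : Subgroup G) ⊓ N ≤ Q.map N.subtype := by
      rw [← subgroupOf_map_subtype]; exact map_mono hPQ
    have h2 := hmax _ (hQ.map N.subtype) h1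
    intro y hy
    exact mem_subgroupOf.2 (h2 ⟨y, hy, rfl⟩)⟩
  obtain ⟨⟨y, hy⟩, hcent⟩ := sylow_isCyclic_of_minimalNonNilpotent hmin hno' T
  have hTmap : (P : Subgroup G) ⊓ N = zpowers (y : G) := by
    rw [← subgroupOf_map_subtype]
    change (T : Subgroup N).map N.subtype = _
    rw [hy, MonoidHom.map_zpowers]
    rfl
  have hDT : D ≤ zpowers (y : G) := by rw [← hTmap]; exact le_inf hDP le_normalizer
  have hTN : normalizer ((zpowers (y : G) : Subgroup G) : Set G) ≤ N := normalizer_zpowers_le hDT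
  have hPN : (P : Subgroup G) ≤ N := by
    by_contra hcon
    have := P.2.isNilpotent
    have h1 : (N.subgroupOf (P : Subgroup G)) < ⊤ := by
      rw [lt_top_iff_ne_top, Ne, subgroupOf_eq_top]
      exact hcon
    obtain ⟨g, hg, hgn⟩ := SetLike.exists_of_lt
      (Group.normalizerCondition_of_isNilpotent (N.subgroupOf (P : Subgroup G)) h1)
    apply hgn
    rw [mem_subgroupOf]
    apply hTN
    apply mem_normalizer_of_finite
    rw [← hTmap]
    intro r hr
    have h2 := (mem_normalizer_iff.1 hg ⟨r, (mem_inf.1 hr).1⟩).1 (mem_subgroupOf.2 (mem_inf.1 hr).2)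
    exact mem_inf.2 ⟨mul_mem (mul_mem g.2 (mem_inf.1 hr).1) (inv_mem g.2), mem_subgroupOf.1 h2⟩
  rw [inf_eq_left.2 hPN] at hTmap
  have hburn : normalizer ((P : Subgroup G) : Set G) ≤ centralizer ((P : Subgroup G) : Set G) := by
    intro g hg
    have hgN : g ∈ N := hTN (by rwa [← hTmap])
    rw [mem_centralizer_iff]
    intro r hr
    have h1 := hcent ⟨g, hgN⟩ (by
      apply mem_normalizer_of_finite
      intro t ht
      exact mem_subgroupOf.2 ((mem_normalizer_iff.1 hg _).1 (mem_subgroupOf.1 ht)))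
      ⟨r, hPN hr⟩ (mem_subgroupOf.2 hr)
    exact (congrArg Subtype.val h1).symm
  have hcompl := MonoidHom.ker_transferSylow_isComplement' P hburn
  rcases (MonoidHom.normal_ker (MonoidHom.transferSylow P hburn)).eq_bot_or_eq_top with h | h
  · rw [h] at hcompl
    exact hPt (isComplement'_bot_left.1 hcompl)
  · rw [h] at hcompl
    exact hDb (le_bot_iff.1 (hDP.trans (isComplement'_top_left.1 hcompl).le))

end SimpleTI

section SimpleNormalizer

open Subgroup

variable {G : Type*} [Group G] [Finite G]

theorem sylow_ne_top (hc : commutator G = ⊤) [Nontrivial G] {p : ℕ} [Fact p.Prime]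
    (P : Sylow p G) : (P : Subgroup G) ≠ ⊤ := by
  intro h
  have h1 := P.2.isNilpotent
  rw [h] at h1
  have h2 := Group.isNilpotent_top.1 h1
  exact not_isSolvable_of_commutator_eq_top hc inferInstance

theorem normalizer_sylow_ne_top [IsSimpleGroup G] (hc : commutator G = ⊤) {p : ℕ} [Fact p.Prime]
    (P : Sylow p G) (hP : (P : Subgroup G) ≠ ⊥) :
    normalizer ((P : Subgroup G) : Set G) ≠ ⊤ :=
  normalizer_ne_top_of_isSimpleGroup hP (sylow_ne_top hc P)

theorem not_isNilpotent_normalizer_sylow [IsSimpleGroup G] (hsub : ProperNilpotentOrMinimal G)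
    (hc : commutator G = ⊤) {p : ℕ} [Fact p.Prime] (P : Sylow p G) (hP : (P : Subgroup G) ≠ ⊥) :
    ¬ Group.IsNilpotent (normalizer ((P : Subgroup G) : Set G)) := fun h =>
  commutator_ne_top_of_sylow hP (isSimpleGroup_sylow_inf_eq_bot hsub hc P) h hc

theorem exists_normalizer_structure [IsSimpleGroup G] (hsub : ProperNilpotentOrMinimal G)
    (hc : commutator G = ⊤) {p : ℕ} [hp : Fact p.Prime] (P : Sylow p G)
    (hP : (P : Subgroup G) ≠ ⊥) : ∃ (q : ℕ) (x : G) (b : ℕ), q.Prime ∧ p ≠ q ∧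
      orderOf x = q ^ b ∧ x ∈ normalizer ((P : Subgroup G) : Set G) ∧
      Nat.card (normalizer ((P : Subgroup G) : Set G)) = Nat.card P * q ^ b ∧
      (P : Subgroup G) ⊔ zpowers x = normalizer ((P : Subgroup G) : Set G) ∧
      (∀ g ∈ normalizer ((P : Subgroup G) : Set G), g * x ^ q = x ^ q * g) ∧
      (∀ R ≤ (P : Subgroup G), (∀ r ∈ R, x * r * x⁻¹ ∈ R) → R ≠ P → ∀ r ∈ R, x * r = r * x) ∧
      ¬ ∀ r ∈ (P : Subgroup G), x * r = r * x := by
  set N := normalizer ((P : Subgroup G) : Set G) with hN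
  have hNt : N ≠ ⊤ := normalizer_sylow_ne_top hc P hP
  have hPN : (P : Subgroup G) ≤ N := le_normalizer
  obtain hnil | hmin := hsub N hNt
  · exact absurd hnil (not_isNilpotent_normalizer_sylow hsub hc P hP)
  obtain ⟨p0, q, R, x, a, b, hp0, hq, hpq, hRn, hR, hx, hS, hsup, hxc, hRR, hnc⟩ :=
    exists_structure_of_minimalNonNilpotent hmin
  have hqf : Fact q.Prime := ⟨hq⟩
  have hp0f : Fact p0.Prime := ⟨hp0⟩
  have hRi : R.index = q ^ b := by
    have := R.card_mul_index
    rw [hS, hR] at this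
    exact Nat.eq_of_mul_eq_mul_left (pow_pos hp0.pos a) this
  have hRp : IsPGroup p0 R := IsPGroup.of_card hR
  have hPsub : IsPGroup p ((P : Subgroup G).subgroupOf N) := P.2.comap_subtype
  have hpq' : p ≠ q := by
    rintro rfl
    apply hnc
    intro r hr
    have hxP : x ∈ (P : Subgroup G).subgroupOf N := by
      have h1 : IsPGroup p (zpowers (x : G)) :=
        IsPGroup.of_card (n := b) (by rw [Nat.card_zpowers, orderOf_coe, hx])
      have h2 : zpowers (x : G) ⊓ N ≤ P := by
        have h3 := h1.inf_normalizer_sylow P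
        change zpowers (x : G) ⊓ N = _ at h3
        rw [h3]
        exact inf_le_right
      exact mem_subgroupOf.2 (h2 (mem_inf.2 ⟨mem_zpowers _, x.2⟩))
    have hPn : ((P : Subgroup G).subgroupOf N).Normal := normal_in_normalizer
    have hdisj : Disjoint R ((P : Subgroup G).subgroupOf N) :=
      IsPGroup.disjoint_of_ne p0 p hpq _ _ hRp hPsub
    have h1 : x * r * x⁻¹ * r⁻¹ ∈ R := mul_mem (hRn.conj_mem _ hr x) (inv_mem hr)
    have h2 : x * r * x⁻¹ * r⁻¹ ∈ (P : Subgroup G).subgroupOf N := by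
      have := mul_mem hxP (hPn.conj_mem _ (inv_mem hxP) r)
      simpa only [mul_assoc] using this
    have := Subgroup.disjoint_def.1 hdisj h1 h2
    rw [mul_inv_eq_one, mul_inv_eq_iff_eq_mul] at this
    exact this
  have hPR : (P : Subgroup G).subgroupOf N ≤ R :=
    le_of_isPGroup_of_coprime_index hpq' hRi hPsub
  have hpp : p = p0 := by
    by_contra hne
    have h1 := IsPGroup.disjoint_of_ne p p0 hne _ _ hPsub hRp
    have h2 : (P : Subgroup G).subgroupOf N = ⊥ := le_bot_iff.1 (h1 le_rfl hPR)
    apply hP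
    rw [← inf_eq_left.2 hPN, ← subgroupOf_map_subtype, h2, Subgroup.map_bot]
  subst hpp
  have hRP : R = (P : Subgroup G).subgroupOf N := by
    refine le_antisymm ?_ hPR
    have h1 : (P : Subgroup G) ≤ R.map N.subtype := by
      rw [← inf_eq_left.2 hPN, ← subgroupOf_map_subtype]
      exact map_mono hPR
    intro r hr
    exact mem_subgroupOf.2 ((P.3 (hRp.map N.subtype) h1).le ⟨r, hr, rfl⟩)
  have hcardP : Nat.card P = p ^ a := by
    rw [← hR, hRP]
    exact Nat.card_congr (subgroupOfEquivOfLe hPN).toEquiv.symm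
  refine ⟨q, x, b, hq, hpq, by rw [orderOf_coe, hx], x.2, by rw [hcardP, hS], ?_, ?_, ?_, ?_⟩
  · have h1 := congrArg (Subgroup.map N.subtype) hsup
    rw [Subgroup.map_sup, MonoidHom.map_zpowers, hRP, subgroupOf_map_subtype, inf_eq_left.2 hPN,
      ← MonoidHom.range_eq_map, range_subtype] at h1
    exact h1
  · intro g hg
    exact congrArg Subtype.val (mem_center_iff.1 hxc ⟨g, hg⟩)
  · intro D hDP hD hDne r hr
    refine congrArg Subtype.val (hRR (D.subgroupOf N) ?_ ?_ ?_ ⟨r, hPN (hDP hr)⟩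
      (mem_subgroupOf.2 hr))
    · rw [hRP]
      exact comap_mono hDP
    · intro s hs
      exact mem_subgroupOf.2 (hD s (mem_subgroupOf.1 hs))
    · intro h
      rw [hRP] at h
      apply hDne
      have := congrArg (Subgroup.map N.subtype) h
      rwa [subgroupOf_map_subtype, subgroupOf_map_subtype, inf_eq_left.2 hPN,
        inf_eq_left.2 (hDP.trans hPN)] at this
  · intro h
    apply hnc
    intro r hr
    rw [hRP] at hr
    exact Subtype.ext (h r (mem_subgroupOf.1 hr))

omit [Finite G] in
theorem mem_normalizer_sylow_of_conj_mem {p : ℕ} [Fact p.Prime]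
    (hTI : ∀ P Q : Sylow p G, P ≠ Q → ((P : Subgroup G) ⊓ Q : Subgroup G) = ⊥) (P : Sylow p G)
    {u g : G} (hu : u ∈ (P : Subgroup G)) (hu1 : u ≠ 1) (hg : g * u * g⁻¹ ∈ (P : Subgroup G)) :
    g ∈ normalizer ((P : Subgroup G) : Set G) := by
  have h1 : g • P = P := by
    by_contra hne
    have h2 : g * u * g⁻¹ ∈ ((g • P : Sylow p G) : Subgroup G) ⊓ P := by
      refine mem_inf.2 ⟨?_, hg⟩
      rw [Sylow.smul_def, Sylow.pointwise_smul_def]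
      exact ⟨u, hu, rfl⟩
    rw [hTI _ _ hne, mem_bot] at h2
    exact hu1 (by simpa using h2)
  exact Sylow.smul_eq_iff_mem_normalizer.1 h1

omit [Finite G] in
theorem exists_sylow_of_orderOf_eq_pow {p : ℕ} [Fact p.Prime] {u : G} {k : ℕ}
    (hu : orderOf u = p ^ k) : ∃ P : Sylow p G, u ∈ (P : Subgroup G) := by
  obtain ⟨P, hP⟩ := IsPGroup.exists_le_sylow (P := zpowers u)
    (IsPGroup.of_card (n := k) (by rw [Nat.card_zpowers, hu]))
  exact ⟨P, hP (mem_zpowers u)⟩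

theorem exists_normalizer_structure' [IsSimpleGroup G] (hsub : ProperNilpotentOrMinimal G)
    (hc : commutator G = ⊤) {p : ℕ} [hp : Fact p.Prime] (P : Sylow p G)
    (hP : (P : Subgroup G) ≠ ⊥) : ∃ (q : ℕ) (x : G), q.Prime ∧ p ≠ q ∧
      orderOf x = q ∧ x ∈ normalizer ((P : Subgroup G) : Set G) ∧
      Nat.card (normalizer ((P : Subgroup G) : Set G)) = Nat.card P * q ∧
      (P : Subgroup G) ⊔ zpowers x = normalizer ((P : Subgroup G) : Set G) ∧
      (∀ R ≤ (P : Subgroup G), (∀ r ∈ R, x * r * x⁻¹ ∈ R) → R ≠ P → ∀ r ∈ R, x * r = r * x) ∧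
      ¬ ∀ r ∈ (P : Subgroup G), x * r = r * x := by
  obtain ⟨q, x, b, hq, hpq, hx, hxN, hcard, hsup, hxc, hR, hnc⟩ :=
    exists_normalizer_structure hsub hc P hP
  have hqf : Fact q.Prime := ⟨hq⟩
  have hxq : x ^ q = 1 := by
    by_contra hne
    obtain ⟨Q, hxQ⟩ := exists_sylow_of_orderOf_eq_pow hx
    have hyQ : x ^ q ∈ (Q : Subgroup G) := pow_mem hxQ q
    have hQb : (Q : Subgroup G) ≠ ⊥ := by
      intro h
      rw [h, mem_bot] at hyQ
      exact hne hyQ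
    have h1 : normalizer ((P : Subgroup G) : Set G) ≤ normalizer ((Q : Subgroup G) : Set G) := by
      intro g hg
      refine mem_normalizer_sylow_of_conj_mem (isSimpleGroup_sylow_inf_eq_bot hsub hc) Q hyQ hne ?_
      rwa [hxc g hg, mul_inv_cancel_right]
    have h2 := hsub.eq_of_le (not_isNilpotent_normalizer_sylow hsub hc P hP) h1
      (normalizer_sylow_ne_top hc Q hQb)
    apply hnc
    intro r hr
    have hdisj : Disjoint (P : Subgroup G) (Q : Subgroup G) :=
      IsPGroup.disjoint_of_ne p q hpq _ _ P.2 Q.2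
    have h3 : x * r * x⁻¹ * r⁻¹ ∈ (P : Subgroup G) :=
      mul_mem ((mem_normalizer_iff.1 hxN r).1 hr) (inv_mem hr)
    have h4 : x * r * x⁻¹ * r⁻¹ ∈ (Q : Subgroup G) := by
      have hrQ : r ∈ normalizer ((Q : Subgroup G) : Set G) := h1 (le_normalizer hr)
      have := mul_mem hxQ ((mem_normalizer_iff.1 hrQ x⁻¹).1 (inv_mem hxQ))
      simpa only [mul_assoc] using this
    have := Subgroup.disjoint_def.1 hdisj h3 h4
    rw [mul_inv_eq_one, mul_inv_eq_iff_eq_mul] at this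
    exact this
  have hx1 : x ≠ 1 := by
    rintro rfl
    exact hnc (by simp)
  have hox : orderOf x = q := orderOf_eq_prime hxq hx1
  exact ⟨q, x, hq, hpq, hox, hxN, by rw [hcard, ← hx, hox], hsup, hR, hnc⟩

end SimpleNormalizer

section Counting

open Subgroup

variable {G : Type*} [Group G] [Finite G]

omit [Finite G] in
theorem card_mul_ncard_eq_of_conj {H : Subgroup G} {U : Set G}
    (hU : ∀ u ∈ U, ∀ g : G, g * u * g⁻¹ ∈ U ↔ g ∈ H) :
    Nat.card G * U.ncard = {c : G | ∃ u ∈ U, ∃ g : G, g * u * g⁻¹ = c}.ncard * Nat.card H := by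
  set C : Set G := {c : G | ∃ u ∈ U, ∃ g : G, g * u * g⁻¹ = c} with hC
  rw [← Nat.card_coe_set_eq, ← Nat.card_coe_set_eq, ← Nat.card_prod, ← Nat.card_prod]
  have hc : ∀ c : C, ∃ u ∈ U, ∃ g : G, g * u * g⁻¹ = c := fun c => c.2
  choose u hu g hg using hc
  symm
  have hmem : ∀ (c : C) (h : H), (h : G)⁻¹ * u c * h ∈ U := by
    intro c h
    have := (hU (u c) (hu c) (h : G)⁻¹).2 (inv_mem h.2)
    rwa [inv_inv] at this
  refine Nat.card_eq_of_bijective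
    (fun ch : C × H => ((g ch.1 * ch.2, ⟨_, hmem ch.1 ch.2⟩) : G × U)) ⟨?_, ?_⟩
  · rintro ⟨c, h⟩ ⟨c', h'⟩ heq
    simp only [Prod.mk.injEq, Subtype.mk.injEq] at heq
    obtain ⟨h1, h2⟩ := heq
    have hcc : c = c' := by
      apply Subtype.ext
      rw [← hg c, ← hg c']
      have h3 : g c * u c * (g c)⁻¹ =
          (g c * h) * ((h : G)⁻¹ * u c * h) * (g c * h)⁻¹ := by group
      have h4 : g c' * u c' * (g c')⁻¹ =
          (g c' * h') * ((h' : G)⁻¹ * u c' * h') * (g c' * h')⁻¹ := by group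
      rw [h3, h4, h1, h2]
    subst hcc
    rw [mul_right_inj] at h1
    rw [Subtype.ext h1]
  · rintro ⟨a, v, hv⟩
    let c : C := ⟨a * v * a⁻¹, v, hv, a, rfl⟩
    have h1 : g c * u c * (g c)⁻¹ = a * v * a⁻¹ := hg c
    have h2 : (g c)⁻¹ * a * v * ((g c)⁻¹ * a)⁻¹ = u c := by
      have : (g c)⁻¹ * a * v * ((g c)⁻¹ * a)⁻¹ = (g c)⁻¹ * (a * v * a⁻¹) * g c := by group
      rw [this, ← h1]; group
    have h3 : (g c)⁻¹ * a ∈ H := (hU v hv _).1 (by rw [h2]; exact hu c)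
    refine ⟨⟨c, ⟨_, h3⟩⟩, ?_⟩
    simp only [Prod.mk.injEq, Subtype.mk.injEq]
    refine ⟨by group, ?_⟩
    rw [← h2]; group

theorem le_centralizer_of_card_dvd {H : Subgroup G} {p q : ℕ} (hp : p.Prime) (hq : q.Prime)
    (hpq : p ≠ q) {x z : G} (hx : orderOf x = q) (hz : orderOf z = p) (hxH : x ∈ H) (hzH : z ∈ H)
    (hxz : x * z = z * x) (hH : Nat.card H ∣ p * q) {y : G} (hy : y ∈ zpowers x ∨ y ∈ zpowers z) :
    ∀ g ∈ H, g * y = y * g := by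
  have hyx : x * y = y * x := by
    rcases hy with h | h <;> obtain ⟨k, rfl⟩ := mem_zpowers_iff.1 h
    · exact (Commute.refl x).zpow_right k
    · exact Commute.zpow_right hxz k
  have hyz : z * y = y * z := by
    rcases hy with h | h <;> obtain ⟨k, rfl⟩ := mem_zpowers_iff.1 h
    · exact Commute.zpow_right hxz.symm k
    · exact (Commute.refl z).zpow_right k
  have hxC : x ∈ H ⊓ centralizer {y} := mem_inf.2 ⟨hxH, mem_centralizer_singleton_iff.2 hyx⟩
  have hzC : z ∈ H ⊓ centralizer {y} := mem_inf.2 ⟨hzH, mem_centralizer_singleton_iff.2 hyz⟩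
  have h1 : q ∣ Nat.card (H ⊓ centralizer {y} : Subgroup G) := by
    rw [← hx]; exact orderOf_dvd_natCard _ hxC
  have h2 : p ∣ Nat.card (H ⊓ centralizer {y} : Subgroup G) := by
    rw [← hz]; exact orderOf_dvd_natCard _ hzC
  have h3 : p * q ∣ Nat.card (H ⊓ centralizer {y} : Subgroup G) :=
    ((Nat.coprime_primes hp hq).2 hpq).mul_dvd_of_dvd_of_dvd h2 h1
  have h4 : H ⊓ centralizer {y} = H := by
    refine eq_of_le_of_card_ge inf_le_left ?_
    exact Nat.le_of_dvd Nat.card_pos (hH.trans h3)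
  intro g hg
  rw [← h4] at hg
  exact mem_centralizer_singleton_iff.1 (mem_inf.1 hg).2

omit [Finite G] in
theorem ncard_diff_one (H : Subgroup G) : ((H : Set G) \ {1}).ncard = Nat.card H - 1 := by
  rw [Set.ncard_sdiff_singleton_of_mem (one_mem H), ← Nat.card_coe_set_eq]
  rfl

end Counting

section FixedPointFree

open Subgroup

variable {G : Type*} [Group G] [Finite G]

omit [Finite G] in
theorem conj_mem_diff_one_iff {H : Subgroup G} {u g : G} (hg : g ∈ normalizer (H : Set G)) :
    g * u * g⁻¹ ∈ (H : Set G) \ {1} ↔ u ∈ (H : Set G) \ {1} := by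
  have h1 : g * u * g⁻¹ ∈ H ↔ u ∈ H := (mem_normalizer_iff.1 hg u).symm
  have h2 : g * u * g⁻¹ = 1 ↔ u = 1 := conj_eq_one_iff
  simp only [Set.mem_sdiff, SetLike.mem_coe, Set.mem_singleton_iff, h1, h2]

theorem counting_inequality {n A B C P Q p q : ℕ} (hn : 1 + A + B + C ≤ n)
    (hA : n * (P - 1) = A * (P * q)) (hB : n * (Q - 1) = B * (Q * p))
    (hC : n * ((p - 1) * (q - 1)) ≤ C * (p * q)) (hp : 0 < p) (hq : 0 < q) (hP : 2 * p ≤ P)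
    (hQ : 2 * q ≤ Q) : False := by
  have hP1 : 1 ≤ P := by omega
  have hQ1 : 1 ≤ Q := by omega
  zify [hP1, hQ1, Nat.succ_le_of_lt hp, Nat.succ_le_of_lt hq] at *
  have h1 := mul_le_mul_of_nonneg_right hn (show (0 : ℤ) ≤ P * Q * p * q by positivity)
  have h2 : (A : ℤ) * (P * Q * p * q) = n * (P - 1) * (Q * p) := by rw [hA]; ring
  have h3 : (B : ℤ) * (P * Q * p * q) = n * (Q - 1) * (P * q) := by rw [hB]; ring
  have h4 : (n : ℤ) * ((p - 1) * (q - 1)) * (P * Q) ≤ C * (P * Q * p * q) := by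
    calc _ ≤ (C : ℤ) * (p * q) * (P * Q) := mul_le_mul_of_nonneg_right hC (by positivity)
      _ = _ := by ring
  have h5 : (n : ℤ) * (Q * p + P * q - P * Q) ≤ 0 := by
    apply mul_nonpos_of_nonneg_of_nonpos (by positivity)
    nlinarith
  have hP0 : (0 : ℤ) < P := by linarith
  have hQ0 : (0 : ℤ) < Q := by linarith
  have h6 : (0 : ℤ) < P * Q * p * q := by positivity
  nlinarith

theorem eq_one_of_pow_card_of_sylow {p q : ℕ} [hp : Fact p.Prime] [hq : Fact q.Prime] (hpq : p ≠ q)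
    (P : Sylow p G) {y : G} (hy : IsPGroup q (zpowers y)) (h : y ^ Nat.card P = 1) : y = 1 := by
  obtain ⟨a, ha⟩ := IsPGroup.iff_card.1 P.2
  obtain ⟨b, hb⟩ := IsPGroup.iff_card.1 hy
  rw [Nat.card_zpowers] at hb
  have h1 := orderOf_dvd_of_pow_eq_one h
  rw [ha, hb] at h1
  have h2 : Nat.Coprime (q ^ b) (p ^ a) :=
    Nat.Coprime.pow _ _ ((Nat.coprime_primes hq.1 hp.1).2 hpq.symm)
  rw [← orderOf_eq_one_iff, hb]
  exact Nat.Coprime.eq_one_of_dvd h2 h1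

theorem false_of_commuting_of_TI {p q : ℕ} [hp : Fact p.Prime] [hq : Fact q.Prime] (hpq : p ≠ q)
    (hTIp : ∀ P Q : Sylow p G, P ≠ Q → ((P : Subgroup G) ⊓ Q : Subgroup G) = ⊥)
    (hTIq : ∀ P Q : Sylow q G, P ≠ Q → ((P : Subgroup G) ⊓ Q : Subgroup G) = ⊥)
    (P : Sylow p G) (Q : Sylow q G)
    (hNP : Nat.card (normalizer ((P : Subgroup G) : Set G)) = Nat.card P * q)
    (hNQ : Nat.card (normalizer ((Q : Subgroup G) : Set G)) = Nat.card Q * p)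
    {x z : G} (hx : orderOf x = q) (hz : orderOf z = p) (hxQ : x ∈ (Q : Subgroup G))
    (hzP : z ∈ (P : Subgroup G)) (hxz : x * z = z * x) {a b : ℕ} (hP : Nat.card P = p * p ^ a)
    (hQ : Nat.card Q = q * q ^ b) (ha : a ≠ 0) (hb : b ≠ 0) : False := by
  have hx1 : x ≠ 1 := by rintro rfl; rw [orderOf_one] at hx; exact hq.1.one_lt.ne hx
  have hz1 : z ≠ 1 := by rintro rfl; rw [orderOf_one] at hz; exact hp.1.one_lt.ne hz
  have hxX : x ∈ normalizer ((P : Subgroup G) : Set G) :=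
    mem_normalizer_sylow_of_conj_mem hTIp P hzP hz1 (by rwa [hxz, mul_inv_cancel_right])
  have hzX : z ∈ normalizer ((Q : Subgroup G) : Set G) :=
    mem_normalizer_sylow_of_conj_mem hTIq Q hxQ hx1 (by rwa [← hxz, mul_inv_cancel_right])
  set H := normalizer ((P : Subgroup G) : Set G) ⊓ normalizer ((Q : Subgroup G) : Set G) with hH
  have hHcard : Nat.card H ∣ p * q := by
    have h1 : Nat.card H ∣ Nat.card P * q := hNP ▸ card_dvd_of_le inf_le_left
    have h2 : Nat.card H ∣ Nat.card Q * p := hNQ ▸ card_dvd_of_le inf_le_right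
    have h3 := Nat.dvd_gcd h1 h2
    have h4 : Nat.gcd (Nat.card P * q) (Nat.card Q * p) = p * q := by
      have h5 : Nat.card P * q = p * q * p ^ a := by rw [hP]; ring
      have h6 : Nat.card Q * p = p * q * q ^ b := by rw [hQ]; ring
      have h7 : Nat.gcd (p ^ a) (q ^ b) = 1 :=
        Nat.Coprime.pow _ _ ((Nat.coprime_primes hp.1 hq.1).2 hpq)
      rw [h5, h6, Nat.gcd_mul_left, h7, mul_one]
    rwa [h4] at h3
  have hxH : x ∈ H := mem_inf.2 ⟨hxX, le_normalizer hxQ⟩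
  have hzH : z ∈ H := mem_inf.2 ⟨le_normalizer hzP, hzX⟩
  have hcomm : ∀ y, y ∈ zpowers x ∨ y ∈ zpowers z → ∀ g ∈ H, g * y = y * g := fun y hy =>
    le_centralizer_of_card_dvd hp.1 hq.1 hpq hx hz hxH hzH hxz hHcard hy
  have hXp : IsPGroup q (zpowers x) :=
    IsPGroup.of_card (n := 1) (by rw [Nat.card_zpowers, hx, pow_one])
  have hZp : IsPGroup p (zpowers z) :=
    IsPGroup.of_card (n := 1) (by rw [Nat.card_zpowers, hz, pow_one])
  have hXQ : zpowers x ≤ Q := by rwa [zpowers_le]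
  have hZP : zpowers z ≤ P := by rwa [zpowers_le]
  have hyw : ∀ {y w : G}, y ∈ zpowers x → w ∈ zpowers z → y * w = w * y := by
    intro y w hy hw
    obtain ⟨i, rfl⟩ := mem_zpowers_iff.1 hy
    obtain ⟨j, rfl⟩ := mem_zpowers_iff.1 hw
    exact (Commute.zpow_zpow hxz i j)
  have hPpow : ∀ {w : G}, w ∈ (P : Subgroup G) → w ^ Nat.card P = 1 := fun {w} hw =>
    congrArg Subtype.val (pow_card_eq_one' (x := (⟨w, hw⟩ : (P : Subgroup G))))
  have hQpow : ∀ {w : G}, w ∈ (Q : Subgroup G) → w ^ Nat.card Q = 1 := fun {w} hw =>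
    congrArg Subtype.val (pow_card_eq_one' (x := (⟨w, hw⟩ : (Q : Subgroup G))))
  have hmulP : ∀ {y w : G}, y ∈ zpowers x → w ∈ zpowers z →
      (y * w) ^ Nat.card P = y ^ Nat.card P := by
    intro y w hy hw
    rw [Commute.mul_pow (hyw hy hw), hPpow (hZP hw), mul_one]
  have hmulQ : ∀ {y w : G}, y ∈ zpowers x → w ∈ zpowers z →
      (y * w) ^ Nat.card Q = w ^ Nat.card Q := by
    intro y w hy hw
    rw [Commute.mul_pow (hyw hy hw), hQpow (hXQ hy), one_mul]
  have hy1 : ∀ {y : G}, y ∈ zpowers x → y ^ Nat.card P = 1 → y = 1 := fun hy h =>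
    eq_one_of_pow_card_of_sylow hpq P (hXp.to_le (by rwa [zpowers_le])) h
  have hw1 : ∀ {y : G}, y ∈ zpowers z → y ^ Nat.card Q = 1 → y = 1 := fun hy h =>
    eq_one_of_pow_card_of_sylow hpq.symm Q (hZp.to_le (by rwa [zpowers_le])) h
  set U : Set G := (fun yw : G × G => yw.1 * yw.2) ''
    (((zpowers x : Set G) \ {1}) ×ˢ ((zpowers z : Set G) \ {1})) with hU
  have hUcard : U.ncard = (q - 1) * (p - 1) := by
    rw [hU, Set.InjOn.ncard_image, Set.ncard_prod, ncard_diff_one, ncard_diff_one,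
      Nat.card_zpowers, Nat.card_zpowers, hx, hz]
    rintro ⟨y, w⟩ ⟨⟨hy, -⟩, ⟨hw, -⟩⟩ ⟨y', w'⟩ ⟨⟨hy', -⟩, ⟨hw', -⟩⟩ heq
    have hdisj : Disjoint (zpowers x) (zpowers z) :=
      IsPGroup.disjoint_of_ne q p hpq.symm _ _ hXp hZp
    have := mul_injective_of_disjoint hdisj
      (a₁ := (⟨y, hy⟩, ⟨w, hw⟩)) (a₂ := (⟨y', hy'⟩, ⟨w', hw'⟩)) heq
    simpa using this
  have hP' := card_mul_ncard_eq_of_conj (H := normalizer ((P : Subgroup G) : Set G))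
    (U := ((P : Subgroup G) : Set G) \ {1}) (fun u hu g =>
      ⟨fun h => mem_normalizer_sylow_of_conj_mem hTIp P hu.1 hu.2 h.1,
       fun h => (conj_mem_diff_one_iff h).2 hu⟩)
  have hQ' := card_mul_ncard_eq_of_conj (H := normalizer ((Q : Subgroup G) : Set G))
    (U := ((Q : Subgroup G) : Set G) \ {1}) (fun u hu g =>
      ⟨fun h => mem_normalizer_sylow_of_conj_mem hTIq Q hu.1 hu.2 h.1,
       fun h => (conj_mem_diff_one_iff h).2 hu⟩)
  have hU' := card_mul_ncard_eq_of_conj (H := H) (U := U) (by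
    rintro _ ⟨⟨y, w⟩, ⟨⟨hy, hyn⟩, ⟨hw, hwn⟩⟩, rfl⟩ g
    constructor
    · rintro ⟨⟨y', w'⟩, ⟨⟨hy', hyn'⟩, ⟨hw', hwn'⟩⟩, heq⟩
      simp only at heq
      have h1 := congrArg (· ^ Nat.card P) heq
      have h2 := congrArg (· ^ Nat.card Q) heq
      simp only [conj_pow, hmulP hy hw, hmulP hy' hw', hmulQ hy hw, hmulQ hy' hw'] at h1 h2
      refine mem_inf.2 ⟨?_, ?_⟩
      · refine mem_normalizer_sylow_of_conj_mem hTIp P (u := w ^ Nat.card Q) (pow_mem (hZP hw) _)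
          (fun h => hwn (hw1 hw h)) ?_
        rw [← h2]
        exact pow_mem (hZP hw') _
      · refine mem_normalizer_sylow_of_conj_mem hTIq Q (u := y ^ Nat.card P) (pow_mem (hXQ hy) _)
          (fun h => hyn (hy1 hy h)) ?_
        rw [← h1]
        exact pow_mem (hXQ hy') _
    · intro hg
      have : g * (y * w) * g⁻¹ = y * w := by
        rw [← mul_assoc g, hcomm y (Or.inl hy) g hg, mul_assoc y, hcomm w (Or.inr hw) g hg,
          ← mul_assoc, mul_inv_cancel_right]
      simp only
      rw [this]
      exact ⟨(y, w), ⟨⟨hy, hyn⟩, ⟨hw, hwn⟩⟩, rfl⟩)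
  rw [hUcard] at hU'
  rw [ncard_diff_one, hNP] at hP'
  rw [ncard_diff_one, hNQ] at hQ'
  set A := {c : G | ∃ u ∈ ((P : Subgroup G) : Set G) \ {1}, ∃ g : G, g * u * g⁻¹ = c} with hA
  set B := {c : G | ∃ u ∈ ((Q : Subgroup G) : Set G) \ {1}, ∃ g : G, g * u * g⁻¹ = c} with hB
  set C := {c : G | ∃ u ∈ U, ∃ g : G, g * u * g⁻¹ = c} with hC
  have hAp : ∀ c ∈ A, c ^ Nat.card P = 1 := by
    rintro _ ⟨u, hu, g, rfl⟩
    rw [conj_pow, hPpow hu.1]; simp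
  have hA1 : (1 : G) ∉ A := by
    rintro ⟨u, hu, g, h⟩
    exact hu.2 (conj_eq_one_iff.1 h)
  have hBp : ∀ c ∈ B, c ^ Nat.card Q = 1 := by
    rintro _ ⟨u, hu, g, rfl⟩
    rw [conj_pow, hQpow hu.1]; simp
  have hB1 : (1 : G) ∉ B := by
    rintro ⟨u, hu, g, h⟩
    exact hu.2 (conj_eq_one_iff.1 h)
  have hCp : ∀ c ∈ C, c ^ Nat.card P ≠ 1 := by
    rintro _ ⟨_, ⟨⟨y, w⟩, ⟨⟨hy, hyn⟩, ⟨hw, hwn⟩⟩, rfl⟩, g, rfl⟩ h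
    simp only [conj_pow, hmulP hy hw] at h
    exact hyn (hy1 hy (conj_eq_one_iff.1 h))
  have hCq : ∀ c ∈ C, c ^ Nat.card Q ≠ 1 := by
    rintro _ ⟨_, ⟨⟨y, w⟩, ⟨⟨hy, hyn⟩, ⟨hw, hwn⟩⟩, rfl⟩, g, rfl⟩ h
    simp only [conj_pow, hmulQ hy hw] at h
    exact hwn (hw1 hw (conj_eq_one_iff.1 h))
  have hAB : Disjoint A B := by
    rw [Set.disjoint_left]
    intro c hcA hcB
    have h1 := orderOf_dvd_of_pow_eq_one (hAp c hcA)
    have h2 := orderOf_dvd_of_pow_eq_one (hBp c hcB)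
    obtain ⟨s, hs⟩ := IsPGroup.iff_card.1 P.2
    obtain ⟨t, ht⟩ := IsPGroup.iff_card.1 Q.2
    rw [hs] at h1
    rw [ht] at h2
    have h3 : Nat.Coprime (p ^ s) (q ^ t) :=
      Nat.Coprime.pow _ _ ((Nat.coprime_primes hp.1 hq.1).2 hpq)
    have h4 := Nat.eq_one_of_dvd_coprimes h3 h1 h2
    rw [orderOf_eq_one_iff] at h4
    exact hA1 (h4 ▸ hcA)
  have hABC : Disjoint (A ∪ B) C := by
    rw [Set.disjoint_left]
    rintro c (hc | hc) hcC
    · exact hCp c hcC (hAp c hc)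
    · exact hCq c hcC (hBp c hc)
  have h1n : Disjoint (A ∪ B ∪ C) {1} := by
    rw [Set.disjoint_singleton_right]
    rintro ((h | h) | h)
    · exact hA1 h
    · exact hB1 h
    · exact hCp 1 h (one_pow _)
  have hsum : 1 + A.ncard + B.ncard + C.ncard ≤ Nat.card G := by
    have h1 := Set.ncard_union_eq h1n
    have h2 := Set.ncard_union_eq hABC
    have h3 := Set.ncard_union_eq hAB
    have h4 := Set.ncard_le_card (A ∪ B ∪ C ∪ {1})
    rw [Set.ncard_singleton] at h1
    omega
  refine counting_inequality (p := p) (q := q) hsum (by rw [hP']) (by rw [hQ']) ?_ hp.1.pos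
    hq.1.pos ?_ ?_
  · rw [mul_comm (p - 1), hU']
    exact Nat.mul_le_mul_left _ (Nat.le_of_dvd (mul_pos hp.1.pos hq.1.pos) hHcard)
  · rw [hP, mul_comm]
    exact Nat.mul_le_mul_left _ (hp.1.two_le.trans (Nat.le_self_pow ha p))
  · rw [hQ, mul_comm]
    exact Nat.mul_le_mul_left _ (hq.1.two_le.trans (Nat.le_self_pow hb q))

end FixedPointFree

section SimpleFrobenius

open Subgroup

variable {G : Type*} [Group G] [Finite G]

theorem exists_frobenius_complement [IsSimpleGroup G] (hsub : ProperNilpotentOrMinimal G)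
    (hc : commutator G = ⊤) {p : ℕ} [hp : Fact p.Prime] (P : Sylow p G)
    (hP : (P : Subgroup G) ≠ ⊥) : ∃ (q : ℕ) (x : G), q.Prime ∧ p ≠ q ∧
      orderOf x = q ∧ x ∈ normalizer ((P : Subgroup G) : Set G) ∧
      Nat.card (normalizer ((P : Subgroup G) : Set G)) = Nat.card P * q ∧
      (P : Subgroup G) ⊔ zpowers x = normalizer ((P : Subgroup G) : Set G) ∧
      (∀ R ≤ (P : Subgroup G), (∀ r ∈ R, x * r * x⁻¹ ∈ R) → R ≠ P → ∀ r ∈ R, x * r = r * x) ∧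
      ∀ z ∈ (P : Subgroup G), x * z = z * x → z = 1 := by
  obtain ⟨q, x, hq, hpq, hx, hxN, hcard, hsup, hR, hnc⟩ :=
    exists_normalizer_structure' hsub hc P hP
  refine ⟨q, x, hq, hpq, hx, hxN, hcard, hsup, hR, fun z hz hxz => ?_⟩
  by_contra hz1
  have hqf : Fact q.Prime := ⟨hq⟩
  have hx1 : x ≠ 1 := by rintro rfl; rw [orderOf_one] at hx; exact hq.one_lt.ne hx
  have hTIp := isSimpleGroup_sylow_inf_eq_bot hsub hc (p := p)
  have hTIq := isSimpleGroup_sylow_inf_eq_bot hsub hc (p := q)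
  obtain ⟨Q, hxQ⟩ := exists_sylow_of_orderOf_eq_pow (p := q) (k := 1) (by rw [hx, pow_one])
  have hQb : (Q : Subgroup G) ≠ ⊥ := by
    intro h
    rw [h, mem_bot] at hxQ
    exact hx1 hxQ
  have hzQ : z ∈ normalizer ((Q : Subgroup G) : Set G) :=
    mem_normalizer_sylow_of_conj_mem hTIq Q hxQ hx1 (by rwa [← hxz, mul_inv_cancel_right])
  obtain ⟨q', x', hq', hqq', hx', hxN', hcard', hsup', -, hnc'⟩ :=
    exists_normalizer_structure' hsub hc Q hQb
  obtain ⟨a, ha⟩ := IsPGroup.iff_card.1 P.2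
  obtain ⟨b, hb⟩ := IsPGroup.iff_card.1 Q.2
  have hzo : ∃ k, orderOf z = p ^ k := by
    obtain ⟨k, hk⟩ := IsPGroup.iff_card.1 (P.2.to_le (show zpowers z ≤ P by rwa [zpowers_le]))
    exact ⟨k, by rw [← Nat.card_zpowers, hk]⟩
  obtain ⟨k, hk⟩ := hzo
  have hk0 : k ≠ 0 := by
    rintro rfl
    rw [pow_zero, orderOf_eq_one_iff] at hk
    exact hz1 hk
  have hdvd : p ^ k ∣ q' := by
    have h1 : p ^ k ∣ q ^ b * q' := by
      rw [← hb, ← hcard', ← hk]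
      exact orderOf_dvd_natCard _ hzQ
    exact Nat.Coprime.dvd_of_dvd_mul_left
      (Nat.Coprime.pow _ _ ((Nat.coprime_primes hp.1 hq).2 hpq)) h1
  have hpq' : q' = p :=
    ((Nat.prime_dvd_prime_iff_eq hp.1 hq').1 ((dvd_pow_self p hk0).trans hdvd)).symm
  subst hpq'
  have hzo : orderOf z = q' := by
    rw [hk]
    exact Nat.dvd_antisymm hdvd (dvd_pow_self _ hk0)
  have ha1 : a ≠ 0 := by
    rintro rfl
    exact hP (card_eq_one.1 (by rw [ha, pow_zero]))
  have hb1 : b ≠ 0 := by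
    rintro rfl
    exact hQb (card_eq_one.1 (by rw [hb, pow_zero]))
  obtain ⟨a, rfl⟩ := Nat.exists_eq_succ_of_ne_zero ha1
  obtain ⟨b, rfl⟩ := Nat.exists_eq_succ_of_ne_zero hb1
  refine false_of_commuting_of_TI hpq hTIp hTIq P Q hcard hcard' hx hzo hxQ hz hxz
    (a := a) (b := b) (by rw [ha, pow_succ']) (by rw [hb, pow_succ']) ?_ ?_
  · rintro rfl
    apply hnc
    intro r hr
    have h1 : zpowers z = P := by
      refine eq_of_le_of_card_ge (by rwa [zpowers_le]) ?_
      rw [Nat.card_zpowers, hzo, ha]; simp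
    rw [← h1] at hr
    obtain ⟨i, rfl⟩ := mem_zpowers_iff.1 hr
    exact Commute.zpow_right hxz i
  · rintro rfl
    apply hnc'
    intro r hr
    have h1 : zpowers x = Q := by
      refine eq_of_le_of_card_ge (by rwa [zpowers_le]) ?_
      rw [Nat.card_zpowers, hx, hb]; simp
    refine le_centralizer_of_card_dvd hp.1 hq hpq hx hzo (le_normalizer hxQ) hzQ hxz
      (H := normalizer ((Q : Subgroup G) : Set G)) ?_ (Or.inl (by rwa [h1])) x' hxN'
    rw [hcard', hb]
    simp [mul_comm]

theorem exists_frobenius_structure [IsSimpleGroup G] (hsub : ProperNilpotentOrMinimal G)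
    (hc : commutator G = ⊤) {p : ℕ} [hp : Fact p.Prime] (P : Sylow p G)
    (hP : (P : Subgroup G) ≠ ⊥) : ∃ (q : ℕ) (x : G), q.Prime ∧ p ≠ q ∧
      orderOf x = q ∧ x ∈ normalizer ((P : Subgroup G) : Set G) ∧
      Nat.card (normalizer ((P : Subgroup G) : Set G)) = Nat.card P * q ∧
      (P : Subgroup G) ⊔ zpowers x = normalizer ((P : Subgroup G) : Set G) ∧
      (∀ z ∈ (P : Subgroup G), x * z = z * x → z = 1) ∧
      (∀ R ≤ (P : Subgroup G), (∀ r ∈ R, x * r * x⁻¹ ∈ R) → R ≠ P → R = ⊥) ∧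
      (∀ u ∈ (P : Subgroup G), ∀ v ∈ (P : Subgroup G), u * v = v * u) ∧
      ∀ u ∈ (P : Subgroup G), u ≠ 1 → ∀ g : G, g * u = u * g → g ∈ (P : Subgroup G) := by
  obtain ⟨q, x, hq, hpq, hx, hxN, hcard, hsup, hR, hfix⟩ :=
    exists_frobenius_complement hsub hc P hP
  have hqf : Fact q.Prime := ⟨hq⟩
  have hTIp := isSimpleGroup_sylow_inf_eq_bot hsub hc (p := p)
  have habel : ∀ u ∈ (P : Subgroup G), ∀ v ∈ (P : Subgroup G), u * v = v * u := by
    by_contra hcon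
    set R := (P : Subgroup G) ⊓ centralizer ((P : Subgroup G) : Set G) with hRdef
    have hRx : ∀ r ∈ R, x * r * x⁻¹ ∈ R := by
      intro r hr
      refine mem_inf.2 ⟨(mem_normalizer_iff.1 hxN r).1 (mem_inf.1 hr).1, ?_⟩
      rw [mem_centralizer_iff]
      intro s hs
      have h1 : x⁻¹ * s * x ∈ (P : Subgroup G) := by
        have := (mem_normalizer_iff.1 (inv_mem hxN) s).1 hs
        rwa [inv_inv] at this
      have h2 := mem_centralizer_iff.1 (mem_inf.1 hr).2 _ h1
      have h3 := congrArg (fun t => x * t * x⁻¹) h2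
      simp only [mul_assoc, mul_inv_cancel_left, mul_inv_cancel, mul_one] at h3
      simpa only [mul_assoc] using h3
    have hRP : R ≠ P := by
      intro h
      apply hcon
      intro u hu v hv
      rw [SetLike.mem_coe.symm] at hv
      have hu' : u ∈ R := by rw [h]; exact hu
      exact (mem_centralizer_iff.1 (mem_inf.1 hu').2 v hv).symm
    have hR1 : R = ⊥ := by
      rw [eq_bot_iff]
      intro r hr
      exact mem_bot.2 (hfix r (mem_inf.1 hr).1 (hR R inf_le_left hRx hRP r hr))
    have hnt : Nontrivial (P : Subgroup G) := (nontrivial_iff_ne_bot _).2 hP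
    have h2 : Nontrivial (center (P : Subgroup G)) := IsPGroup.center_nontrivial P.2
    obtain ⟨⟨⟨r, hrP⟩, hrc⟩, hr1⟩ := exists_ne (1 : center (P : Subgroup G))
    apply hr1
    have hrR : r ∈ R := by
      refine mem_inf.2 ⟨hrP, mem_centralizer_iff.2 fun s hs => ?_⟩
      exact congrArg Subtype.val (mem_center_iff.1 hrc ⟨s, hs⟩)
    rw [hR1, mem_bot] at hrR
    exact Subtype.ext (Subtype.ext hrR)
  refine ⟨q, x, hq, hpq, hx, hxN, hcard, hsup, hfix, fun R hRP hRx hne =>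
    (eq_bot_iff_forall R).2 fun r hr => hfix r (hRP hr) (hR R hRP hRx hne r hr),
    habel, fun u hu hu1 g hg => ?_⟩
  have hgN : g ∈ normalizer ((P : Subgroup G) : Set G) :=
    mem_normalizer_sylow_of_conj_mem hTIp P hu hu1 (by rwa [hg, mul_inv_cancel_right])
  have hxzN : zpowers x ≤ normalizer ((P : Subgroup G) : Set G) := by rwa [zpowers_le]
  obtain ⟨r, hr, y, hy, rfl⟩ : ∃ r ∈ (P : Subgroup G), ∃ y ∈ zpowers x, r * y = g := by
    have h1 : g ∈ (((P : Subgroup G) ⊔ zpowers x : Subgroup G) : Set G) := by rw [hsup]; exact hgN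
    rw [coe_mul_of_right_le_normalizer_left _ _ hxzN] at h1
    exact Set.mem_mul.1 h1
  by_cases hy1 : y = 1
  · rw [hy1, mul_one]; exact hr
  exfalso
  have hyu : y * u = u * y := by
    have h1 := habel r hr u hu
    have h2 : r * (y * u) = r * (u * y) := by
      rw [← mul_assoc, hg, ← mul_assoc, ← mul_assoc, h1]
    exact mul_left_cancel h2
  have hzy : zpowers y = zpowers x := by
    refine eq_of_le_of_card_ge (by rwa [zpowers_le]) ?_
    rw [Nat.card_zpowers, Nat.card_zpowers, hx]
    have h1 : orderOf y ∣ q := by rw [← hx]; exact orderOf_dvd_of_mem_zpowers hy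
    rcases (Nat.dvd_prime hq).1 h1 with h | h
    · exact absurd (orderOf_eq_one_iff.1 h) hy1
    · exact h.ge
  obtain ⟨k, hk⟩ := mem_zpowers_iff.1 (hzy ▸ mem_zpowers x)
  apply hu1
  apply hfix u hu
  rw [← hk]
  exact Commute.zpow_left hyu k

theorem exists_sylow_mem_of_ne_one {g : G} (hg : g ≠ 1)
    (h : ∀ p : ℕ, Fact p.Prime → ∀ P : Sylow p G, ∀ u ∈ (P : Subgroup G), u ≠ 1 →
      ∀ g : G, g * u = u * g → g ∈ (P : Subgroup G)) :
    ∃ (p : ℕ) (_ : Fact p.Prime) (P : Sylow p G), g ∈ (P : Subgroup G) := by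
  obtain ⟨p, hp, hpd⟩ := Nat.exists_prime_and_dvd (mt orderOf_eq_one_iff.1 hg)
  have hpf : Fact p.Prime := ⟨hp⟩
  have h1 : orderOf (g ^ (orderOf g / p)) = p := orderOf_pow_orderOf_div (orderOf_pos g).ne' hpd
  obtain ⟨P, hP⟩ := exists_sylow_of_orderOf_eq_pow (p := p) (k := 1) (by rw [h1, pow_one])
  refine ⟨p, hpf, P, h p hpf P _ hP ?_ g ((Commute.refl g).pow_right _)⟩
  intro h2
  rw [h2, orderOf_one] at h1
  exact hp.one_lt.ne h1

end SimpleFrobenius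

section Partition

open Subgroup

/-- A family of abelian subgroups whose conjugates partition the non-identity elements of the
group, each of them being its own centralizer and having a Frobenius normalizer. -/
structure FrobeniusPartition (G : Type*) [Group G] (κ : Type*) where
  A : κ → Subgroup G
  x : κ → G
  e : κ → ℕ
  ne_bot : ∀ k, A k ≠ ⊥
  e_prime : ∀ k, (e k).Prime
  orderOf_x : ∀ k, orderOf (x k) = e k
  x_mem : ∀ k, x k ∈ normalizer (A k : Set G)
  card_normalizer : ∀ k, Nat.card (normalizer (A k : Set G)) = Nat.card (A k) * e k
  sup_zpowers : ∀ k, A k ⊔ zpowers (x k) = normalizer (A k : Set G)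
  eq_one_of_commute : ∀ k, ∀ u ∈ A k, x k * u = u * x k → u = 1
  eq_bot_of_ne : ∀ k, ∀ R ≤ A k, (∀ r ∈ R, x k * r * (x k)⁻¹ ∈ R) → R ≠ A k → R = ⊥
  comm : ∀ k, ∀ u ∈ A k, ∀ v ∈ A k, u * v = v * u
  mem_of_commute : ∀ k, ∀ u ∈ A k, u ≠ 1 → ∀ g : G, g * u = u * g → g ∈ A k
  mem_normalizer : ∀ k, ∀ u ∈ A k, u ≠ 1 → ∀ g : G, g * u * g⁻¹ ∈ A k →
    g ∈ normalizer (A k : Set G)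
  eq_of_conj_mem : ∀ k l, ∀ u ∈ A k, u ≠ 1 → ∀ g : G, g * u * g⁻¹ ∈ A l → k = l
  cover : ∀ u : G, u ≠ 1 → ∃ k, ∃ g : G, g * u * g⁻¹ ∈ A k
  normalizer_ne_top : ∀ k, normalizer (A k : Set G) ≠ ⊤

namespace FrobeniusPartition

variable {G : Type*} [Group G] [Finite G] {κ : Type*} (F : FrobeniusPartition G κ)

/-- The order of a member of the partition. -/
noncomputable def a (k : κ) : ℕ := Nat.card (F.A k)

/-- The number of non-identity classes of a member of the partition under its normalizer. -/
noncomputable def w (k : κ) : ℕ := (F.a k - 1) / F.e k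

theorem one_lt_a (k : κ) : 1 < F.a k := by
  have := (nontrivial_iff_ne_bot (F.A k)).2 (F.ne_bot k)
  exact Finite.one_lt_card

theorem e_dvd (k : κ) : F.e k ∣ F.a k - 1 := by
  have hf : Fact (F.e k).Prime := ⟨F.e_prime k⟩
  set X := zpowers (F.x k) with hX
  have hXp : IsPGroup (F.e k) X :=
    IsPGroup.of_card (n := 1) (by rw [Nat.card_zpowers, F.orderOf_x, pow_one])
  have hXN : X ≤ normalizer (F.A k : Set G) := by rw [hX, zpowers_le]; exact F.x_mem k
  let _ : MulAction X (F.A k) :=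
    { smul := fun y u => ⟨y * u * (y : G)⁻¹, (mem_normalizer_iff.1 (hXN y.2) u).1 u.2⟩
      one_smul := fun u => Subtype.ext (by change (1 : G) * u * (1 : G)⁻¹ = u; simp)
      mul_smul := fun y z u => Subtype.ext (by
        change ((y * z : X) : G) * u * ((y * z : X) : G)⁻¹ =
          (y : G) * ((z : G) * u * (z : G)⁻¹) * (y : G)⁻¹
        push_cast
        group) }
  have h1 := hXp.card_modEq_card_fixedPoints (F.A k)
  have h2 : Nat.card (MulAction.fixedPoints X (F.A k)) = 1 := by
    rw [Nat.card_eq_one_iff_unique]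
    refine ⟨⟨?_⟩, ⟨⟨1, fun y => Subtype.ext (by change (y : G) * 1 * (y : G)⁻¹ = 1; simp)⟩⟩⟩
    have key : ∀ u : MulAction.fixedPoints X (F.A k), u.1 = 1 := by
      rintro ⟨u, hu⟩
      have h3 : F.x k * u * (F.x k)⁻¹ = u := congrArg Subtype.val (hu ⟨F.x k, mem_zpowers _⟩)
      exact Subtype.ext (F.eq_one_of_commute k u u.2 (mul_inv_eq_iff_eq_mul.1 h3))
    intro u v
    exact Subtype.ext ((key u).trans (key v).symm)
  rw [h2] at h1
  exact (Nat.modEq_iff_dvd' (F.one_lt_a k).le).1 h1.symm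

theorem a_eq (k : κ) : F.a k = F.w k * F.e k + 1 := by
  have h1 : F.w k * F.e k = F.a k - 1 := Nat.div_mul_cancel (F.e_dvd k)
  have := F.one_lt_a k
  omega

theorem w_pos (k : κ) : 0 < F.w k := by
  have h1 := F.a_eq k
  have h2 := F.one_lt_a k
  by_contra h
  have : F.w k = 0 := by omega
  rw [this] at h1
  omega

theorem coprime_a_e (k : κ) : Nat.Coprime (F.a k) (F.e k) := by
  rw [F.a_eq k, Nat.coprime_comm]
  simp

/-- The non-identity elements conjugate into a member of the partition. -/
def support (k : κ) : Set G := {c : G | ∃ u ∈ (F.A k : Set G) \ {1}, ∃ g : G, g * u * g⁻¹ = c}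

omit [Finite G] in
theorem disjoint_support : Pairwise (fun k l => Disjoint (F.support k) (F.support l)) := by
  intro k l hkl
  rw [Set.disjoint_left]
  rintro _ ⟨u, hu, g, rfl⟩ ⟨v, hv, h, hh⟩
  refine hkl (F.eq_of_conj_mem k l u hu.1 hu.2 (h⁻¹ * g) ?_)
  have : h⁻¹ * g * u * (h⁻¹ * g)⁻¹ = v := by
    have : h⁻¹ * g * u * (h⁻¹ * g)⁻¹ = h⁻¹ * (g * u * g⁻¹) * h := by group
    rw [this, ← hh]; group
  rw [this]
  exact hv.1

omit [Finite G] in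
theorem card_mul_a_sub_one (k : κ) :
    Nat.card G * (F.a k - 1) = (F.support k).ncard * (F.a k * F.e k) := by
  have h := card_mul_ncard_eq_of_conj (H := normalizer (F.A k : Set G))
    (U := (F.A k : Set G) \ {1}) (fun u hu g =>
      ⟨fun h => F.mem_normalizer k u hu.1 hu.2 g h.1, fun h => (conj_mem_diff_one_iff h).2 hu⟩)
  rw [ncard_diff_one, F.card_normalizer] at h
  exact h

theorem card_mul_w (k : κ) : Nat.card G * F.w k = (F.support k).ncard * F.a k := by
  have h1 := F.card_mul_a_sub_one k
  have h2 := F.a_eq k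
  have h3 : F.a k - 1 = F.w k * F.e k := by omega
  rw [h3, ← mul_assoc, ← mul_assoc] at h1
  exact Nat.eq_of_mul_eq_mul_right (F.e_prime k).pos h1

theorem card_eq_sum [Fintype κ] : Nat.card G = 1 + ∑ k, (F.support k).ncard := by
  classical
  have h1 : (Set.univ : Set G) = {1} ∪ ⋃ k, F.support k := by
    symm
    rw [Set.eq_univ_iff_forall]
    intro u
    by_cases hu : u = 1
    · exact Or.inl hu
    · obtain ⟨k, g, hg⟩ := F.cover u hu
      refine Or.inr (Set.mem_iUnion.2 ⟨k, g * u * g⁻¹, ⟨hg, ?_⟩, g⁻¹, by group⟩)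
      exact fun h => hu (conj_eq_one_iff.1 h)
  have h2 : Disjoint ({1} : Set G) (⋃ k, F.support k) := by
    rw [Set.disjoint_singleton_left, Set.mem_iUnion]
    rintro ⟨k, u, hu, g, hg⟩
    exact hu.2 (conj_eq_one_iff.1 hg)
  rw [← Set.ncard_univ, h1, Set.ncard_union_eq h2, Set.ncard_singleton,
    Set.ncard_iUnion_of_finite (fun k => Set.toFinite _) F.disjoint_support, finsum_eq_sum_of_fintype]

theorem sum_w_div_a [Fintype κ] :
    ∑ k, (F.w k : ℝ) / F.a k = 1 - 1 / Nat.card G := by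
  have hn : (0 : ℝ) < Nat.card G := by exact_mod_cast Nat.card_pos
  have h1 : ∀ k, (F.w k : ℝ) / F.a k = (F.support k).ncard / Nat.card G := by
    intro k
    have ha : (0 : ℝ) < F.a k := by exact_mod_cast (F.one_lt_a k).le
    rw [div_eq_div_iff ha.ne' hn.ne']
    have := F.card_mul_w k
    rw [mul_comm] at this
    exact_mod_cast this
  have h2 : (Nat.card G : ℝ) = 1 + ∑ k, ((F.support k).ncard : ℝ) := by exact_mod_cast F.card_eq_sum
  rw [Finset.sum_congr rfl fun k _ => h1 k, ← Finset.sum_div, eq_sub_iff_add_eq, ← add_div,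
    add_comm, ← h2, div_self hn.ne']

theorem mem_of_mem_normalizer (k : κ) {u : G} (hu : u ∈ normalizer (F.A k : Set G))
    (h : u ^ F.a k = 1) : u ∈ F.A k := by
  have hn : ((F.A k).subgroupOf (normalizer (F.A k : Set G))).Normal := normal_in_normalizer
  have hle : F.A k ≤ normalizer (F.A k : Set G) := le_normalizer
  have hidx : ((F.A k).subgroupOf (normalizer (F.A k : Set G))).index = F.e k := by
    have h1 := ((F.A k).subgroupOf (normalizer (F.A k : Set G))).card_mul_index
    rw [Nat.card_congr (subgroupOfEquivOfLe hle).toEquiv, F.card_normalizer] at h1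
    exact Nat.eq_of_mul_eq_mul_left (Nat.card_pos) h1
  have h2 : u ^ F.e k ∈ F.A k := by
    have := pow_index_mem ((F.A k).subgroupOf (normalizer (F.A k : Set G))) ⟨u, hu⟩
    rw [hidx] at this
    exact mem_subgroupOf.1 this
  have h3 : orderOf u ∣ F.a k := orderOf_dvd_of_pow_eq_one h
  have h4 : Nat.Coprime (orderOf u) (F.e k) := Nat.Coprime.coprime_dvd_left h3 (F.coprime_a_e k)
  obtain ⟨m, hm⟩ := exists_pow_eq_self_of_coprime h4.symm
  rw [← hm]
  exact pow_mem h2 m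

omit [Finite G] in
theorem pow_a_eq_one (k : κ) {u : G} (hu : u ∈ F.A k) : u ^ F.a k = 1 :=
  congrArg Subtype.val (pow_card_eq_one' (x := (⟨u, hu⟩ : F.A k)))

theorem mul_le_card (k : κ) : F.a k * F.e k * (F.a k + 1) ≤ Nat.card G := by
  obtain ⟨g, hg⟩ : ∃ g, g ∉ normalizer (F.A k : Set G) := by
    by_contra! h
    exact F.normalizer_ne_top k ((eq_top_iff' _).2 h)
  set N := normalizer (F.A k : Set G) with hN
  set V : Set G := Set.range fun um : F.A k × N => (um.1 : G) * g * um.2 with hV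
  have hVcard : V.ncard = F.a k * (F.a k * F.e k) := by
    rw [hV, ← Nat.card_coe_set_eq, ← Nat.card_congr (Equiv.ofInjective _ ?_), Nat.card_prod,
      F.card_normalizer]
    · rfl
    rintro ⟨u, m⟩ ⟨v, l⟩ h
    have h1 : (u : G) * g * m = v * g * l := h
    have h2 : (v : G)⁻¹ * u = g * (l * (m : G)⁻¹) * g⁻¹ := by
      rw [inv_mul_eq_iff_eq_mul, ← mul_left_inj (g * m)]
      simp only [← mul_assoc, inv_mul_cancel_right]
      exact h1
    have h3 : (v : G)⁻¹ * u = 1 := by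
      by_contra hne
      have hA : (v : G)⁻¹ * u ∈ F.A k := mul_mem (inv_mem v.2) u.2
      have hlm : (l : G) * (m : G)⁻¹ ∈ F.A k := by
        apply F.mem_of_mem_normalizer k (mul_mem l.2 (inv_mem m.2))
        have h4 := F.pow_a_eq_one k hA
        rw [h2, conj_pow] at h4
        exact conj_eq_one_iff.1 h4
      apply hg
      refine F.mem_normalizer k _ hlm ?_ g (h2 ▸ hA)
      intro h5
      rw [h5] at h2
      exact hne (by rw [h2]; simp)
    have huv : u = v := Subtype.ext (inv_mul_eq_one.1 h3).symm
    subst huv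
    rw [mul_right_inj] at h1
    rw [Subtype.ext h1]
  have hdisj : Disjoint V (N : Set G) := by
    rw [Set.disjoint_left]
    rintro _ ⟨⟨u, m⟩, rfl⟩ h
    apply hg
    have h1 := (mul_mem_cancel_right m.2).1 h
    exact (mul_mem_cancel_left (le_normalizer u.2)).1 h1
  have h1 := Set.ncard_union_eq hdisj
  have h2 := Set.ncard_le_card (V ∪ (N : Set G))
  have h3 : (N : Set G).ncard = F.a k * F.e k := by
    rw [← Nat.card_coe_set_eq]; exact F.card_normalizer k
  rw [h1, hVcard, h3] at h2
  linarith

end FrobeniusPartition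

end Partition

section PartitionOfSimple

open Subgroup

variable {G : Type*} [Group G] [Finite G]

theorem exists_frobeniusPartition [IsSimpleGroup G] (hsub : ProperNilpotentOrMinimal G)
    (hc : commutator G = ⊤) : ∃ F : FrobeniusPartition G (Nat.card G).primeFactors,
      ∀ p, F.a p = (p : ℕ) ^ (Nat.card G).factorization p := by
  classical
  have hf : ∀ p : (Nat.card G).primeFactors, Fact (p : ℕ).Prime := fun p =>
    ⟨Nat.prime_of_mem_primeFactors p.2⟩
  let P : ∀ p : (Nat.card G).primeFactors, Sylow p G := fun p => default
  have hP : ∀ p, (P p : Subgroup G) ≠ ⊥ := fun p =>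
    (P p).ne_bot_of_dvd_card (Nat.dvd_of_mem_primeFactors p.2)
  choose q x hq hpq hx hxN hcard hsup hfix hmin hcomm hcent using fun p =>
    exists_frobenius_structure hsub hc (P p) (hP p)
  have hTI : ∀ p : (Nat.card G).primeFactors, ∀ P Q : Sylow p G, P ≠ Q →
      ((P : Subgroup G) ⊓ Q : Subgroup G) = ⊥ := fun p =>
    isSimpleGroup_sylow_inf_eq_bot hsub hc
  refine ⟨⟨fun p => P p, x, q, hP, hq, hx, hxN, hcard, hsup, fun p u hu h => hfix p u hu h, hmin,
    hcomm, hcent, ?_, ?_, ?_, ?_⟩, ?_⟩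
  · intro p u hu hu1 g hg
    exact mem_normalizer_sylow_of_conj_mem (hTI p) (P p) hu hu1 hg
  · intro p l u hu hu1 g hg
    by_contra hne
    obtain ⟨s, hs⟩ := IsPGroup.iff_orderOf.1 (P p).2 ⟨u, hu⟩
    obtain ⟨t, ht⟩ := IsPGroup.iff_orderOf.1 (P l).2 ⟨_, hg⟩
    rw [Subgroup.orderOf_mk] at hs ht
    have h1 : orderOf (g * u * g⁻¹) = orderOf u := (MulAut.conj g).orderOf_eq u
    have h2 : Nat.Coprime ((p : ℕ) ^ s) ((l : ℕ) ^ t) :=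
      Nat.Coprime.pow _ _ ((Nat.coprime_primes (hf p).1 (hf l).1).2 fun h => hne (Subtype.ext h))
    rw [← hs, ← ht, h1, Nat.coprime_self, orderOf_eq_one_iff] at h2
    exact hu1 h2
  · intro u hu
    obtain ⟨p, hp, Q, hQ⟩ := exists_sylow_mem_of_ne_one hu (by
      intro p hp Q u hu hu1
      have hQ : (Q : Subgroup G) ≠ ⊥ := by
        intro h
        rw [h, mem_bot] at hu
        exact hu1 hu
      obtain ⟨-, -, -, -, -, -, -, -, -, -, -, h⟩ := exists_frobenius_structure hsub hc Q hQ
      exact h u hu hu1)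
    have hp' : p ∈ (Nat.card G).primeFactors := by
      refine Nat.mem_primeFactors.2 ⟨hp.1, ?_, Nat.card_pos.ne'⟩
      obtain ⟨s, hs⟩ := IsPGroup.iff_orderOf.1 Q.2 ⟨u, hQ⟩
      rw [Subgroup.orderOf_mk] at hs
      have hs0 : s ≠ 0 := by
        rintro rfl
        rw [pow_zero, orderOf_eq_one_iff] at hs
        exact hu hs
      exact (dvd_pow_self p hs0).trans (hs ▸ orderOf_dvd_natCard u)
    obtain ⟨g, hg⟩ := MulAction.exists_smul_eq G Q (P ⟨p, hp'⟩)
    refine ⟨⟨p, hp'⟩, g, ?_⟩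
    rw [← hg, Sylow.smul_def, Sylow.pointwise_smul_def]
    exact ⟨u, hQ, rfl⟩
  · exact fun p => normalizer_sylow_ne_top hc (P p) (hP p)
  · exact fun p => (P p).card_eq_multiplicity

end PartitionOfSimple

section Involutions

open Subgroup

namespace FrobeniusPartition

variable {G : Type*} [Group G] [Finite G] {κ : Type*} (F : FrobeniusPartition G κ)

omit [Finite G] in
theorem mul_self_of_mem_support {k₀ : κ} (h2 : ∀ u ∈ F.A k₀, u * u = 1) {t : G}
    (ht : t ∈ F.support k₀) : t * t = 1 ∧ t ≠ 1 := by
  obtain ⟨u, ⟨hu, hu1⟩, g, rfl⟩ := ht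
  refine ⟨?_, fun h => hu1 (conj_eq_one_iff.1 h)⟩
  have : g * u * g⁻¹ * (g * u * g⁻¹) = g * (u * u) * g⁻¹ := by group
  rw [this, h2 u hu]; simp

theorem ncard_inverting_le [DecidableEq κ] {k₀ : κ} (h2 : ∀ u ∈ F.A k₀, u * u = 1)
    (hodd : ∀ k ≠ k₀, Odd (F.a k)) {k : κ} {z : G} (hz : z ∈ F.support k) :
    {t | t ∈ F.support k₀ ∧ t * z ∈ F.support k₀}.ncard ≤
      if k = k₀ then F.a k₀ - 2 else if F.e k = 2 then F.a k else 0 := by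
  obtain ⟨u, ⟨hu, hu1⟩, g, rfl⟩ := hz
  have key : ∀ t, t ∈ F.support k₀ → t * (g * u * g⁻¹) ∈ F.support k₀ →
      (g⁻¹ * t * g) * u * (g⁻¹ * t * g)⁻¹ = u⁻¹ := by
    intro t ht htz
    have h3 := (F.mul_self_of_mem_support h2 ht).1
    have h4 := (F.mul_self_of_mem_support h2 htz).1
    have h5 : t⁻¹ = t := inv_eq_of_mul_eq_one_left h3
    rw [eq_inv_iff_mul_eq_one]
    have : g⁻¹ * t * g * u * (g⁻¹ * t * g)⁻¹ * u =
      g⁻¹ * (t * (g * u * g⁻¹) * (t⁻¹ * (g * u * g⁻¹))) * g := by group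
    rw [this, h5, h4]; simp
  have hN : ∀ t, t ∈ F.support k₀ → t * (g * u * g⁻¹) ∈ F.support k₀ →
      g⁻¹ * t * g ∈ normalizer (F.A k : Set G) := fun t ht htz =>
    F.mem_normalizer k u hu hu1 _ (by rw [key t ht htz]; exact inv_mem hu)
  split_ifs with hk he
  · subst hk
    have h6 : {t | t ∈ F.support k ∧ t * (g * u * g⁻¹) ∈ F.support k} ⊆
        (fun s => g * s * g⁻¹) '' (((F.A k : Set G) \ {1}) \ {u}) := by
      rintro t ⟨ht, htz⟩
      refine ⟨g⁻¹ * t * g, ⟨⟨?_, ?_⟩, ?_⟩, by group⟩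
      · refine F.mem_of_commute k u hu hu1 _ ?_
        have h7 := key t ht htz
        rw [inv_eq_of_mul_eq_one_left (h2 u hu)] at h7
        exact mul_inv_eq_iff_eq_mul.1 h7
      · intro h
        apply (F.mul_self_of_mem_support h2 ht).2
        have h8 : g⁻¹ * t * g = 1 := h
        have : t = g * (g⁻¹ * t * g) * g⁻¹ := by group
        rw [this, h8]; simp
      · intro h
        apply (F.mul_self_of_mem_support h2 htz).2
        have h8 : g⁻¹ * t * g = u := h
        have : t = g * (g⁻¹ * t * g) * g⁻¹ := by group
        rw [this, h8]
        have : g * u * g⁻¹ * (g * u * g⁻¹) = g * (u * u) * g⁻¹ := by group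
        rw [this, h2 u hu]; simp
    refine (Set.ncard_le_ncard h6 (Set.toFinite _)).trans ((Set.ncard_image_le).trans ?_)
    rw [Set.ncard_sdiff_singleton_of_mem (show u ∈ (F.A k : Set G) \ {1} from ⟨hu, hu1⟩),
      ncard_diff_one]
    exact le_of_eq (by rw [Nat.sub_sub]; rfl)
  · rcases Set.eq_empty_or_nonempty
      {t | t ∈ F.support k₀ ∧ t * (g * u * g⁻¹) ∈ F.support k₀} with h | ⟨t₀, ht₀, htz₀⟩
    · rw [h]; simp
    · have h6 : {t | t ∈ F.support k₀ ∧ t * (g * u * g⁻¹) ∈ F.support k₀} ⊆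
          (fun s => t₀ * (g * s * g⁻¹)) '' (F.A k : Set G) := by
        rintro t ⟨ht, htz⟩
        refine ⟨g⁻¹ * (t₀⁻¹ * t) * g, ?_, by group⟩
        refine F.mem_of_commute k u hu hu1 _ ?_
        have h7 := key t ht htz
        rw [← key t₀ ht₀ htz₀] at h7
        have h8 := congrArg (fun y => g⁻¹ * t₀⁻¹ * g * y * (g⁻¹ * t * g)) h7
        simp only [← mul_assoc, mul_inv_rev, inv_inv] at h8 ⊢
        simpa using h8
      refine (Set.ncard_le_ncard h6 (Set.toFinite _)).trans ((Set.ncard_image_le).trans ?_)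
      rw [← Nat.card_coe_set_eq]
      rfl
  · rw [Nat.le_zero, Set.ncard_eq_zero]
    by_contra hne
    obtain ⟨t, ht, htz⟩ := Set.nonempty_iff_ne_empty.2 hne
    have h3 := F.mul_self_of_mem_support h2 ht
    have h4 : orderOf (g⁻¹ * t * g) ∣ F.a k * F.e k := by
      rw [a, ← F.card_normalizer k]
      exact orderOf_dvd_natCard _ (hN t ht htz)
    have h5 : orderOf (g⁻¹ * t * g) = 2 := by
      rw [orderOf_eq_prime_iff]
      constructor
      · rw [pow_two]
        have : g⁻¹ * t * g * (g⁻¹ * t * g) = g⁻¹ * (t * t) * g := by group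
        rw [this, h3.1]; simp
      · intro h
        apply h3.2
        have : t = g * (g⁻¹ * t * g) * g⁻¹ := by group
        rw [this, h]; simp
    rw [h5, (Nat.prime_two).dvd_mul] at h4
    rcases h4 with h4 | h4
    · exact (Nat.not_even_iff_odd.2 (hodd k hk)) (even_iff_two_dvd.2 h4)
    · exact he ((Nat.prime_dvd_prime_iff_eq Nat.prime_two (F.e_prime k)).1 h4).symm

theorem ncard_support_mul_self_le [Fintype κ] [DecidableEq κ] {k₀ : κ} (h2 : ∀ u ∈ F.A k₀, u * u = 1)
    (hodd : ∀ k ≠ k₀, Odd (F.a k)) :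
    (F.support k₀).ncard * (F.support k₀).ncard ≤ (F.support k₀).ncard * (F.a k₀ - 1) +
      ∑ k with k ≠ k₀ ∧ F.e k = 2, (F.support k).ncard * F.a k := by
  classical
  have := Fintype.ofFinite G
  set I := (F.support k₀).toFinset with hI
  set c : κ → ℕ := fun k => if k = k₀ then F.a k₀ - 2 else if F.e k = 2 then F.a k else 0 with hc
  have hIc : I.card = (F.support k₀).ncard := by rw [hI, Set.ncard_eq_toFinset_card']
  let D : G → Finset G := fun z => {t ∈ I | t * z ∈ I}
  have h3 : I.card * I.card = ∑ z, (D z).card := by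
    rw [← Finset.card_product, ← Finset.card_sigma]
    refine Finset.card_bij' (fun p _ => ⟨p.1⁻¹ * p.2, p.1⟩) (fun s _ => (s.2, s.2 * s.1)) ?_ ?_ ?_ ?_
    · rintro ⟨t, u⟩ h
      simpa [D] using h
    · rintro ⟨z, t⟩ h
      simpa [D] using h
    · rintro ⟨t, u⟩ _
      simp
    · rintro ⟨z, t⟩ _
      simp
  have h4 : (Finset.univ : Finset G) = {1} ∪ Finset.univ.biUnion fun k => (F.support k).toFinset := by
    symm
    rw [Finset.eq_univ_iff_forall]
    intro u
    by_cases hu : u = 1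
    · simp [hu]
    · obtain ⟨k, g, hg⟩ := F.cover u hu
      simp only [Finset.mem_union, Finset.mem_biUnion, Finset.mem_univ, true_and, Set.mem_toFinset]
      exact Or.inr ⟨k, g * u * g⁻¹, ⟨hg, fun h => hu (conj_eq_one_iff.1 h)⟩, g⁻¹, by group⟩
  have h5 : ∀ k, ∀ z ∈ (F.support k).toFinset, (D z).card ≤ c k := by
    intro k z hz
    rw [Set.mem_toFinset] at hz
    refine le_trans (le_of_eq ?_) (F.ncard_inverting_le h2 hodd hz)
    rw [← Set.ncard_coe_finset]
    congr 1
    ext t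
    simp [D, hI]
  have h6 : ∑ z, (D z).card ≤ I.card + ∑ k, (F.support k).ncard * c k := by
    rw [h4]
    calc _ ≤ ∑ z ∈ {1}, (D z).card +
        ∑ z ∈ Finset.univ.biUnion fun k => (F.support k).toFinset, (D z).card := by
          rw [← Finset.sum_union_inter]; exact Nat.le_add_right _ _
      _ ≤ I.card + ∑ k, ∑ z ∈ (F.support k).toFinset, (D z).card := by
          refine Nat.add_le_add ?_ ?_
          · rw [Finset.sum_singleton]; exact Finset.card_filter_le _ _
          · refine le_of_eq (Finset.sum_biUnion fun k _ l _ hkl => ?_)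
            exact Set.disjoint_toFinset.2 (F.disjoint_support hkl)
      _ ≤ _ := by
          refine Nat.add_le_add_left (Finset.sum_le_sum fun k _ => ?_) _
          refine (Finset.sum_le_card_nsmul _ _ _ (h5 k)).trans ?_
          rw [smul_eq_mul, Set.ncard_eq_toFinset_card']
  have h7 : ∑ k, (F.support k).ncard * c k = (F.support k₀).ncard * (F.a k₀ - 2) +
      ∑ k with k ≠ k₀ ∧ F.e k = 2, (F.support k).ncard * F.a k := by
    rw [← Finset.add_sum_erase _ _ (Finset.mem_univ k₀)]
    congr 1
    · simp [hc]
    · rw [Finset.sum_filter]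
      rw [← Finset.add_sum_erase Finset.univ _ (Finset.mem_univ k₀)]
      simp only [ne_eq, not_true_eq_false, false_and, if_false, zero_add]
      refine Finset.sum_congr rfl fun k hk => ?_
      have : k ≠ k₀ := (Finset.mem_erase.1 hk).1
      simp [hc, this]
  rw [← h3, h7, hIc] at h6
  refine h6.trans (le_of_eq ?_)
  have h8 := F.one_lt_a k₀
  obtain ⟨b, hb⟩ : ∃ b, F.a k₀ = b + 2 := ⟨F.a k₀ - 2, by omega⟩
  rw [hb]
  simp
  ring

end FrobeniusPartition

end Involutions

section EvenCase

open Subgroup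

namespace FrobeniusPartition

section

variable {G : Type*} [Group G] [Finite G] {κ : Type*} (F : FrobeniusPartition G κ)

theorem mul_self_of_two_dvd {k : κ} (h2 : 2 ∣ F.a k) : ∀ u ∈ F.A k, u * u = 1 := by
  let R : Subgroup G :=
    { carrier := {u | u ∈ F.A k ∧ u * u = 1}
      mul_mem' := by
        rintro u v ⟨hu, hu2⟩ ⟨hv, hv2⟩
        refine ⟨mul_mem hu hv, ?_⟩
        rw [mul_assoc, ← mul_assoc v, F.comm k v hv u hu, mul_assoc u, hv2, mul_one, hu2]
      one_mem' := ⟨one_mem _, by simp⟩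
      inv_mem' := by
        rintro u ⟨hu, hu2⟩
        exact ⟨inv_mem hu, by rw [← mul_inv_rev, hu2, inv_one]⟩ }
  by_contra hcon
  have hR : R = ⊥ := by
    refine F.eq_bot_of_ne k R (fun u hu => hu.1) ?_ ?_
    · rintro r ⟨hr, hr2⟩
      refine ⟨(mem_normalizer_iff.1 (F.x_mem k) r).1 hr, ?_⟩
      have : F.x k * r * (F.x k)⁻¹ * (F.x k * r * (F.x k)⁻¹) = F.x k * (r * r) * (F.x k)⁻¹ := by
        group
      rw [this, hr2]; simp
    · intro h
      apply hcon
      intro u hu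
      rw [← h] at hu
      exact hu.2
  have hf : Fact (Nat.Prime 2) := ⟨Nat.prime_two⟩
  obtain ⟨u, hu⟩ := exists_prime_orderOf_dvd_card' (G := F.A k) 2 h2
  have hu1 : (u : G) ∈ R := by
    refine ⟨u.2, ?_⟩
    have := pow_orderOf_eq_one u
    rw [hu, pow_two] at this
    exact congrArg Subtype.val this
  rw [hR, mem_bot] at hu1
  have : u = 1 := Subtype.ext hu1
  rw [this, orderOf_one] at hu
  omega

theorem a_eq_of_e_eq_two {k : κ} (he : F.e k = 2) {p : ℕ} (hp : p.Prime) (hpa : p ∣ F.a k) :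
    F.a k = p := by
  have hx2 : F.x k * F.x k = 1 := by
    have := pow_orderOf_eq_one (F.x k)
    rwa [F.orderOf_x, he, pow_two] at this
  have hinv : ∀ u ∈ F.A k, F.x k * u * (F.x k)⁻¹ = u⁻¹ := by
    intro u hu
    have hxu := (mem_normalizer_iff.1 (F.x_mem k) u).1 hu
    rw [eq_inv_iff_mul_eq_one]
    refine F.eq_one_of_commute k _ (mul_mem hxu hu) ?_
    have hx : (F.x k)⁻¹ = F.x k := inv_eq_of_mul_eq_one_left hx2
    rw [hx]
    rw [hx] at hxu
    calc F.x k * (F.x k * u * F.x k * u) = (F.x k * F.x k) * (u * (F.x k * u)) := by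
          simp only [mul_assoc]
      _ = u * (F.x k * u) * (F.x k * F.x k) := by rw [hx2, one_mul, mul_one]
      _ = u * (F.x k * u * F.x k) * F.x k := by simp only [mul_assoc]
      _ = F.x k * u * F.x k * u * F.x k := by rw [F.comm k u hu _ hxu]
  have hf : Fact p.Prime := ⟨hp⟩
  obtain ⟨u, hu⟩ := exists_prime_orderOf_dvd_card' (G := F.A k) p hpa
  have h1 : zpowers (u : G) = F.A k := by
    by_contra hne
    have h2 := F.eq_bot_of_ne k (zpowers (u : G)) (by rw [zpowers_le]; exact u.2) (by
      intro r hr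
      rw [hinv r ((zpowers_le (H := F.A k)).2 u.2 hr)]
      exact inv_mem hr) hne
    rw [zpowers_eq_bot] at h2
    have : u = 1 := Subtype.ext h2
    rw [this, orderOf_one] at hu
    exact hp.one_lt.ne hu
  rw [a, ← h1, Nat.card_zpowers, Subgroup.orderOf_coe, hu]

end

theorem false_of_one_inverted {a q w N b : ℕ} (ha : a = w * q + 1) (hq : 3 ≤ q) (hw : 1 ≤ w)
    (hN : a + 1 ≤ N) (hb : b = q ∨ b ∣ N)
    (h : 2 * w * (a - 1) * (N - 1) ≤ a * (b - 1)) : False := by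
  have hqa : q + 1 ≤ a := by rw [ha]; nlinarith
  have hb' : b ≤ N := by
    rcases hb with rfl | hb
    · omega
    · exact Nat.le_of_dvd (by omega) hb
  obtain ⟨c, rfl⟩ : ∃ c, a = c + 1 := ⟨a - 1, by omega⟩
  obtain ⟨M, rfl⟩ : ∃ M, N = M + 1 := ⟨N - 1, by omega⟩
  simp only [Nat.add_sub_cancel] at h
  have h1 : (c + 1) * (b - 1) ≤ (c + 1) * M := Nat.mul_le_mul_left _ (by omega)
  have h2 : 2 * 1 * c * M ≤ 2 * w * c * M := by gcongr
  have h3 : 0 < M := by omega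
  nlinarith

theorem eq_of_two_inverted {a q w N b c : ℕ} (ha : a = w * q + 1) (hq : 3 ≤ q) (hw : 1 ≤ w)
    (hN : a + 1 ≤ N) (hb1 : 1 < b) (hbc : b < c) (hc : c = q ∨ c ∣ N)
    (h : 2 * w * (a - 1) * (N - 1) ≤ a * ((b - 1) + (c - 1)))
    (hcl : (w : ℝ) / a < (1 / b + 1 / c) / 2) : c = N := by
  have hqa : q + 1 ≤ a := by rw [ha]; nlinarith
  have hbq : b ≤ q := by
    by_contra! hlt
    have h1 : (1 : ℝ) / (q + 1) ≤ w / a := by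
      rw [div_le_div_iff₀ (by positivity) (by exact_mod_cast (by omega : 0 < a)), ha]
      push_cast
      have : (1 : ℝ) ≤ w := by exact_mod_cast hw
      linarith
    have h2 : (1 : ℝ) / b ≤ 1 / (q + 1) :=
      one_div_le_one_div_of_le (by positivity) (by exact_mod_cast hlt)
    have h3 : (1 : ℝ) / c ≤ 1 / (q + 1) :=
      one_div_le_one_div_of_le (by positivity) (by exact_mod_cast (by omega : q + 1 ≤ c))
    linarith
  obtain ⟨d, rfl⟩ : ∃ d, a = d + 1 := ⟨a - 1, by omega⟩
  obtain ⟨M, rfl⟩ : ∃ M, N = M + 1 := ⟨N - 1, by omega⟩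
  simp only [Nat.add_sub_cancel] at h
  have h2 : 2 * 1 * d * M ≤ 2 * w * d * M := by gcongr
  by_cases hcq : c ≤ q
  · exfalso
    have h1 : (d + 1) * ((b - 1) + (c - 1)) ≤ (d + 1) * (2 * (d - 1)) :=
      Nat.mul_le_mul_left _ (by omega)
    obtain ⟨f, rfl⟩ : ∃ f, d = f + 1 := ⟨d - 1, by omega⟩
    simp only [Nat.add_sub_cancel] at h1
    nlinarith
  have hcd : c ∣ M + 1 := by
    rcases hc with h | h
    · omega
    · exact h
  obtain ⟨r, hr⟩ := hcd
  have hr0 : r ≠ 0 := by rintro rfl; omega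
  have hr1 : r = 1 ∨ 2 ≤ r := by omega
  rcases hr1 with rfl | hr2
  · omega
  exfalso
  have h4 : 2 * c ≤ M + 1 := by rw [hr]; nlinarith
  have h5 : (d + 1) * ((b - 1) + (c - 1)) * 2 ≤ (d + 1) * (2 * (d - 1) + (M - 1)) := by
    rw [mul_assoc]
    exact Nat.mul_le_mul_left _ (by omega)
  obtain ⟨f, rfl⟩ : ∃ f, d = f + 1 := ⟨d - 1, by omega⟩
  obtain ⟨L, rfl⟩ : ∃ L, M = L + 1 := ⟨M - 1, by omega⟩
  simp only [Nat.add_sub_cancel] at h5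
  nlinarith

theorem one_div_add_lt_one {b c d : ℕ} (hb : Odd b) (hc : Odd c) (hd : Odd d) (hb1 : 1 < b)
    (hc1 : 1 < c) (hd1 : 1 < d) (hbc : b ≠ c) (hbd : b ≠ d) (hcd : c ≠ d) :
    (1 : ℝ) / b + 1 / c + 1 / d < 1 := by
  have key : ∀ m : ℕ, ∀ x : ℕ, 0 < m → m ≤ x → (1 : ℝ) / x ≤ 1 / m := fun m x _ h =>
    one_div_le_one_div_of_le (by positivity) (by exact_mod_cast h)
  have h3 : 3 ≤ b ∧ 3 ≤ c ∧ 3 ≤ d := by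
    rcases hb with ⟨x, rfl⟩; rcases hc with ⟨y, rfl⟩; rcases hd with ⟨z, rfl⟩
    omega
  have h5 : (5 ≤ b ∧ 5 ≤ c) ∨ (5 ≤ b ∧ 5 ≤ d) ∨ (5 ≤ c ∧ 5 ≤ d) := by
    rcases hb with ⟨x, rfl⟩; rcases hc with ⟨y, rfl⟩; rcases hd with ⟨z, rfl⟩
    omega
  have k1 := key 3 b (by norm_num) h3.1
  have k2 := key 3 c (by norm_num) h3.2.1
  have k3 := key 3 d (by norm_num) h3.2.2
  push_cast at k1 k2 k3
  rcases h5 with h | h | h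
  · have k4 := key 5 b (by norm_num) h.1
    have k5 := key 5 c (by norm_num) h.2
    push_cast at k4 k5; linarith
  · have k4 := key 5 b (by norm_num) h.1
    have k5 := key 5 d (by norm_num) h.2
    push_cast at k4 k5; linarith
  · have k4 := key 5 c (by norm_num) h.1
    have k5 := key 5 d (by norm_num) h.2
    push_cast at k4 k5; linarith

theorem card_primeFactors_mul_le_three {m q b : ℕ} (hq : q.Prime) (hb : b.Prime) :
    (2 ^ m * q * b).primeFactors.card ≤ 3 := by
  have h1 : (2 ^ m * q * b).primeFactors ⊆ {2, q, b} := by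
    intro p hp
    have hpp := Nat.prime_of_mem_primeFactors hp
    have hpd := Nat.dvd_of_mem_primeFactors hp
    rw [hpp.dvd_mul, hpp.dvd_mul, Nat.prime_dvd_prime_iff_eq hpp hq,
      Nat.prime_dvd_prime_iff_eq hpp hb] at hpd
    simp only [Finset.mem_insert, Finset.mem_singleton]
    rcases hpd with (h | h) | h
    · exact Or.inl ((Nat.prime_dvd_prime_iff_eq hpp Nat.prime_two).1 (hpp.dvd_of_dvd_pow h))
    · exact Or.inr (Or.inl h)
    · exact Or.inr (Or.inr h)
  exact (Finset.card_le_card h1).trans Finset.card_le_three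

theorem card_primeFactors_le_three_of_two_dvd {G : Type*} [Group G] [Finite G]
    {κ : Finset ℕ} (hκ : κ = (Nat.card G).primeFactors) (F : FrobeniusPartition G κ)
    (hF : ∀ p, F.a p = (p : ℕ) ^ (Nat.card G).factorization p) (h2 : 2 ∣ Nat.card G) :
    (Nat.card G).primeFactors.card ≤ 3 := by
  classical
  have hn0 : Nat.card G ≠ 0 := Nat.card_pos.ne'
  have hmem : ∀ p : κ, (p : ℕ) ∈ (Nat.card G).primeFactors := fun p => by rw [← hκ]; exact p.2
  have hpr : ∀ p : κ, (p : ℕ).Prime := fun p => Nat.prime_of_mem_primeFactors (hmem p)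
  let k₀ : κ := ⟨2, by rw [hκ]; exact Nat.mem_primeFactors.2 ⟨Nat.prime_two, h2, hn0⟩⟩
  have hdvd : ∀ p : κ, (p : ℕ) ∣ F.a p := fun p => by
    rw [hF]
    exact dvd_pow_self _ ((hpr p).factorization_pos_of_dvd hn0 (Nat.dvd_of_mem_primeFactors (hmem p))).ne'
  have hodd : ∀ k ≠ k₀, Odd (F.a k) := by
    intro k hk
    rw [hF]
    refine ((hpr k).odd_of_ne_two fun h => hk (Subtype.ext h)).pow
  have hsq := F.mul_self_of_two_dvd (hdvd k₀)
  have hcount := F.ncard_support_mul_self_le hsq hodd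
  set K : Finset κ := {k | k ≠ k₀ ∧ F.e k = 2} with hK
  have hKmem : ∀ k, k ∈ K → k ≠ k₀ ∧ F.e k = 2 := fun k hk => (Finset.mem_filter.1 hk).2
  have hKa : ∀ k ∈ K, F.a k = k := fun k hk => F.a_eq_of_e_eq_two (hKmem k hk).2 (hpr k) (hdvd k)
  obtain ⟨N, hN⟩ : Nat.card (normalizer (F.A k₀ : Set G)) ∣ Nat.card G :=
    card_subgroup_dvd_card _
  rw [F.card_normalizer] at hN
  change _ = F.a k₀ * F.e k₀ * N at hN
  have ha := F.a_eq k₀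
  have hw := F.w_pos k₀
  have h1a := F.one_lt_a k₀
  have hqp := F.e_prime k₀
  have hq3 : 3 ≤ F.e k₀ := by
    have h4 := F.coprime_a_e k₀
    have h5 : F.e k₀ ≠ 2 := by
      intro h
      rw [h] at h4
      have := hdvd k₀
      exact Nat.Prime.not_coprime_iff_dvd.2 ⟨2, Nat.prime_two, this, dvd_rfl⟩ h4
    have := hqp.two_le
    omega
  have hle := F.mul_le_card k₀
  rw [hN] at hle
  have hNa : F.a k₀ + 1 ≤ N := le_of_mul_le_mul_left hle (Nat.mul_pos (by omega) hqp.pos)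
  have hI : (F.support k₀).ncard = N * (F.a k₀ - 1) := by
    have h4 := F.card_mul_a_sub_one k₀
    rw [hN] at h4
    have h5 : 0 < F.a k₀ * F.e k₀ := Nat.mul_pos (by omega) hqp.pos
    exact (Nat.eq_of_mul_eq_mul_right h5 (by rw [← h4]; ring)).symm
  have hmain : 2 * F.w k₀ * (F.a k₀ - 1) * (N - 1) ≤ F.a k₀ * ∑ k ∈ K, (F.a k - 1) := by
    have h4 : ∑ k ∈ K, (F.support k).ncard * F.a k = Nat.card G * ∑ k ∈ K, F.w k := by
      rw [Finset.mul_sum]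
      exact Finset.sum_congr rfl fun k _ => (F.card_mul_w k).symm
    have h5 : ∑ k ∈ K, (F.a k - 1) = 2 * ∑ k ∈ K, F.w k := by
      rw [Finset.mul_sum]
      refine Finset.sum_congr rfl fun k hk => ?_
      rw [F.a_eq k, (hKmem k hk).2]
      simp [mul_comm]
    rw [h4, hI, hN] at hcount
    rw [h5]
    obtain ⟨M, rfl⟩ : ∃ M, N = M + 1 := ⟨N - 1, by omega⟩
    have h6 : F.a k₀ - 1 = F.w k₀ * F.e k₀ := by omega
    rw [h6] at hcount ⊢
    generalize ∑ k ∈ K, F.w k = S at *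
    have h7 : (M + 1) * F.e k₀ * (F.w k₀ * (F.w k₀ * F.e k₀) * M) ≤
        (M + 1) * F.e k₀ * (F.a k₀ * S) := by nlinarith
    have h8 := le_of_mul_le_mul_left h7 (Nat.mul_pos (by omega) hqp.pos)
    simp only [Nat.add_sub_cancel]
    linarith
  have hsum := F.sum_w_div_a
  have hn : (0 : ℝ) < 1 / Nat.card G := by
    have : (0 : ℝ) < Nat.card G := by exact_mod_cast Nat.card_pos
    positivity
  have hKw : ∀ k ∈ K, (F.w k : ℝ) / F.a k = 1 / 2 - 1 / (2 * (k : ℕ)) := by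
    intro k hk
    have h4 := F.a_eq k
    rw [hKa k hk, (hKmem k hk).2] at h4
    have h5 : (((k : ℕ)) : ℝ) = F.w k * 2 + 1 := by exact_mod_cast h4
    have h6 : (0 : ℝ) < F.w k := by exact_mod_cast F.w_pos k
    rw [hKa k hk, h5]
    field_simp
    ring
  have hle : ∀ s : Finset κ, ∑ k ∈ s, (F.w k : ℝ) / F.a k < 1 := by
    intro s
    have := Finset.sum_le_sum_of_subset_of_nonneg (Finset.subset_univ s)
      (f := fun k => (F.w k : ℝ) / F.a k) fun k _ _ => by positivity
    linarith
  have hKodd : ∀ k ∈ K, Odd (k : ℕ) := fun k hk => by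
    rw [← hKa k hk]; exact hodd k (hKmem k hk).1
  have hKN : ∀ k ∈ K, (k : ℕ) = F.e k₀ ∨ (k : ℕ) ∣ N := by
    intro k hk
    have h4 : (k : ℕ) ∣ F.a k₀ * F.e k₀ * N := by
      rw [← hN]; exact Nat.dvd_of_mem_primeFactors (hmem k)
    rw [(hpr k).dvd_mul, (hpr k).dvd_mul, Nat.prime_dvd_prime_iff_eq (hpr k) hqp] at h4
    rcases h4 with (h4 | h4) | h4
    · rw [hF] at h4
      have h5 := (Nat.prime_dvd_prime_iff_eq (hpr k) Nat.prime_two).1 ((hpr k).dvd_of_dvd_pow h4)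
      exact absurd (Subtype.ext h5) (hKmem k hk).1
    · exact Or.inl h4
    · exact Or.inr h4
  have htwo : ∀ i j : κ, K = {i, j} → (i : ℕ) < j → (Nat.card G).primeFactors.card ≤ 3 := by
    intro i j hij hlt
    have hi : i ∈ K := by rw [hij]; simp
    have hj : j ∈ K := by rw [hij]; simp
    have hne : i ≠ j := fun h => by rw [h] at hlt; omega
    rw [hij, Finset.sum_pair hne, hKa i hi, hKa j hj] at hmain
    have h4 := hle {k₀, i, j}
    rw [Finset.sum_insert (by
        simp only [Finset.mem_insert, Finset.mem_singleton, not_or]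
        exact ⟨(hKmem i hi).1.symm, (hKmem j hj).1.symm⟩), Finset.sum_pair hne, hKw i hi,
      hKw j hj, mul_comm (2 : ℝ), mul_comm (2 : ℝ), ← div_div, ← div_div] at h4
    have h5 := eq_of_two_inverted ha hq3 hw hNa (hpr i).one_lt hlt (hKN j hj) hmain (by linarith)
    rw [hF, ← h5] at hN
    rw [hN]
    exact card_primeFactors_mul_le_three hqp (hpr j)
  rcases (by omega : K.card = 0 ∨ K.card = 1 ∨ K.card = 2 ∨ 2 < K.card) with h | h | h | h
  · rw [Finset.card_eq_zero.1 h, Finset.sum_empty, mul_zero, Nat.le_zero] at hmain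
    exfalso
    have h4 : 0 < 2 * F.w k₀ * (F.a k₀ - 1) * (N - 1) :=
      Nat.mul_pos (Nat.mul_pos (by omega) (by omega)) (by omega)
    omega
  · obtain ⟨i, hi⟩ := Finset.card_eq_one.1 h
    have hiK : i ∈ K := by rw [hi]; simp
    rw [hi, Finset.sum_singleton, hKa i hiK] at hmain
    exact (false_of_one_inverted ha hq3 hw hNa (hKN i hiK) hmain).elim
  · obtain ⟨i, j, hij, hKe⟩ := Finset.card_eq_two.1 h
    rcases lt_or_gt_of_ne (fun h => hij (Subtype.ext h) : (i : ℕ) ≠ j) with hlt | hlt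
    · exact htwo i j hKe hlt
    · exact htwo j i (by rw [hKe, Finset.pair_comm]) hlt
  · exfalso
    obtain ⟨i, hi, j, hj, l, hl, hij, hil, hjl⟩ := Finset.two_lt_card.1 h
    have h4 := hle {i, j, l}
    rw [Finset.sum_insert (by simp [hij, hil]), Finset.sum_pair hjl, hKw i hi,
      hKw j hj, hKw l hl, mul_comm (2 : ℝ), mul_comm (2 : ℝ), mul_comm (2 : ℝ), ← div_div,
      ← div_div, ← div_div] at h4
    have h5 := one_div_add_lt_one (hKodd i hi) (hKodd j hj) (hKodd l hl) (hpr i).one_lt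
      (hpr j).one_lt (hpr l).one_lt (fun h => hij (Subtype.ext h)) (fun h => hil (Subtype.ext h))
      (fun h => hjl (Subtype.ext h))
    linarith

end FrobeniusPartition

end EvenCase

section Dual

variable {A : Type*} [Group A]

theorem sum_monoidHom_eq_ite [Fintype A] (l : A →* ℂˣ) [Decidable (l = 1)] :
    ∑ u, ((l u : ℂˣ) : ℂ) = if l = 1 then (Nat.card A : ℂ) else 0 := by
  split_ifs with h
  · simp [h]
  · obtain ⟨b, hb⟩ : ∃ b, l b ≠ 1 := by
      by_contra! hcon
      exact h (MonoidHom.ext hcon)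
    have h1 : ((l b : ℂˣ) : ℂ) * ∑ u, ((l u : ℂˣ) : ℂ) = ∑ u, ((l u : ℂˣ) : ℂ) := by
      rw [Finset.mul_sum]
      refine Fintype.sum_bijective (fun u => b * u) (Group.mulLeft_bijective b) _ _ fun u => ?_
      simp
    have h2 : ((l b : ℂˣ) : ℂ) ≠ 1 := fun h => hb (Units.ext h)
    exact eq_zero_of_mul_eq_self_left h2 h1

theorem card_monoidHom_of_comm [Finite A] (hA : ∀ a b : A, a * b = b * a) :
    Nat.card (A →* ℂˣ) = Nat.card A := by
  let _ : CommGroup A := { ‹Group A› with mul_comm := hA }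
  have : NeZero (Monoid.exponent A) := ⟨Monoid.exponent_ne_zero_of_finite⟩
  exact CommGroup.card_monoidHom_of_hasEnoughRootsOfUnity A ℂ

theorem finite_monoidHom_of_comm [Finite A] (hA : ∀ a b : A, a * b = b * a) :
    Finite (A →* ℂˣ) :=
  Nat.finite_of_card_ne_zero (by rw [card_monoidHom_of_comm hA]; exact Nat.card_pos.ne')

theorem eq_one_of_comp_eq [Finite A] (f : A →* A)
    (hf : ∀ u, f u = u → u = 1) (l : A →* ℂˣ) (hl : l.comp f = l) : l = 1 := by
  have hinj : Function.Injective fun u : A => f u * u⁻¹ := by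
    intro u v huv
    have h1 : f u * u⁻¹ = f v * v⁻¹ := huv
    have h2 : f u = f v * v⁻¹ * u := mul_inv_eq_iff_eq_mul.1 h1
    have h3 : f (v⁻¹ * u) = v⁻¹ * u := by
      rw [map_mul, map_inv, h2]
      simp [mul_assoc]
    exact (inv_mul_eq_one.1 (hf _ h3)).symm
  ext u
  obtain ⟨v, rfl⟩ := Finite.surjective_of_injective hinj u
  have h3 : l (f v) = l v := DFunLike.congr_fun hl v
  simp [h3]

end Dual

section DualAction

variable {A X : Type*} [Group A] [Group X]

/-- The action on the non-trivial linear characters induced by an action by automorphisms. -/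
abbrev nontrivialDualAction (f : X →* MulAut A) : MulAction X {l : A →* ℂˣ // l ≠ 1} where
  smul y l := ⟨l.1.comp (f y⁻¹).toMonoidHom, fun h => l.2 (by
    ext u
    have := DFunLike.congr_fun h (f y u)
    simpa using congrArg Units.val this)⟩
  one_smul l := by
    apply Subtype.ext
    change l.1.comp (f 1⁻¹).toMonoidHom = l.1
    ext u
    simp
  mul_smul y z l := by
    apply Subtype.ext
    change l.1.comp (f (y * z)⁻¹).toMonoidHom =
      (l.1.comp (f z⁻¹).toMonoidHom).comp (f y⁻¹).toMonoidHom
    ext u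
    simp

/-- A fixed-point-free group of automorphisms of a finite abelian group acts freely on the
non-trivial linear characters. -/
theorem exists_dual_equiv [Finite A] [Finite X] (hA : ∀ a b : A, a * b = b * a)
    (f : X →* MulAut A) (hf : ∀ y : X, y ≠ 1 → ∀ u, f y u = u → u = 1) :
    ∃ (w : ℕ) (E : Fin w × X ≃ {l : A →* ℂˣ // l ≠ 1}),
      ∀ j y, (E (j, y)).1 = (E (j, 1)).1.comp (f y⁻¹).toMonoidHom := by
  have hfin : Finite {l : A →* ℂˣ // l ≠ 1} := by
    have := finite_monoidHom_of_comm hA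
    infer_instance
  let _ := nontrivialDualAction f
  let Q := MulAction.orbitRel.Quotient X {l : A →* ℂˣ // l ≠ 1}
  have hQ : Finite Q := inferInstance
  obtain ⟨w, ⟨q⟩⟩ := Finite.exists_equiv_fin Q
  let r : Fin w → {l : A →* ℂˣ // l ≠ 1} := fun j => (q.symm j).out
  have hr : ∀ j, (Quotient.mk'' (r j) : Q) = q.symm j := fun j => Quotient.out_eq' _
  have hbij : Function.Bijective fun p : Fin w × X => p.2 • r p.1 := by
    constructor
    · rintro ⟨j, y⟩ ⟨k, z⟩ h
      have h1 : y • r j = z • r k := h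
      have h2 : q.symm j = q.symm k := by
        rw [← hr, ← hr]
        refine Quotient.sound' ⟨y⁻¹ * z, ?_⟩
        change (y⁻¹ * z) • r k = r j
        rw [mul_smul, ← h1, inv_smul_smul]
      obtain rfl := q.symm.injective h2
      have h3 : (z⁻¹ * y) • r j = r j := by rw [mul_smul, h1, inv_smul_smul]
      by_contra hne
      have h4 : (z⁻¹ * y)⁻¹ ≠ 1 := by
        intro h5
        rw [inv_eq_one, inv_mul_eq_one] at h5
        exact hne (by rw [h5])
      exact (r j).2 (eq_one_of_comp_eq _ (hf _ h4) _ (congrArg Subtype.val h3))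
    · intro l
      have h1 : (Quotient.mk'' (r (q (Quotient.mk'' l))) : Q) = Quotient.mk'' l := by
        rw [hr, Equiv.symm_apply_apply]
      obtain ⟨y, hy⟩ := (MulAction.orbitRel_apply.1 (Quotient.exact' h1.symm))
      exact ⟨(_, y), hy⟩
  refine ⟨w, Equiv.ofBijective _ hbij, fun j y => ?_⟩
  simp only [Equiv.ofBijective_apply, one_smul]
  rfl

end DualAction

section

open Matrix in
theorem trace_mulLeft_mulRight_pi_matrix {F : Type*} [Field F] {ι : Type*} [Fintype ι]
    [DecidableEq ι] (d : ι → ℕ) (P Q : Π i, Matrix (Fin (d i)) (Fin (d i)) F) :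
    LinearMap.trace F (Π i, Matrix (Fin (d i)) (Fin (d i)) F)
      (LinearMap.mulLeft F P ∘ₗ LinearMap.mulRight F Q) =
      ∑ i, (P i).trace * (Q i).trace := by
  classical
  rw [LinearMap.trace_eq_matrix_trace F
    (Pi.basis fun i => Matrix.stdBasis F (Fin (d i)) (Fin (d i)))]
  simp only [Matrix.trace, Matrix.diag_apply, LinearMap.toMatrix_apply, Fintype.sum_sigma]
  refine Finset.sum_congr rfl fun i _ => ?_
  rw [Finset.sum_mul_sum, Fintype.sum_prod_type]
  refine Finset.sum_congr rfl fun a _ => Finset.sum_congr rfl fun b _ => ?_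
  rw [Pi.basis_repr, Pi.basis_apply, Matrix.stdBasis_eq_single]
  simp only [LinearMap.comp_apply, LinearMap.mulLeft_apply, LinearMap.mulRight_apply, Pi.mul_apply,
    Pi.single_eq_same]
  have h : ∀ M : Matrix (Fin (d i)) (Fin (d i)) F,
      (Matrix.stdBasis F (Fin (d i)) (Fin (d i))).repr M (a, b) = M a b := by
    intro M
    simp [Matrix.stdBasis]
  rw [h]
  simp [Matrix.mul_apply, Matrix.single_apply, ite_and]

theorem MonoidAlgebra.trace_mulLeft_mulRight {F : Type*} [Field F] {G : Type*} [Group G]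
    [Fintype G] [DecidableEq G] (g h : G) :
    LinearMap.trace F (MonoidAlgebra F G)
      (LinearMap.mulLeft F (MonoidAlgebra.of F G g) ∘ₗ
        LinearMap.mulRight F (MonoidAlgebra.of F G h)) =
      ∑ x : G, if g * x * h = x then 1 else 0 := by
  rw [LinearMap.trace_eq_matrix_trace F (MonoidAlgebra.basis G F)]
  simp only [Matrix.trace, Matrix.diag_apply, LinearMap.toMatrix_apply]
  refine Finset.sum_congr rfl fun x _ => ?_
  rw [MonoidAlgebra.basis_apply]
  have hr : ∀ r : MonoidAlgebra F G, (MonoidAlgebra.basis G F).repr r x = r.coeff x :=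
    fun r => rfl
  rw [hr]
  simp only [LinearMap.comp_apply, LinearMap.mulLeft_apply, LinearMap.mulRight_apply,
    MonoidAlgebra.of_apply, MonoidAlgebra.single_mul_single, mul_one, ← mul_assoc]
  rw [MonoidAlgebra.coeff_single, Finsupp.single_apply]

/-- A finite group has a family of complex matrix representations affording a complete list of
irreducible characters. -/
theorem exists_complete_matrix_representations (G : Type*) [Group G] [Fintype G] [DecidableEq G] :
    ∃ (r : ℕ) (d : Fin r → ℕ) (ρ : ∀ i, G →* Matrix (Fin (d i)) (Fin (d i)) ℂ),
      (∀ i, 0 < d i) ∧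
      (∀ g h, ∑ i, (ρ i g).trace * (ρ i h).trace = ∑ x : G, if g * x * h = x then 1 else 0) ∧
      r ≤ Nat.card (ConjClasses G) := by
  classical
  have : NeZero (Nat.card G : ℂ) := ⟨by exact_mod_cast Nat.card_pos.ne'⟩
  obtain ⟨r, d, hd, ⟨E⟩⟩ :=
    IsSemisimpleRing.exists_algEquiv_pi_matrix_of_isAlgClosed ℂ (MonoidAlgebra ℂ G)
  let ρ : ∀ i, G →* Matrix (Fin (d i)) (Fin (d i)) ℂ := fun i =>
    ((Pi.evalMonoidHom (fun i => Matrix (Fin (d i)) (Fin (d i)) ℂ) i).comp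
      (E : MonoidAlgebra ℂ G →* Π i, Matrix (Fin (d i)) (Fin (d i)) ℂ)).comp
      (MonoidAlgebra.of ℂ G)
  have hρ : ∀ i g, ρ i g = E (MonoidAlgebra.of ℂ G g) i := fun i g => rfl
  refine ⟨r, d, ρ, fun i => Nat.pos_of_ne_zero (hd i).out, fun g h => ?_, ?_⟩
  · rw [← MonoidAlgebra.trace_mulLeft_mulRight (F := ℂ) g h,
      ← LinearMap.trace_conj' _ E.toLinearEquiv]
    simp only [hρ]
    rw [← trace_mulLeft_mulRight_pi_matrix d (E (MonoidAlgebra.of ℂ G g))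
      (E (MonoidAlgebra.of ℂ G h))]
    congr 1
    refine LinearMap.ext fun s => ?_
    simp [LinearEquiv.conj_apply]
  · let f : Fin r → (ConjClasses G → ℂ) := fun i =>
      fun c => Quotient.liftOn c (fun g => (ρ i g).trace) (by
        intro a b hab
        obtain ⟨c, rfl⟩ := isConj_iff.1 hab
        rw [map_mul, Matrix.trace_mul_comm, ← map_mul]
        simp [← mul_assoc])
    have hf : ∀ i g, f i (ConjClasses.mk g) = (ρ i g).trace := fun i g => rfl
    have hli : LinearIndependent ℂ f := by
      rw [Fintype.linearIndependent_iff]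
      intro c hc j
      have h1 : ∀ g, ∑ i, c i * (ρ i g).trace = 0 := by
        intro g
        have := congrFun hc (ConjClasses.mk g)
        simpa [hf] using this
      have h2 : ∀ s : MonoidAlgebra ℂ G, ∑ i, c i * (E s i).trace = 0 := by
        intro s
        induction s using MonoidAlgebra.induction_on with
        | of g => exact h1 g
        | add x y hx hy => simp [mul_add, Finset.sum_add_distrib, hx, hy]
        | smul z x hx =>
          simp only [map_smul, Pi.smul_apply, Matrix.trace_smul, smul_eq_mul, mul_left_comm _ z]
          rw [← Finset.mul_sum, hx, mul_zero]
      have h3 := h2 (E.symm (Pi.single j (Matrix.single 0 0 1)))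
      rw [AlgEquiv.apply_symm_apply, Finset.sum_eq_single j] at h3
      · simpa [Matrix.trace, Matrix.single_apply] using h3
      · intro b _ hb
        simp [Pi.single_eq_of_ne hb]
      · simp
    have := hli.fintype_card_le_finrank
    rwa [Module.finrank_fintype_fun_eq_card, Fintype.card_fin, ← Nat.card_eq_fintype_card] at this

end

section

/-- The multiplicity of a linear character in a complex matrix representation is a natural
number. -/
theorem exists_nat_multiplicity {A : Type*} [Group A] [Fintype A] {d : ℕ}
    (ρ : A →* Matrix (Fin d) (Fin d) ℂ) (l : A →* ℂˣ) :
    ∃ m : ℕ, (m : ℂ) * Nat.card A = ∑ u, (ρ u).trace * ((l u)⁻¹ : ℂˣ) := by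
  classical
  have hc : (Nat.card A : ℂ) ≠ 0 := by exact_mod_cast Nat.card_pos.ne'
  let ψ : A → Matrix (Fin d) (Fin d) ℂ := fun u => (((l u)⁻¹ : ℂˣ) : ℂ) • ρ u
  have hψ : ∀ u v, ψ u * ψ v = ψ (u * v) := by
    intro u v
    simp only [ψ, map_mul, mul_inv, Units.val_mul, smul_mul_assoc, mul_smul_comm, smul_smul]
    rw [mul_comm (((l v)⁻¹ : ℂˣ) : ℂ)]
  let S : Matrix (Fin d) (Fin d) ℂ := ∑ u, ψ u
  have hS : ∀ u, ψ u * S = S := by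
    intro u
    simp only [S, Finset.mul_sum, hψ]
    exact Fintype.sum_equiv (Equiv.mulLeft u) _ _ fun v => rfl
  let P : Matrix (Fin d) (Fin d) ℂ := (Nat.card A : ℂ)⁻¹ • S
  have hSP : S * P = S := by
    have h1 : S * S = (Nat.card A : ℂ) • S := by
      conv_lhs => rw [show S * S = (∑ u, ψ u) * S from rfl, Finset.sum_mul]
      rw [Finset.sum_congr rfl fun u _ => hS u, Finset.sum_const, Finset.card_univ,
        ← Nat.card_eq_fintype_card, Nat.cast_smul_eq_nsmul]
    simp only [P, mul_smul_comm, h1, smul_smul, inv_mul_cancel₀ hc, one_smul]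
  have hP : IsIdempotentElem (Matrix.toLin' P) := by
    unfold IsIdempotentElem
    rw [Module.End.mul_eq_comp, ← Matrix.toLin'_mul]
    congr 1
    change ((Nat.card A : ℂ)⁻¹ • S) * P = _
    rw [smul_mul_assoc, hSP]
  have htr := (LinearMap.IsIdempotentElem.isProj_range _ hP).trace
  rw [Matrix.trace_toLin'_eq] at htr
  refine ⟨_, (congrArg (· * (Nat.card A : ℂ)) htr.symm).trans ?_⟩
  simp only [P, Matrix.trace_smul, S, Matrix.trace_sum, ψ, smul_eq_mul]
  rw [mul_comm, ← mul_assoc, mul_inv_cancel₀ hc, one_mul]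
  exact Finset.sum_congr rfl fun u _ => mul_comm _ _

/-- The bilinear form on functions defined by a complete list of representations. -/
theorem sum_character_sum_mul {G : Type*} [Group G] [Fintype G] [DecidableEq G] {r : ℕ}
    {χ : Fin r → G → ℂ}
    (hχ : ∀ g h, ∑ i, χ i g * χ i h = ∑ x : G, if g * x * h = x then 1 else 0) (f f' : G → ℂ) :
    ∑ i, (∑ g, χ i g * f g) * (∑ g, χ i g * f' g) = ∑ x, ∑ g, f g * f' (x⁻¹ * g⁻¹ * x) := by
  calc ∑ i, (∑ g, χ i g * f g) * (∑ g, χ i g * f' g)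
      = ∑ g, ∑ h, f g * f' h * ∑ i, χ i g * χ i h := by
        simp only [Finset.sum_mul_sum]
        rw [Finset.sum_comm]
        refine Finset.sum_congr rfl fun g _ => ?_
        rw [Finset.sum_comm]
        refine Finset.sum_congr rfl fun h _ => ?_
        rw [Finset.mul_sum]
        refine Finset.sum_congr rfl fun i _ => ?_
        ring
    _ = ∑ g, ∑ x, f g * f' (x⁻¹ * g⁻¹ * x) := by
        refine Finset.sum_congr rfl fun g _ => ?_
        simp only [hχ, Finset.mul_sum]
        rw [Finset.sum_comm]
        refine Finset.sum_congr rfl fun x _ => ?_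
        rw [Finset.sum_eq_single (x⁻¹ * g⁻¹ * x)]
        · rw [if_pos (by group), mul_one]
        · intro h _ hh
          rw [if_neg, mul_zero]
          rintro hx
          apply hh
          calc h = x⁻¹ * g⁻¹ * (g * x * h) := by group
            _ = x⁻¹ * g⁻¹ * x := by rw [hx]
        · simp
    _ = _ := Finset.sum_comm

/-- The restriction to a subgroup of the difference of the trivial character and the inverse of a
linear character, extended by zero. -/
noncomputable def Subgroup.oneSubChar {G : Type*} [Group G] (A : Subgroup G) (l : A →* ℂˣ)
    (g : G) : ℂ :=
  open Classical in if h : g ∈ A then 1 - (((l ⟨g, h⟩)⁻¹ : ℂˣ) : ℂ) else 0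

namespace Subgroup

variable {G : Type*} [Group G] (A : Subgroup G) (l : A →* ℂˣ)

theorem oneSubChar_coe (u : A) : A.oneSubChar l u = 1 - (((l u)⁻¹ : ℂˣ) : ℂ) := by
  simp [oneSubChar]

theorem oneSubChar_of_notMem {g : G} (h : g ∉ A) : A.oneSubChar l g = 0 := by
  simp [oneSubChar, h]

theorem oneSubChar_one : A.oneSubChar l 1 = 0 := by
  have := A.oneSubChar_coe l 1
  simpa using this

theorem sum_mul_oneSubChar [Fintype G] [Fintype A] (f : G → ℂ) :
    ∑ g, f g * A.oneSubChar l g = ∑ u : A, f u * (1 - (((l u)⁻¹ : ℂˣ) : ℂ)) := by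
  classical
  simp only [← A.oneSubChar_coe l]
  refine (Fintype.sum_of_injective _ A.subtype_injective _ _ (fun g hg => ?_) fun u => rfl).symm
  rw [oneSubChar_of_notMem, mul_zero]
  simpa using hg

end Subgroup

end

section

open Subgroup

theorem sum_one_sub_inv_mul_one_sub {A : Type*} [Group A] [Fintype A] {l m : A →* ℂˣ}
    (hl : l ≠ 1) (hm : m ≠ 1) [Decidable (l = m)] :
    ∑ u, (1 - (((l u)⁻¹ : ℂˣ) : ℂ)) * (1 - ((m u : ℂˣ) : ℂ)) =
      Nat.card A * (1 + if l = m then 1 else 0) := by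
  classical
  have h1 : ∑ u, (((l u)⁻¹ : ℂˣ) : ℂ) = 0 := by
    have := sum_monoidHom_eq_ite (l⁻¹)
    rwa [if_neg fun h => hl (MonoidHom.ext fun u => by
      simpa using DFunLike.congr_fun h u)] at this
  have h2 : ∑ u, ((m u : ℂˣ) : ℂ) = 0 := by
    have := sum_monoidHom_eq_ite m
    rwa [if_neg hm] at this
  have h3 : ∑ u, (((l u)⁻¹ : ℂˣ) : ℂ) * ((m u : ℂˣ) : ℂ) =
      if l = m then (Nat.card A : ℂ) else 0 := by
    have := sum_monoidHom_eq_ite (l⁻¹ * m)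
    simp only [MonoidHom.mul_apply, MonoidHom.inv_apply, Units.val_mul] at this
    rw [this]
    exact if_congr ⟨fun h => MonoidHom.ext fun u => inv_mul_eq_one.1 (DFunLike.congr_fun h u),
      fun h => MonoidHom.ext fun u => inv_mul_eq_one.2 (DFunLike.congr_fun h u)⟩ rfl rfl
  calc ∑ u, (1 - (((l u)⁻¹ : ℂˣ) : ℂ)) * (1 - ((m u : ℂˣ) : ℂ))
      = ∑ u, (1 - (((l u)⁻¹ : ℂˣ) : ℂ) - ((m u : ℂˣ) : ℂ) +
          (((l u)⁻¹ : ℂˣ) : ℂ) * ((m u : ℂˣ) : ℂ)) :=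
        Finset.sum_congr rfl fun u _ => by ring
    _ = _ := by
        rw [Finset.sum_add_distrib, Finset.sum_sub_distrib, Finset.sum_sub_distrib, h1, h2, h3]
        simp only [Finset.sum_const, Finset.card_univ, nsmul_eq_mul, Nat.card_eq_fintype_card]
        split_ifs <;> ring

namespace FrobeniusPartition

variable {G : Type*} [Group G] [Finite G] {κ : Type*} (F : FrobeniusPartition G κ)

theorem eq_one_of_mem_zpowers (k : κ) {y : G} (hy : y ∈ zpowers (F.x k)) (hA : y ∈ F.A k) :
    y = 1 := by
  have h1 : orderOf y ∣ F.a k := orderOf_dvd_of_pow_eq_one (F.pow_a_eq_one k hA)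
  have h2 : orderOf y ∣ F.e k := by
    rw [← F.orderOf_x k]
    obtain ⟨i, rfl⟩ := hy
    exact orderOf_dvd_of_pow_eq_one (by
      change (F.x k ^ i) ^ orderOf (F.x k) = 1
      rw [← zpow_natCast, zpow_comm, zpow_natCast, pow_orderOf_eq_one, one_zpow])
  exact orderOf_eq_one_iff.1 (Nat.eq_one_of_dvd_coprimes (F.coprime_a_e k) h1 h2)

theorem exists_orbit_representatives (k : κ) :
    ∃ μ : Fin (F.w k) → (F.A k →* ℂˣ), (∀ j, μ j ≠ 1) ∧
      ∀ j m (x : normalizer (F.A k : Set G)),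
        (μ m).comp ((F.A k).normalizerMonoidHom x).toMonoidHom = μ j ↔
          m = j ∧ (x : G) ∈ F.A k := by
  have hXN : zpowers (F.x k) ≤ normalizer (F.A k : Set G) := by
    rw [zpowers_le]; exact F.x_mem k
  have hcomm : ∀ u v : F.A k, u * v = v * u := fun u v =>
    Subtype.ext (F.comm k u u.2 v v.2)
  obtain ⟨w, E, hE⟩ := exists_dual_equiv hcomm
    ((F.A k).normalizerMonoidHom.comp (inclusion hXN)) (by
      intro y hy u hu
      by_contra hu1
      have h1 : (y : G) * u * (y : G)⁻¹ = u := congrArg Subtype.val hu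
      refine hy (Subtype.ext (F.eq_one_of_mem_zpowers k y.2 ?_))
      exact F.mem_of_commute k u u.2 (fun h => hu1 (Subtype.ext h)) y
        (mul_inv_eq_iff_eq_mul.1 h1))
  have hw : w = F.w k := by
    have h1 := Nat.card_congr E
    have hfin := finite_monoidHom_of_comm hcomm
    have h2 : Nat.card {l : F.A k →* ℂˣ // l ≠ 1} = F.a k - 1 := by
      classical
      have := Fintype.ofFinite (F.A k →* ℂˣ)
      rw [Nat.card_eq_fintype_card, Fintype.card_subtype_compl, Fintype.card_subtype_eq,
        ← Nat.card_eq_fintype_card, card_monoidHom_of_comm hcomm]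
      rfl
    rw [Nat.card_prod, Nat.card_fin, Nat.card_zpowers, F.orderOf_x, h2, F.a_eq,
      Nat.add_sub_cancel] at h1
    exact Nat.eq_of_mul_eq_mul_right (F.e_prime k).pos h1
  subst hw
  refine ⟨fun j => (E (j, 1)).1, fun j => (E (j, 1)).2, fun j m x => ?_⟩
  have hcomp : ∀ y (hy : y ∈ zpowers (F.x k)) (v : G), v ∈ F.A k → ∀ z,
      (z : normalizer (F.A k : Set G)) = y * v →
      (E (m, 1)).1.comp ((F.A k).normalizerMonoidHom z).toMonoidHom =
        (E (m, (⟨y, hy⟩ : zpowers (F.x k))⁻¹)).1 := by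
    intro y hy v hv z hz
    rw [hE m (_)⁻¹]
    refine MonoidHom.ext fun u => congrArg (E (m, 1)).1 (Subtype.ext ?_)
    rw [inv_inv]
    change (z : G) * u * (z : G)⁻¹ = y * u * y⁻¹
    rw [hz]
    calc y * v * u * (y * v)⁻¹ = y * (v * u) * v⁻¹ * y⁻¹ := by group
      _ = y * u * y⁻¹ := by rw [F.comm k v hv u u.2]; group
  constructor
  · intro h
    have hx : (x : G) ∈ ((zpowers (F.x k) ⊔ F.A k : Subgroup G) : Set G) := by
      rw [sup_comm, F.sup_zpowers]; exact x.2
    rw [coe_mul_of_left_le_normalizer_right _ _ hXN] at hx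
    obtain ⟨y, hy, v, hv, hyv⟩ := Set.mem_mul.1 hx
    have h1 := hcomp y hy v hv x hyv.symm
    have h2 := E.injective (Subtype.ext (h1.symm.trans h))
    simp only [Prod.mk.injEq, inv_eq_one] at h2
    obtain ⟨h3, h4⟩ := h2
    have h5 : y = 1 := congrArg Subtype.val h4
    refine ⟨h3, ?_⟩
    rw [← hyv, h5, one_mul]
    exact hv
  · rintro ⟨rfl, hx⟩
    rw [hcomp 1 (one_mem _) x hx x (by simp)]
    congr 3
    exact inv_one

omit [Finite G] in
theorem sum_oneSubChar_conj_eq_zero [Fintype G] {k l : κ} (hkl : k ≠ l) (μ : F.A k →* ℂˣ)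
    (ν : F.A l →* ℂˣ) :
    ∑ x, ∑ g, (F.A k).oneSubChar μ g * (F.A l).oneSubChar ν (x⁻¹ * g⁻¹ * x) = 0 := by
  refine Finset.sum_eq_zero fun x _ => Finset.sum_eq_zero fun g _ => ?_
  by_cases hg : g ∈ F.A k
  · rcases eq_or_ne g 1 with rfl | hg1
    · rw [oneSubChar_one, zero_mul]
    · rw [oneSubChar_of_notMem (F.A l), mul_zero]
      intro h
      exact hkl (F.eq_of_conj_mem k l g⁻¹ (inv_mem hg) (inv_ne_one.2 hg1) x⁻¹ (by simpa using h))
  · rw [oneSubChar_of_notMem _ _ hg, zero_mul]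

omit [Finite G] in
open Classical in
theorem sum_oneSubChar_conj [Fintype G] {k : κ} {w : ℕ} {μ : Fin w → (F.A k →* ℂˣ)}
    (hμ : ∀ j, μ j ≠ 1)
    (hμ' : ∀ j m (x : normalizer (F.A k : Set G)),
      (μ m).comp ((F.A k).normalizerMonoidHom x).toMonoidHom = μ j ↔ m = j ∧ (x : G) ∈ F.A k)
    (j m : Fin w) :
    ∑ x, ∑ g, (F.A k).oneSubChar (μ j) g * (F.A k).oneSubChar (μ m) (x⁻¹ * g⁻¹ * x) =
      (F.a k : ℂ) ^ 2 * (F.e k + if j = m then 1 else 0) := by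
  have hx : ∀ x : G,
      ∑ g, (F.A k).oneSubChar (μ j) g * (F.A k).oneSubChar (μ m) (x⁻¹ * g⁻¹ * x) =
      (F.a k : ℂ) * ((if x ∈ normalizer (F.A k : Set G) then 1 else 0) +
        (if j = m then 1 else 0) * (if x ∈ F.A k then 1 else 0)) := by
    intro x
    by_cases hxN : x ∈ normalizer (F.A k : Set G)
    · rw [if_pos hxN]
      simp only [mul_comm ((F.A k).oneSubChar (μ j) _)]
      rw [sum_mul_oneSubChar]
      set c : F.A k →* F.A k :=
        ((F.A k).normalizerMonoidHom (⟨x, hxN⟩⁻¹ : normalizer (F.A k : Set G))).toMonoidHom with hc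
      have h1 : ∀ u : F.A k, (F.A k).oneSubChar (μ m) (x⁻¹ * (u : G)⁻¹ * x) =
          1 - ((((μ m).comp c) u : ℂˣ) : ℂ) := by
        intro u
        have h2 : ((c u⁻¹ : F.A k) : G) = x⁻¹ * (u : G)⁻¹ * x := by
          change x⁻¹ * (u : G)⁻¹ * (x⁻¹)⁻¹ = _
          rw [inv_inv]
        rw [← h2, oneSubChar_coe, map_inv, map_inv, inv_inv]
        rfl
      simp only [h1, mul_comm _ (1 - (((μ j _)⁻¹ : ℂˣ) : ℂ))]
      rw [sum_one_sub_inv_mul_one_sub (hμ j)]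
      · change (F.a k : ℂ) * _ = _
        have h3 : (μ j = (μ m).comp c) ↔ j = m ∧ x ∈ F.A k := by
          rw [eq_comm, hc, hμ', eq_comm]
          simp
        simp only [h3, ite_and]
        split_ifs <;> simp
      · intro h
        refine hμ m (MonoidHom.ext fun u => ?_)
        have hsurj : Function.Surjective c := MulEquiv.surjective _
        obtain ⟨v, rfl⟩ := hsurj u
        exact DFunLike.congr_fun h v
    · have hxA : x ∉ F.A k := fun h => hxN (le_normalizer h)
      rw [if_neg hxN, if_neg hxA, mul_zero, add_zero, mul_zero]
      refine Finset.sum_eq_zero fun g _ => ?_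
      by_cases hg : g ∈ F.A k
      · rcases eq_or_ne g 1 with rfl | hg1
        · rw [oneSubChar_one, zero_mul]
        · rw [oneSubChar_of_notMem (F.A k) (μ m), mul_zero]
          intro h
          have := F.mem_normalizer k g⁻¹ (inv_mem hg) (inv_ne_one.2 hg1) x⁻¹ (by simpa using h)
          exact hxN (inv_mem_iff.1 this)
      · rw [oneSubChar_of_notMem _ _ hg, zero_mul]
  have hcard : ∀ H : Subgroup G, ∑ x : G, (if x ∈ H then (1 : ℂ) else 0) = Nat.card H := by
    intro H
    rw [Finset.sum_boole, Nat.card_eq_fintype_card, Fintype.card_subtype]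
  simp only [hx]
  rw [← Finset.mul_sum, Finset.sum_add_distrib, ← Finset.mul_sum, hcard, hcard, F.card_normalizer]
  change (F.a k : ℂ) * (((F.a k * F.e k : ℕ) : ℂ) + _ * (F.a k : ℂ)) = _
  push_cast
  ring

end FrobeniusPartition

end

section

open Subgroup

namespace FrobeniusPartition

variable {G : Type*} [Group G] [Finite G] {κ : Type*} [Fintype κ] (F : FrobeniusPartition G κ)

theorem card_conjClasses_le : Nat.card (ConjClasses G) ≤ 1 + ∑ k, F.w k := by
  classical
  have := Fintype.ofFinite G
  have hn : 0 < Nat.card G := Nat.card_pos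
  refine Nat.le_of_mul_le_mul_right ?_ hn
  rw [← card_comm_eq_card_conjClasses_mul_card]
  have e : {p : G × G // Commute p.1 p.2} ≃ Σ g : G, {h : G // Commute g h} :=
    { toFun := fun p => ⟨p.1.1, p.1.2, p.2⟩
      invFun := fun p => ⟨(p.1, p.2.1), p.2.2⟩
      left_inv := fun _ => rfl
      right_inv := fun _ => rfl }
  rw [Nat.card_congr e, Nat.card_sigma]
  have hc : ∀ g : G, Nat.card {h : G // Commute g h} ≤
      (if g = 1 then Nat.card G else 0) + ∑ k, if g ∈ F.support k then F.a k else 0 := by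
    intro g
    rcases eq_or_ne g 1 with rfl | hg
    · rw [if_pos rfl]
      exact (Nat.card_le_card_of_injective _ Subtype.val_injective).trans (Nat.le_add_right _ _)
    · obtain ⟨k, h, hk⟩ := F.cover g hg
      have hgk : g ∈ F.support k := by
        refine ⟨h * g * h⁻¹, ⟨hk, fun h1 => hg (conj_eq_one_iff.1 h1)⟩, h⁻¹, by group⟩
      refine le_trans ?_ (Nat.le_add_left _ _)
      refine le_trans ?_ (Finset.single_le_sum (fun _ _ => Nat.zero_le _) (Finset.mem_univ k))
      rw [if_pos hgk]
      refine Nat.card_le_card_of_injective (fun y : {y : G // Commute g y} =>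
        (⟨h * y * h⁻¹, F.mem_of_commute k _ hk (fun h1 => hg (conj_eq_one_iff.1 h1)) _ ?_⟩ :
          F.A k)) ?_
      · calc h * y * h⁻¹ * (h * g * h⁻¹) = h * (y * g) * h⁻¹ := by group
          _ = h * (g * y) * h⁻¹ := by rw [y.2.eq]
          _ = h * g * h⁻¹ * (h * y * h⁻¹) := by group
      · intro y z hyz
        have := congrArg Subtype.val hyz
        exact Subtype.ext (by simpa using this)
  refine (Finset.sum_le_sum fun g _ => hc g).trans ?_
  rw [Finset.sum_add_distrib, Finset.sum_comm]
  have hk : ∀ k, (∑ g : G, if g ∈ F.support k then F.a k else 0) = F.w k * Nat.card G := by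
    intro k
    rw [mul_comm, F.card_mul_w, Set.ncard_eq_toFinset_card', ← Finset.sum_filter,
      Finset.sum_const, smul_eq_mul]
    congr 2
    ext g
    simp
  simp only [hk, Finset.sum_ite_eq', Finset.mem_univ, if_true]
  rw [add_mul, one_mul, Finset.sum_mul]

omit [Fintype κ] in
theorem sum_oneSubChar [Fintype G] {k : κ} {μ : F.A k →* ℂˣ} (hμ : μ ≠ 1) :
    ∑ g, (F.A k).oneSubChar μ g = F.a k := by
  classical
  have := Fintype.ofFinite (F.A k)
  have h := (F.A k).sum_mul_oneSubChar μ (fun _ => 1)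
  have h1 := sum_monoidHom_eq_ite (μ⁻¹)
  rw [if_neg fun h => hμ (MonoidHom.ext fun u => by simpa using DFunLike.congr_fun h u)] at h1
  simp only [MonoidHom.inv_apply] at h1
  simp only [one_mul, Finset.sum_sub_distrib, h1, Finset.sum_const, Finset.card_univ, sub_zero,
    nsmul_eq_mul, mul_one, ← Nat.card_eq_fintype_card] at h
  exact h

/-- The integral vectors recording the multiplicities in the irreducible characters of `G` of the
trivial character of `G`, the degrees, and the differences of the trivial character and other
linear characters of the members of the partition. -/
theorem exists_multiplicity_vectors [DecidableEq κ] :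
    ∃ (r : ℕ) (v t : Fin r → ℤ) (β : ∀ k, Fin (F.w k) → Fin r → ℤ),
      r ≤ 1 + ∑ k, F.w k ∧ (∀ i, 0 < v i) ∧ ∑ i, t i * t i = 1 ∧
      (∀ k j, ∑ i, v i * β k j i = 0) ∧ (∀ k j, ∑ i, t i * β k j i = 1) ∧
      (∀ k j m, ∑ i, β k j i * β k m i = F.e k + if j = m then 1 else 0) ∧
      (∀ k l, k ≠ l → ∀ j m, ∑ i, β k j i * β l m i = 0) := by
  classical
  have := Fintype.ofFinite G
  have hn : (Nat.card G : ℂ) ≠ 0 := by exact_mod_cast Nat.card_pos.ne'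
  have ha : ∀ k, (F.a k : ℂ) ≠ 0 := fun k => by exact_mod_cast (by have := F.one_lt_a k; omega)
  obtain ⟨r, d, ρ, hd, hρ, hr⟩ := exists_complete_matrix_representations G
  have horth := sum_character_sum_mul (χ := fun i g => (ρ i g).trace) hρ
  have hft : ∀ i, ∃ m : ℤ, (m : ℂ) * Nat.card G = ∑ u, (ρ i u).trace := by
    intro i
    obtain ⟨m, hm⟩ := exists_nat_multiplicity (ρ i) 1
    exact ⟨m, by simpa using hm⟩
  choose t ht using hft
  choose μ hμ hμ' using F.exists_orbit_representatives
  have hfβ : ∀ k j i, ∃ m : ℤ,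
      (m : ℂ) * F.a k = ∑ g, (ρ i g).trace * (F.A k).oneSubChar (μ k j) g := by
    intro k j i
    have := Fintype.ofFinite (F.A k)
    obtain ⟨m1, hm1⟩ := exists_nat_multiplicity ((ρ i).comp (F.A k).subtype) 1
    obtain ⟨m2, hm2⟩ := exists_nat_multiplicity ((ρ i).comp (F.A k).subtype) (μ k j)
    refine ⟨m1 - m2, ?_⟩
    rw [sum_mul_oneSubChar]
    push_cast
    rw [sub_mul]
    change (m1 : ℂ) * (Nat.card (F.A k) : ℂ) - m2 * (Nat.card (F.A k) : ℂ) = _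
    rw [hm1, hm2, ← Finset.sum_sub_distrib]
    refine Finset.sum_congr rfl fun u _ => ?_
    simp [mul_sub]
  choose β hβ using hfβ
  have hv : ∀ i, ((d i : ℤ) : ℂ) = ∑ g, (ρ i g).trace * (if g = 1 then 1 else 0) := by
    intro i
    simp
  refine ⟨r, fun i => d i, t, β, hr.trans F.card_conjClasses_le, fun i => Int.natCast_pos.2 (hd i),
    ?_, fun k j => ?_, fun k j => ?_, fun k j m => ?_, fun k l hkl j m => ?_⟩
  · have h := horth (fun _ => 1) (fun _ => 1)
    simp only [← ht, mul_one, Finset.sum_const, Finset.card_univ, ← Nat.card_eq_fintype_card,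
      nsmul_eq_mul] at h
    have h2 : ((∑ i, t i * t i : ℤ) : ℂ) * ((Nat.card G : ℂ) * Nat.card G) =
        (1 : ℤ) * ((Nat.card G : ℂ) * Nat.card G) := by
      push_cast
      rw [one_mul, Finset.sum_mul]
      refine Eq.trans ?_ h
      exact Finset.sum_congr rfl fun i _ => by ring
    exact_mod_cast mul_right_cancel₀ (mul_ne_zero hn hn) h2
  · have h := horth (fun g => if g = 1 then 1 else 0) ((F.A k).oneSubChar (μ k j))
    simp only [← hβ, ← hv, ite_mul, one_mul, zero_mul, Finset.sum_ite_eq', Finset.mem_univ,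
      if_true, inv_one, mul_one, inv_mul_cancel, oneSubChar_one, Finset.sum_const_zero] at h
    have h2 : ((∑ i, (d i : ℤ) * β k j i : ℤ) : ℂ) * F.a k = 0 := by
      push_cast
      rw [← h, Finset.sum_mul]
      exact Finset.sum_congr rfl fun i _ => by push_cast; ring
    exact_mod_cast (mul_eq_zero.1 h2).resolve_right (ha k)
  · have h := horth (fun _ => 1) ((F.A k).oneSubChar (μ k j))
    have h1 : ∀ x : G, ∑ g, (F.A k).oneSubChar (μ k j) (x⁻¹ * g⁻¹ * x) = F.a k := by
      intro x
      rw [← F.sum_oneSubChar (hμ k j)]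
      exact Fintype.sum_equiv ((Equiv.inv G).trans (MulAut.conj x⁻¹).toEquiv) _ _ fun g => by
        simp
    simp only [mul_one, ← hβ, ← ht, one_mul, h1, Finset.sum_const, Finset.card_univ, nsmul_eq_mul,
      ← Nat.card_eq_fintype_card] at h
    have h2 : ((∑ i, t i * β k j i : ℤ) : ℂ) * ((Nat.card G : ℂ) * F.a k) =
        (1 : ℤ) * ((Nat.card G : ℂ) * F.a k) := by
      push_cast
      rw [one_mul, Finset.sum_mul]
      refine Eq.trans ?_ h
      exact Finset.sum_congr rfl fun i _ => by ring
    exact_mod_cast mul_right_cancel₀ (mul_ne_zero hn (ha k)) h2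
  · have h := horth ((F.A k).oneSubChar (μ k j)) ((F.A k).oneSubChar (μ k m))
    rw [F.sum_oneSubChar_conj (hμ k) (hμ' k)] at h
    simp only [← hβ] at h
    have h2 : ((∑ i, β k j i * β k m i : ℤ) : ℂ) * ((F.a k : ℂ) ^ 2) =
        ((F.e k + if j = m then 1 else 0 : ℤ) : ℂ) * ((F.a k : ℂ) ^ 2) := by
      push_cast
      rw [mul_comm _ ((F.a k : ℂ) ^ 2), mul_comm _ ((F.a k : ℂ) ^ 2), ← h, Finset.mul_sum]
      exact Finset.sum_congr rfl fun i _ => by ring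
    exact_mod_cast mul_right_cancel₀ (pow_ne_zero 2 (ha k)) h2
  · have h := horth ((F.A k).oneSubChar (μ k j)) ((F.A l).oneSubChar (μ l m))
    rw [F.sum_oneSubChar_conj_eq_zero hkl] at h
    simp only [← hβ] at h
    have h2 : ((∑ i, β k j i * β l m i : ℤ) : ℂ) * ((F.a k : ℂ) * F.a l) = 0 := by
      push_cast
      rw [← h, Finset.sum_mul]
      exact Finset.sum_congr rfl fun i _ => by ring
    exact_mod_cast (mul_eq_zero.1 h2).resolve_right (mul_ne_zero (ha k) (ha l))

end FrobeniusPartition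

end

section

theorem exists_eq_single_of_sum_mul_self_eq_one {ι : Type*} [Fintype ι] [DecidableEq ι]
    {t : ι → ℤ} (ht : ∑ i, t i * t i = 1) : ∃ i s, s * s = 1 ∧ t = Pi.single i s := by
  obtain ⟨i, hi⟩ : ∃ i, t i ≠ 0 := by
    by_contra! h
    simp [h] at ht
  have h1 : 1 ≤ t i * t i := mul_self_pos.2 hi
  rw [← Finset.add_sum_erase _ _ (Finset.mem_univ i)] at ht
  have h2 : ∀ l ∈ Finset.univ.erase i, 0 ≤ t l * t l := fun l _ => mul_self_nonneg _
  have h3 := Finset.sum_nonneg h2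
  refine ⟨i, t i, by omega, ?_⟩
  have h4 := (Finset.sum_eq_zero_iff_of_nonneg h2).1 (by omega)
  ext l
  rcases eq_or_ne l i with rfl | hl
  · simp
  · rw [Pi.single_eq_of_ne hl]
    exact mul_self_eq_zero.1 (h4 l (by simp [hl]))

theorem exists_eq_single_sub_single {ι : Type*} [Fintype ι] [DecidableEq ι] {v x : ι → ℤ}
    (hv : ∀ i, 0 < v i) (hx : ∑ i, x i * x i = 2) (hvx : ∑ i, v i * x i = 0) :
    ∃ a b, x = Pi.single a 1 - Pi.single b 1 := by
  have hne : ∃ i, x i ≠ 0 := by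
    by_contra! h
    simp [h] at hx
  have hpos : ∀ y : ι → ℤ, ∑ i, v i * y i = 0 → (∃ i, y i ≠ 0) → ∃ i, 0 < y i := by
    intro y hy hne
    by_contra! h
    have h1 := (Finset.sum_eq_zero_iff_of_nonpos fun i _ =>
      mul_nonpos_of_nonneg_of_nonpos (hv i).le (h i)).1 hy
    obtain ⟨i, hi⟩ := hne
    exact hi ((mul_eq_zero.1 (h1 i (Finset.mem_univ i))).resolve_left (hv i).ne')
  obtain ⟨a, ha⟩ := hpos x hvx hne
  obtain ⟨b, hb⟩ := hpos (-x) (by simp [hvx]) (by simpa using hne)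
  have hb : x b < 0 := by simpa using hb
  have hab : b ≠ a := by rintro rfl; omega
  rw [← Finset.add_sum_erase _ _ (Finset.mem_univ a),
    ← Finset.add_sum_erase _ _ (show b ∈ Finset.univ.erase a by simp [hab])] at hx
  have h2 : ∀ l ∈ (Finset.univ.erase a).erase b, 0 ≤ x l * x l := fun l _ => mul_self_nonneg _
  have h3 := Finset.sum_nonneg h2
  have ha1 : x a = 1 := by nlinarith
  have hb1 : x b = -1 := by nlinarith
  rw [ha1, hb1] at hx
  have h4 := (Finset.sum_eq_zero_iff_of_nonneg h2).1 (by omega)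
  refine ⟨a, b, ?_⟩
  ext l
  rcases eq_or_ne l a with rfl | hla
  · simp [ha1, Pi.single_eq_of_ne hab.symm]
  · rcases eq_or_ne l b with rfl | hlb
    · simp [hb1, Pi.single_eq_of_ne hab]
    · simp only [Pi.sub_apply, Pi.single_eq_of_ne hla, Pi.single_eq_of_ne hlb, sub_zero]
      exact mul_self_eq_zero.1 (h4 l (by simp [hla, hlb]))

theorem forall_eq_or_forall_eq {J α : Type*} {a b : J → α}
    (h : ∀ j l, a j = a l ∨ b j = b l) : (∀ j l, a j = a l) ∨ ∀ j l, b j = b l := by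
  by_contra! hcon
  obtain ⟨⟨j, l, hjl⟩, m, n, hmn⟩ := hcon
  have h1 : ∀ p, b p = b j := by
    intro p
    rcases h p j with h2 | h2
    · rcases h p l with h3 | h3
      · exact absurd (h2.symm.trans h3) hjl
      · exact h3.trans ((h j l).resolve_left hjl).symm
    · exact h2
  exact hmn ((h1 m).trans (h1 n).symm)

/-- A coherent family of integral vectors orthogonal to a positive vector. -/
theorem exists_eq_sub_single_of_gram {ι J : Type*} [Fintype ι] [DecidableEq ι] [DecidableEq J]
    {v : ι → ℤ} (hv : ∀ i, 0 < v i) {β : J → ι → ℤ} {e : ℤ}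
    (hvβ : ∀ j, ∑ i, v i * β j i = 0)
    (hβ : ∀ j l, ∑ i, β j i * β l i = e + if j = l then 1 else 0) {j₀ : J}
    (j₁ : {j // j ≠ j₀}) :
    ∃ (ε : ℤ) (γ : ι → ℤ) (χ : J → ι), ε * ε = 1 ∧ Function.Injective χ ∧
      ∀ j, β j = γ - Pi.single (χ j) ε := by
  suffices H : ∃ (ε : ℤ) (γ : ι → ℤ) (χ : J → ι), ε * ε = 1 ∧
      ∀ j, β j = γ - Pi.single (χ j) ε by
    obtain ⟨ε, γ, χ, hε, h⟩ := H
    refine ⟨ε, γ, χ, hε, fun j l hjl => ?_, h⟩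
    by_contra hne
    have h1 : β j = β l := by rw [h, h, hjl]
    have h2 := hβ j l
    rw [← h1, hβ, if_pos rfl, if_neg hne] at h2
    omega
  have hD : ∀ j : {j // j ≠ j₀}, ∃ a b, β j₀ - β j = Pi.single a 1 - Pi.single b 1 := by
    rintro ⟨j, hj⟩
    refine exists_eq_single_sub_single hv ?_ ?_
    · calc ∑ i, (β j₀ - β j) i * (β j₀ - β j) i
          = ∑ i, (β j₀ i * β j₀ i - β j₀ i * β j i - β j i * β j₀ i + β j i * β j i) :=
            Finset.sum_congr rfl fun i _ => by simp only [Pi.sub_apply]; ring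
        _ = 2 := by
            rw [Finset.sum_add_distrib, Finset.sum_sub_distrib, Finset.sum_sub_distrib, hβ, hβ,
              hβ, hβ, if_pos rfl, if_pos rfl, if_neg hj, if_neg (Ne.symm hj)]
            ring
    · simp only [Pi.sub_apply, mul_sub, Finset.sum_sub_distrib, hvβ, sub_zero]
  choose a b hab using hD
  have hβj : ∀ j (hj : j ≠ j₀), β j = β j₀ - Pi.single (a ⟨j, hj⟩) 1 +
      Pi.single (b ⟨j, hj⟩) 1 := by
    intro j hj
    have h := hab ⟨j, hj⟩
    rw [sub_eq_iff_eq_add'] at h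
    rw [h]
    abel
  have hcase : ∀ j l, a j = a l ∨ b j = b l := by
    intro j l
    rcases eq_or_ne j l with rfl | hjl
    · exact Or.inl rfl
    have hne : (j : J) ≠ l := fun h => hjl (Subtype.ext h)
    have h1 : ∑ i, (β j₀ - β j) i * (β j₀ - β l) i = 1 := by
      calc ∑ i, (β j₀ - β j) i * (β j₀ - β l) i
          = ∑ i, (β j₀ i * β j₀ i - β j₀ i * β l i - β j i * β j₀ i + β j i * β l i) :=
            Finset.sum_congr rfl fun i _ => by simp only [Pi.sub_apply]; ring
        _ = 1 := by
            rw [Finset.sum_add_distrib, Finset.sum_sub_distrib, Finset.sum_sub_distrib, hβ, hβ,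
              hβ, hβ, if_pos rfl, if_neg (Ne.symm l.2), if_neg j.2, if_neg hne]
            ring
    by_contra! hcon
    rw [hab, hab] at h1
    simp only [Pi.sub_apply, mul_sub, Finset.sum_sub_distrib, Pi.single_apply, sub_mul, ite_mul,
      one_mul, zero_mul, Finset.sum_ite_eq', Finset.mem_univ, if_true, if_neg hcon.1,
      if_neg hcon.2] at h1
    split_ifs at h1 <;> omega
  rcases forall_eq_or_forall_eq hcase with h | h
  · refine ⟨-1, β j₀ - Pi.single (a j₁) 1,
      fun j => if hj : j = j₀ then a j₁ else b ⟨j, hj⟩, by norm_num, fun j => ?_⟩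
    by_cases hj : j = j₀
    · subst hj
      simp [Pi.single_neg]
    · simp only [dif_neg hj, hβj j hj, h ⟨j, hj⟩ j₁, Pi.single_neg, sub_neg_eq_add]
  · refine ⟨1, β j₀ + Pi.single (b j₁) 1,
      fun j => if hj : j = j₀ then b j₁ else a ⟨j, hj⟩, by norm_num, fun j => ?_⟩
    by_cases hj : j = j₀
    · subst hj
      simp
    · simp only [dif_neg hj, hβj j hj, h ⟨j, hj⟩ j₁]
      abel

end

section

/-- Coherent families that are mutually orthogonal and exhaust all but one coordinate are described
by one sign per family and one integer per pair of families. -/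
theorem exists_block_constants {κ : Type*} [Fintype κ] [DecidableEq κ] {w e : κ → ℕ}
    (hw : ∀ k, 2 ≤ w k) {r : ℕ} {v t : Fin r → ℤ} {β : ∀ k, Fin (w k) → Fin r → ℤ}
    (hr : r ≤ 1 + ∑ k, w k) (hv : ∀ i, 0 < v i) (ht : ∑ i, t i * t i = 1)
    (hvβ : ∀ k j, ∑ i, v i * β k j i = 0) (htβ : ∀ k j, ∑ i, t i * β k j i = 1)
    (hβ : ∀ k j m, ∑ i, β k j i * β k m i = e k + if j = m then 1 else 0)
    (hβ' : ∀ k l, k ≠ l → ∀ j m, ∑ i, β k j i * β l m i = 0) :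
    ∃ (ε : κ → ℤ) (b : κ → κ → ℤ), (∀ k, ε k * ε k = 1) ∧
      ∀ k l, 1 + ∑ i, w i * (b k i * b l i) - ε k * b l k - ε l * b k l =
        if k = l then (e k : ℤ) else 0 := by
  have h0 : ∀ k, 0 < w k := fun k => (Nat.zero_lt_two).trans_le (hw k)
  have hne : ∀ k (j : Fin (w k)), ∃ j', j' ≠ j := fun k j => by
    have : Nontrivial (Fin (w k)) := Fin.nontrivial_iff_two_le.2 (hw k)
    exact exists_ne j
  have hex : ∀ k, ∃ (ε : ℤ) (γ : Fin r → ℤ) (χ : Fin (w k) → Fin r), ε * ε = 1 ∧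
      Function.Injective χ ∧ ∀ j, β k j = γ - Pi.single (χ j) ε := by
    intro k
    obtain ⟨j', hj'⟩ := hne k ⟨0, h0 k⟩
    exact exists_eq_sub_single_of_gram hv (hvβ k) (hβ k) ⟨j', hj'⟩
  choose ε γ χ hε hχ hβγ using hex
  have hε0 : ∀ k, ε k ≠ 0 := fun k h => by simpa [h] using hε k
  obtain ⟨i₀, s, hs, rfl⟩ := exists_eq_single_of_sum_mul_self_eq_one ht
  have hβs : ∀ k j, β k j i₀ = s := by
    intro k j
    have h := htβ k j
    simp only [Pi.single_apply, ite_mul, zero_mul, Finset.sum_ite_eq', Finset.mem_univ,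
      if_true] at h
    calc β k j i₀ = s * s * β k j i₀ := by rw [hs, one_mul]
      _ = s * (s * β k j i₀) := mul_assoc _ _ _
      _ = s := by rw [h, mul_one]
  have hdiff : ∀ k j j' i, β k j i - β k j' i =
      (Pi.single (χ k j') (ε k) : Fin r → ℤ) i - (Pi.single (χ k j) (ε k) : Fin r → ℤ) i := by
    intro k j j' i
    rw [hβγ k j, hβγ k j']
    simp only [Pi.sub_apply]
    ring
  have hsum : ∀ (f : Fin r → ℤ) k j j', ∑ i, f i * β k j i - ∑ i, f i * β k j' i =
      ε k * (f (χ k j') - f (χ k j)) := by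
    intro f k j j'
    rw [← Finset.sum_sub_distrib]
    simp only [← mul_sub, hdiff k j j']
    simp only [mul_sub, Pi.single_apply, mul_ite, mul_zero, Finset.sum_sub_distrib,
      Finset.sum_ite_eq', Finset.mem_univ, if_true]
    ring
  have hχi₀ : ∀ k j, χ k j ≠ i₀ := by
    intro k j h
    obtain ⟨j', hj'⟩ := hne k j
    have h1 := hdiff k j j' i₀
    rw [hβs, hβs, ← h, Pi.single_eq_same,
      Pi.single_eq_of_ne (fun h2 => hj' (hχ k h2).symm)] at h1
    exact hε0 k (by omega)
  have hconst : ∀ k l, k ≠ l → ∀ j m m', β k j (χ l m) = β k j (χ l m') := by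
    intro k l hkl j m m'
    have h := hsum (β k j) l m m'
    rw [hβ' k l hkl, hβ' k l hkl, sub_zero] at h
    have := (mul_eq_zero.1 h.symm).resolve_left (hε0 l)
    omega
  have hdisj : ∀ k l, k ≠ l → ∀ j m, χ k j ≠ χ l m := by
    intro k l hkl j m h
    obtain ⟨j', hj'⟩ := hne k j
    obtain ⟨m', hm'⟩ := hne l m
    have h1 := hdiff k j j' (χ l m)
    have h2 := hdiff k j j' (χ l m')
    rw [hconst k l hkl j m m', hconst k l hkl j' m m', h2, ← h, Pi.single_eq_same,
      Pi.single_eq_of_ne (fun h3 => hj' (hχ k h3).symm),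
      Pi.single_eq_of_ne (i := χ k j) (fun h3 => hm' (hχ l (h3.trans h)))] at h1
    simp only [Pi.single_apply] at h1
    have := hε0 k
    have := hε k
    split_ifs at h1
    · have : ε k = 0 := by omega
      exact hε0 k this
    · exact hε0 k (by omega)
  let X : Option (Σ k, Fin (w k)) → Fin r := fun o => o.elim i₀ fun p => χ p.1 p.2
  have hX : Function.Injective X := by
    rintro (_ | ⟨k, j⟩) (_ | ⟨l, m⟩) h
    · rfl
    · exact absurd h.symm (hχi₀ l m)
    · exact absurd h (hχi₀ k j)
    · have h' : χ k j = χ l m := h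
      obtain rfl : k = l := by
        by_contra hkl
        exact hdisj k l hkl j m h'
      rw [hχ k h']
  have hXb : Function.Bijective X := by
    rw [Fintype.bijective_iff_injective_and_card]
    refine ⟨hX, le_antisymm (Fintype.card_le_of_injective X hX) ?_⟩
    simp only [Fintype.card_option, Fintype.card_sigma, Fintype.card_fin]
    omega
  have hsumX : ∀ f : Fin r → ℤ, ∑ i, f i = f i₀ + ∑ i, ∑ m, f (χ i m) := by
    intro f
    rw [← (Equiv.ofBijective X hXb).sum_comp, Fintype.sum_option, Fintype.sum_sigma]
    rfl
  have hγ : ∀ k i m m', γ k (χ i m) = γ k (χ i m') := by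
    intro k i m m'
    rcases eq_or_ne k i with rfl | hki
    · rcases eq_or_ne m m' with rfl | hm
      · rfl
      have h := hsum (β k m) k m m'
      rw [hβ, hβ, if_pos rfl, if_neg hm, hβγ k m] at h
      simp only [Pi.sub_apply, Pi.single_eq_same] at h
      rw [Pi.single_eq_of_ne (fun h3 => hm (hχ k h3).symm)] at h
      have h4 : ε k * (γ k (χ k m') - γ k (χ k m)) = 0 := by linear_combination -h - hε k
      have := (mul_eq_zero.1 h4).resolve_left (hε0 k)
      omega
    · have h := hconst k i hki ⟨0, h0 k⟩ m m'
      rw [hβγ k] at h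
      simp only [Pi.sub_apply] at h
      rwa [Pi.single_eq_of_ne (hdisj k i hki _ _).symm, Pi.single_eq_of_ne (hdisj k i hki _ _).symm,
        sub_zero, sub_zero] at h
  refine ⟨ε, fun k i => γ k (χ i ⟨0, h0 i⟩), hε, fun k l => ?_⟩
  have hval : ∀ k i m, β k ⟨0, h0 k⟩ (χ i m) =
      γ k (χ i ⟨0, h0 i⟩) - (Pi.single (χ k ⟨0, h0 k⟩) (ε k) : Fin r → ℤ) (χ i m) := by
    intro k i m
    rw [hβγ k, ← hγ k i m]
    rfl
  have hsingle : ∀ (c d : κ → ℤ) k, ∑ i, ∑ m, c i *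
      (Pi.single (χ k ⟨0, h0 k⟩) (d k) : Fin r → ℤ) (χ i m) = d k * c k := by
    intro c d k
    rw [Finset.sum_eq_single k]
    · rw [Finset.sum_eq_single (⟨0, h0 k⟩ : Fin (w k))]
      · rw [Pi.single_eq_same, mul_comm]
      · intro m _ hm
        rw [Pi.single_eq_of_ne (fun h => hm (hχ k h)), mul_zero]
      · simp
    · intro i _ hi
      refine Finset.sum_eq_zero fun m _ => ?_
      rw [Pi.single_eq_of_ne (hdisj i k hi _ _), mul_zero]
    · simp
  have hmain : ∑ i, β k ⟨0, h0 k⟩ i * β l ⟨0, h0 l⟩ i =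
      1 + ∑ i, w i * (γ k (χ i ⟨0, h0 i⟩) * γ l (χ i ⟨0, h0 i⟩)) -
        ε k * γ l (χ k ⟨0, h0 k⟩) - ε l * γ k (χ l ⟨0, h0 l⟩) + if k = l then 1 else 0 := by
    have hkl : ∑ i, ∑ m, (Pi.single (χ k ⟨0, h0 k⟩) (ε k) : Fin r → ℤ) (χ i m) *
        (Pi.single (χ l ⟨0, h0 l⟩) (ε l) : Fin r → ℤ) (χ i m) = if k = l then 1 else 0 := by
      split_ifs with h
      · subst h
        have h5 := hsingle (fun _ => 1) (fun k => ε k * ε k) k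
        simp only [one_mul, mul_one, hε] at h5
        rw [← h5]
        refine Finset.sum_congr rfl fun i _ => Finset.sum_congr rfl fun m _ => ?_
        simp only [Pi.single_apply]
        split_ifs
        · rw [hε]
        · rw [mul_zero]
      · refine Finset.sum_eq_zero fun i _ => Finset.sum_eq_zero fun m _ => ?_
        rcases eq_or_ne i k with rfl | hi
        · rw [Pi.single_eq_of_ne (hdisj i l h _ _), mul_zero]
        · rw [Pi.single_eq_of_ne (hdisj i k hi _ _), zero_mul]
    rw [hsumX, hβs, hβs, hs]
    simp only [hval]
    calc 1 + ∑ i, ∑ m, (γ k (χ i ⟨0, h0 i⟩) -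
            (Pi.single (χ k ⟨0, h0 k⟩) (ε k) : Fin r → ℤ) (χ i m)) * (γ l (χ i ⟨0, h0 i⟩) -
            (Pi.single (χ l ⟨0, h0 l⟩) (ε l) : Fin r → ℤ) (χ i m))
        = 1 + ∑ i, ∑ m : Fin (w i), (γ k (χ i ⟨0, h0 i⟩) * γ l (χ i ⟨0, h0 i⟩) -
            γ l (χ i ⟨0, h0 i⟩) * (Pi.single (χ k ⟨0, h0 k⟩) (ε k) : Fin r → ℤ) (χ i m) -
            γ k (χ i ⟨0, h0 i⟩) * (Pi.single (χ l ⟨0, h0 l⟩) (ε l) : Fin r → ℤ) (χ i m) +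
            (Pi.single (χ k ⟨0, h0 k⟩) (ε k) : Fin r → ℤ) (χ i m) *
            (Pi.single (χ l ⟨0, h0 l⟩) (ε l) : Fin r → ℤ) (χ i m)) := by
          congr 1
          refine Finset.sum_congr rfl fun i _ => Finset.sum_congr rfl fun m _ => ?_
          ring
      _ = _ := by
          simp only [Finset.sum_add_distrib, Finset.sum_sub_distrib]
          rw [hkl, hsingle (fun i => γ l (χ i ⟨0, h0 i⟩)) ε k,
            hsingle (fun i => γ k (χ i ⟨0, h0 i⟩)) ε l]
          simp only [Finset.sum_const, Finset.card_univ, Fintype.card_fin, nsmul_eq_mul]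
          ring
  rcases eq_or_ne k l with rfl | hkl
  · rw [hβ] at hmain
    simp only [if_true] at hmain ⊢
    linarith
  · rw [hβ' k l hkl] at hmain
    simp only [if_neg hkl] at hmain ⊢
    linarith

end

section

/-- Bessel's inequality for an orthogonal family in a weighted Euclidean space. -/
theorem weighted_bessel {ι κ : Type*} [Fintype ι] [Fintype κ] [DecidableEq κ] {W : ι → ℝ}
    (hW : ∀ i, 0 ≤ W i) {y : κ → ι → ℝ} {N : κ → ℝ} (hN : ∀ k, 0 < N k)
    (hy : ∀ k l, ∑ i, W i * (y k i * y l i) = if k = l then N k else 0) (x : ι → ℝ) :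
    ∑ k, (∑ i, W i * (x i * y k i)) ^ 2 / N k ≤ ∑ i, W i * x i ^ 2 := by
  set c : κ → ℝ := fun k => (∑ i, W i * (x i * y k i)) / N k with hc
  have hcN : ∀ k, ∑ i, W i * (x i * y k i) = c k * N k := fun k => by
    rw [hc]; exact (div_mul_cancel₀ _ (hN k).ne').symm
  have h1 : 0 ≤ ∑ i, W i * (x i - ∑ k, c k * y k i) ^ 2 :=
    Finset.sum_nonneg fun i _ => mul_nonneg (hW i) (sq_nonneg _)
  have h2 : ∑ i, W i * (x i * ∑ k, c k * y k i) = ∑ k, c k * (c k * N k) := by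
    simp only [Finset.mul_sum]
    rw [Finset.sum_comm]
    refine Finset.sum_congr rfl fun k _ => ?_
    rw [← hcN, Finset.mul_sum]
    exact Finset.sum_congr rfl fun i _ => by ring
  have h3 : ∑ i, W i * (∑ k, c k * y k i) ^ 2 = ∑ k, c k * (c k * N k) := by
    simp only [sq, Finset.sum_mul_sum]
    simp only [Finset.mul_sum]
    rw [Finset.sum_comm]
    refine Finset.sum_congr rfl fun k _ => ?_
    rw [Finset.sum_comm]
    calc ∑ l, ∑ i, W i * (c k * y k i * (c l * y l i))
        = ∑ l, c k * (c l * ∑ i, W i * (y k i * y l i)) := by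
          refine Finset.sum_congr rfl fun l _ => ?_
          simp only [Finset.mul_sum]
          exact Finset.sum_congr rfl fun i _ => by ring
      _ = _ := by simp [hy]
  have h4 : ∑ i, W i * (x i - ∑ k, c k * y k i) ^ 2 = ∑ i, W i * x i ^ 2 -
      2 * ∑ i, W i * (x i * ∑ k, c k * y k i) + ∑ i, W i * (∑ k, c k * y k i) ^ 2 := by
    rw [Finset.mul_sum, ← Finset.sum_sub_distrib, ← Finset.sum_add_distrib]
    exact Finset.sum_congr rfl fun i _ => by ring
  have h5 : ∑ k, (∑ i, W i * (x i * y k i)) ^ 2 / N k = ∑ k, c k * (c k * N k) := by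
    refine Finset.sum_congr rfl fun k _ => ?_
    rw [hcN]
    have := (hN k).ne'
    field_simp
  rw [h5]
  linarith

section BlockConstants

variable {κ : Type*} [Fintype κ] [DecidableEq κ] {w e : κ → ℕ} {ε : κ → ℤ} {b : κ → κ → ℤ}

theorem sum_ne_zero_le (hw : ∀ k, 2 ≤ w k) (hε : ∀ k, ε k * ε k = 1)
    (hb : ∀ k l, 1 + ∑ i, w i * (b k i * b l i) - ε k * b l k - ε l * b k l =
      if k = l then (e k : ℤ) else 0) (k : κ) :
    ∑ i with i ≠ k ∧ b k i ≠ 0, w i + 1 ≤ e k := by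
  have h1 := hb k k
  rw [if_pos rfl, ← Finset.add_sum_erase _ _ (Finset.mem_univ k)] at h1
  have h2 : (∑ i with i ≠ k ∧ b k i ≠ 0, (w i : ℤ)) ≤
      ∑ i ∈ Finset.univ.erase k, (w i : ℤ) * (b k i * b k i) := by
    calc (∑ i with i ≠ k ∧ b k i ≠ 0, (w i : ℤ))
        ≤ ∑ i with i ≠ k ∧ b k i ≠ 0, (w i : ℤ) * (b k i * b k i) := by
          refine Finset.sum_le_sum fun i hi => ?_
          have h3 : b k i ≠ 0 := (Finset.mem_filter.1 hi).2.2
          have h4 : 0 < b k i * b k i := mul_self_pos.2 h3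
          nlinarith [Int.natCast_nonneg (w i)]
      _ ≤ _ := by
          refine Finset.sum_le_sum_of_subset_of_nonneg ?_ ?_
          · intro i hi
            exact Finset.mem_erase.2 ⟨(Finset.mem_filter.1 hi).2.1, Finset.mem_univ i⟩
          · intro i _ _
            exact mul_nonneg (Int.natCast_nonneg _) (mul_self_nonneg _)
  have h5 : 1 ≤ 1 + (w k : ℤ) * (b k k * b k k) - ε k * b k k - ε k * b k k := by
    have hw' : (2 : ℤ) ≤ w k := by exact_mod_cast hw k
    have h6 := hε k
    have h7 : 1 ≤ b k k * b k k + (b k k - ε k) * (b k k - ε k) := by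
      by_cases h : b k k = 0
      · rw [h]; nlinarith
      · have : 0 < b k k * b k k := mul_self_pos.2 h
        nlinarith [mul_self_nonneg (b k k - ε k)]
    nlinarith [mul_self_nonneg (b k k)]
  have : ((∑ i with i ≠ k ∧ b k i ≠ 0, w i + 1 : ℕ) : ℤ) ≤ e k := by
    push_cast
    linarith
  exact_mod_cast this

theorem ne_zero_or_ne_zero (hwe : ∀ k, Even (w k))
    (hb : ∀ k l, 1 + ∑ i, w i * (b k i * b l i) - ε k * b l k - ε l * b k l =
      if k = l then (e k : ℤ) else 0) {k l : κ} (hkl : k ≠ l) : b k l ≠ 0 ∨ b l k ≠ 0 := by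
  by_contra! h
  have h1 := hb k l
  rw [if_neg hkl, h.1, h.2] at h1
  have h2 : (2 : ℤ) ∣ ∑ i, (w i : ℤ) * (b k i * b l i) :=
    Finset.dvd_sum fun i _ => Dvd.dvd.mul_right (by exact_mod_cast (hwe i).two_dvd) _
  omega

theorem sum_div_ne_zero_le (hw : ∀ k, 2 ≤ w k) (hε : ∀ k, ε k * ε k = 1)
    (hb : ∀ k l, 1 + ∑ i, w i * (b k i * b l i) - ε k * b l k - ε l * b k l =
      if k = l then (e k : ℤ) else 0) (k : κ) :
    ∑ i with i ≠ k ∧ b i k ≠ 0, (w i : ℝ) / (w i * e i + 1) ≤ e k / (w k * e k + 1) := by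
  have hw0 : ∀ i, (2 : ℝ) ≤ w i := fun i => by exact_mod_cast hw i
  have he0 : ∀ i, (0 : ℝ) ≤ e i := fun i => Nat.cast_nonneg _
  have ha0 : ∀ i, (0 : ℝ) < w i * e i + 1 := fun i => by have := hw0 i; have := he0 i; positivity
  have hbessel := weighted_bessel (ι := Option κ) (W := fun o => o.elim 1 fun i => (w i : ℝ))
    (y := fun l o => o.elim (w l : ℝ) fun i => w l * b l i - if i = l then (ε l : ℝ) else 0)
    (N := fun l => w l * (w l * e l + 1)) (by rintro (_ | i) <;> simp)
    (fun l => mul_pos (by linarith [hw0 l]) (ha0 l)) (by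
      intro l m
      have h1 := hb l m
      have h2 : (1 : ℝ) + ∑ i, (w i : ℝ) * ((b l i : ℝ) * (b m i : ℝ)) - ε l * b m l - ε m * b l m =
        if l = m then (e l : ℝ) else 0 := by exact_mod_cast h1
      have h3 : ∀ i, (w i : ℝ) * ((w l * b l i - if i = l then (ε l : ℝ) else 0) *
          (w m * b m i - if i = m then (ε m : ℝ) else 0)) =
          w l * w m * (w i * (b l i * b m i)) - (if i = l then (w l * w m * ε l * b m l : ℝ) else 0)
          - (if i = m then (w l * w m * ε m * b l m : ℝ) else 0)
          + (if i = l then if l = m then (w l : ℝ) else 0 else 0) := by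
        intro i
        have h4 : (ε i : ℝ) * ε i = 1 := by exact_mod_cast hε i
        by_cases hil : i = l
        · subst hil
          by_cases him : i = m
          · subst him
            simp only [if_true]
            linear_combination (w i : ℝ) * h4
          · simp only [if_true, if_neg him]; ring
        · by_cases him : i = m
          · subst him
            simp only [if_true, if_neg hil]; ring
          · simp only [if_neg him, if_neg hil]; ring
      rw [Fintype.sum_option]
      simp only [Option.elim, h3, Finset.sum_add_distrib, Finset.sum_sub_distrib,
        Finset.sum_ite_eq', Finset.mem_univ, if_true, ← Finset.mul_sum]
      by_cases hlm : l = m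
      · subst hlm
        simp only [if_true] at h2 ⊢
        linear_combination (w l : ℝ) * w l * h2
      · simp only [if_neg hlm] at h2 ⊢
        linear_combination (w l : ℝ) * w m * h2)
    (fun o => o.elim 0 fun i => if i = k then 1 else 0)
  simp only [Fintype.sum_option, Option.elim, zero_mul, mul_zero, zero_add, ite_mul, one_mul,
    mul_ite, ite_pow, one_pow, ne_eq, OfNat.ofNat_ne_zero, not_false_eq_true, zero_pow, mul_one,
    Finset.sum_ite_eq', Finset.mem_univ, if_true] at hbessel
  set T : κ → ℝ := fun l => ((w k : ℝ) * (w l * b l k - if k = l then (ε l : ℝ) else 0)) ^ 2 /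
    (w l * (w l * e l + 1)) with hT
  have hT0 : ∀ l, 0 ≤ T l := fun l =>
    div_nonneg (sq_nonneg _) (mul_nonneg (by linarith [hw0 l]) (ha0 l).le)
  have h1 : T k + ∑ i with i ≠ k ∧ b i k ≠ 0, T i ≤ w k := by
    refine le_trans ?_ hbessel
    rw [← Finset.add_sum_erase Finset.univ _ (Finset.mem_univ k)]
    refine add_le_add_right (Finset.sum_le_sum_of_subset_of_nonneg ?_ fun i _ _ => hT0 i) _
    intro i hi
    exact Finset.mem_erase.2 ⟨(Finset.mem_filter.1 hi).2.1, Finset.mem_univ i⟩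
  have h2 : (w k : ℝ) / (w k * e k + 1) ≤ T k := by
    have h3 : (1 : ℝ) ≤ (w k * b k k - ε k) ^ 2 := by
      have h4 : (w k : ℤ) * b k k - ε k ≠ 0 := by
        intro h
        have h5 : (w k : ℤ) ∣ 1 := by
          rw [← hε k]
          exact Dvd.dvd.mul_right ⟨b k k, by linarith⟩ _
        have h6 := Int.le_of_dvd one_pos h5
        have := hw k
        omega
      have h5 : 0 < ((w k : ℤ) * b k k - ε k) ^ 2 := by positivity
      exact_mod_cast h5
    simp only [hT, if_true]
    rw [div_le_div_iff₀ (ha0 k) (mul_pos (by linarith [hw0 k]) (ha0 k)), mul_pow]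
    have := mul_le_mul_of_nonneg_left h3
      (mul_nonneg (sq_nonneg (w k : ℝ)) (ha0 k).le)
    linarith
  have h3 : ∑ i with i ≠ k ∧ b i k ≠ 0, (w k : ℝ) ^ 2 * ((w i : ℝ) / (w i * e i + 1)) ≤
      ∑ i with i ≠ k ∧ b i k ≠ 0, T i := by
    refine Finset.sum_le_sum fun i hi => ?_
    obtain ⟨hik, hbi⟩ := (Finset.mem_filter.1 hi).2
    have h4 : (1 : ℝ) ≤ (b i k : ℝ) ^ 2 := by
      have h5 : 0 < (b i k) ^ 2 := by positivity
      exact_mod_cast h5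
    simp only [hT, if_neg (Ne.symm hik), sub_zero]
    rw [← mul_div_assoc, div_le_div_iff₀ (ha0 i) (mul_pos (by linarith [hw0 i]) (ha0 i))]
    have := mul_le_mul_of_nonneg_left h4
      (mul_nonneg (mul_nonneg (sq_nonneg (w k : ℝ)) (sq_nonneg (w i : ℝ))) (ha0 i).le)
    linarith
  rw [← Finset.mul_sum] at h3
  set S := ∑ i with i ≠ k ∧ b i k ≠ 0, (w i : ℝ) / (w i * e i + 1)
  have h4 : (w k : ℝ) / (w k * e k + 1) + w k ^ 2 * S ≤ w k := by linarith
  have hwk : (0 : ℝ) < w k := by linarith [hw0 k]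
  rw [le_div_iff₀ (ha0 k)]
  rw [div_add' _ _ _ (ha0 k).ne', div_le_iff₀ (ha0 k)] at h4
  have h5 : (w k : ℝ) ^ 2 * (S * (w k * e k + 1)) ≤ w k ^ 2 * e k := by linarith
  exact le_of_mul_le_mul_left h5 (by positivity)

theorem false_of_block_constants [Nonempty κ] (hw : ∀ k, 2 ≤ w k) (hwe : ∀ k, Even (w k))
    (he : ∀ k, 2 ≤ e k) (hinj : Function.Injective fun k => w k * e k + 1) {n : ℕ}
    (hn : ∀ k, (w k * e k + 1) * e k * (w k * e k + 1 + 1) ≤ n)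
    (hsum : ∑ k, (w k : ℝ) / (w k * e k + 1) = 1 - 1 / n) (hε : ∀ k, ε k * ε k = 1)
    (hb : ∀ k l, 1 + ∑ i, w i * (b k i * b l i) - ε k * b l k - ε l * b k l =
      if k = l then (e k : ℤ) else 0) : False := by
  obtain ⟨k, hk⟩ := Finite.exists_min fun k => w k * e k + 1
  have h1 := sum_ne_zero_le hw hε hb k
  have h2 := sum_div_ne_zero_le hw hε hb k
  have ha0 : ∀ i, (0 : ℝ) < w i * e i + 1 := fun i => by positivity
  have h3 : ∑ i with i ≠ k ∧ b k i ≠ 0, (w i : ℝ) / (w i * e i + 1) ≤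
      (e k - 1) / (w k * e k + 1 + 1) := by
    calc ∑ i with i ≠ k ∧ b k i ≠ 0, (w i : ℝ) / (w i * e i + 1)
        ≤ ∑ i with i ≠ k ∧ b k i ≠ 0, (w i : ℝ) / (w k * e k + 1 + 1) := by
          refine Finset.sum_le_sum fun i hi => ?_
          have h4 : i ≠ k := (Finset.mem_filter.1 hi).2.1
          have h5 : w k * e k + 1 < w i * e i + 1 :=
            lt_of_le_of_ne (hk i) fun h => h4 (hinj h).symm
          have h6 : ((w k * e k + 1 + 1 : ℕ) : ℝ) ≤ (w i * e i + 1 : ℕ) := by exact_mod_cast h5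
          push_cast at h6
          exact div_le_div_of_nonneg_left (Nat.cast_nonneg _) (by linarith [ha0 k]) h6
      _ ≤ _ := by
          rw [← Finset.sum_div]
          refine div_le_div_of_nonneg_right ?_ (by linarith [ha0 k])
          have h4 : ((∑ i with i ≠ k ∧ b k i ≠ 0, w i + 1 : ℕ) : ℝ) ≤ e k := by exact_mod_cast h1
          push_cast at h4
          linarith
  have h4 : ∑ i, (w i : ℝ) / (w i * e i + 1) ≤ (w k : ℝ) / (w k * e k + 1) +
      (e k - 1) / (w k * e k + 1 + 1) + e k / (w k * e k + 1) := by
    have h5 : ∑ i ∈ Finset.univ.erase k, (w i : ℝ) / (w i * e i + 1) ≤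
        ∑ i with i ≠ k ∧ b k i ≠ 0, (w i : ℝ) / (w i * e i + 1) +
        ∑ i with i ≠ k ∧ b i k ≠ 0, (w i : ℝ) / (w i * e i + 1) := by
      rw [← Finset.sum_union_inter]
      refine le_trans (Finset.sum_le_sum_of_subset_of_nonneg ?_ fun i _ _ =>
        div_nonneg (Nat.cast_nonneg _) (ha0 i).le) (le_add_of_nonneg_right
          (Finset.sum_nonneg fun i _ => div_nonneg (Nat.cast_nonneg _) (ha0 i).le))
      intro i hi
      have h6 := (Finset.mem_erase.1 hi).1
      rcases ne_zero_or_ne_zero hwe hb h6 with h | h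
      · exact Finset.mem_union_right _ (by simp [h6, h])
      · exact Finset.mem_union_left _ (by simp [h6, h])
    rw [← Finset.add_sum_erase _ _ (Finset.mem_univ k)]
    linarith
  rw [hsum] at h4
  have hw2 : (2 : ℝ) ≤ w k := by exact_mod_cast hw k
  have he2 : (2 : ℝ) ≤ e k := by exact_mod_cast he k
  have hn' : ((w k : ℝ) * e k + 1) * e k * (w k * e k + 1 + 1) ≤ n := by exact_mod_cast hn k
  set a : ℝ := w k * e k + 1 with ha
  have ha1 : 0 < a := ha0 k
  have hwa : (w k : ℝ) + 2 * e k - 1 ≤ a := by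
    nlinarith [mul_nonneg (sub_nonneg.2 hw2) (sub_nonneg.2 he2)]
  have h5 : (1 : ℝ) / n ≤ 1 / (a * e k * (a + 1)) := one_div_le_one_div_of_le (by positivity) hn'
  have h6 : (1 : ℝ) / (a * e k * (a + 1)) ≤ (1 / 2) / (a * (a + 1)) := by
    rw [div_le_div_iff₀ (by positivity) (by positivity)]
    have : 0 < a * (a + 1) := by positivity
    nlinarith
  have h7 : 1 ≤ (w k + e k) / a + (e k - 1) / (a + 1) + (1 / 2) / (a * (a + 1)) := by
    rw [add_div]
    linarith
  have h8 : (w k + e k) / a + (e k - 1) / (a + 1) + (1 / 2) / (a * (a + 1)) =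
      ((w k + e k) * (a + 1) + (e k - 1) * a + 1 / 2) / (a * (a + 1)) := by
    field_simp
  rw [h8, one_le_div (by positivity)] at h7
  nlinarith

end BlockConstants

end

section

theorem FrobeniusPartition.false_of_odd {G : Type*} [Group G] [Finite G] {κ : Type*} [Fintype κ]
    [Nonempty κ] (F : FrobeniusPartition G κ) (hF : Function.Injective F.a)
    (h2 : ¬ 2 ∣ Nat.card G) : False := by
  classical
  have hdvd : ∀ k, F.a k * F.e k ∣ Nat.card G := fun k => by
    have h := Subgroup.card_subgroup_dvd_card (Subgroup.normalizer (F.A k : Set G))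
    rwa [F.card_normalizer k] at h
  have hwe : ∀ k, Even (F.w k) := fun k => by
    by_contra h
    have ha : Odd (F.a k) := Nat.not_even_iff_odd.1 fun h =>
      h2 (h.two_dvd.trans ((dvd_mul_right _ _).trans (hdvd k)))
    have he : Odd (F.e k) := Nat.not_even_iff_odd.1 fun h =>
      h2 (h.two_dvd.trans ((dvd_mul_left _ _).trans (hdvd k)))
    rw [F.a_eq k] at ha
    exact Nat.not_even_iff_odd.2 ha ((Nat.not_even_iff_odd.1 h).mul he).add_one
  have hw : ∀ k, 2 ≤ F.w k := fun k => Nat.le_of_dvd (F.w_pos k) (hwe k).two_dvd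
  obtain ⟨r, v, t, β, hr, hv, ht, hvβ, htβ, hβ, hβ'⟩ := F.exists_multiplicity_vectors
  obtain ⟨ε, b, hε, hb⟩ := exists_block_constants hw hr hv ht hvβ htβ hβ hβ'
  refine false_of_block_constants (n := Nat.card G) hw hwe (fun k => (F.e_prime k).two_le) ?_ ?_ ?_
    hε hb
  · intro k l h
    exact hF ((F.a_eq k).trans (h.trans (F.a_eq l).symm))
  · intro k
    rw [← F.a_eq k]
    exact F.mul_le_card k
  · rw [← F.sum_w_div_a]
    refine Finset.sum_congr rfl fun k _ => ?_
    rw [F.a_eq k]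
    push_cast
    rfl

theorem card_primeFactors_le_three_of_isSimpleGroup {G : Type*} [Group G] [Finite G]
    [IsSimpleGroup G] (hsub : ProperNilpotentOrMinimal G) (hc : commutator G = ⊤) :
    (Nat.card G).primeFactors.card ≤ 3 := by
  obtain ⟨F, hF⟩ := exists_frobeniusPartition hsub hc
  by_cases h2 : 2 ∣ Nat.card G
  · exact F.card_primeFactors_le_three_of_two_dvd rfl hF h2
  · obtain ⟨p, hp⟩ := Nat.nonempty_primeFactors.2 (Finite.one_lt_card (α := G))
    have : Nonempty (Nat.card G).primeFactors := ⟨⟨p, hp⟩⟩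
    refine (F.false_of_odd ?_ h2).elim
    intro p q hpq
    have hp := Nat.prime_of_mem_primeFactors p.2
    have hq := Nat.prime_of_mem_primeFactors q.2
    have hpa : (p : ℕ) ∣ F.a p := by
      rw [hF]
      exact dvd_pow_self _
        (hp.factorization_pos_of_dvd Nat.card_pos.ne' (Nat.dvd_of_mem_primeFactors p.2)).ne'
    rw [hpq, hF] at hpa
    exact Subtype.ext ((Nat.prime_dvd_prime_iff_eq hp hq).1 (hp.dvd_of_dvd_pow hpa))

theorem card_primeFactors_le_three {G : Type*} [Group G] [Finite G]
    (hnn : ¬ Group.IsNilpotent G) (hsub : ProperNilpotentOrMinimal G) :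
    (Nat.card G).primeFactors.card ≤ 3 := by
  by_cases hc : commutator G = ⊤
  · have hnt : Nontrivial G := by
      by_contra h
      rw [not_nontrivial_iff_subsingleton] at h
      exact hnn inferInstance
    obtain ⟨M, hM, hS⟩ := exists_isSimpleGroup_quotient G
    exact (Finset.card_le_card (primeFactors_subset_quotient hsub hc M)).trans
      (card_primeFactors_le_three_of_isSimpleGroup (hsub.quotient M)
        (commutator_quotient_eq_top M hc))
  · exact card_primeFactors_le_three_of_commutator_ne_top hnn hsub hc

end

/-- A finitely generated locally graded biminimal non-nilpotent group is finite, and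
its order is divisible by at most three distinct primes. -/
theorem stmt_14 {G : Type*} [Group G] (hfg : Group.FG G) (hlg : LocallyGraded G)
    (hbi : BiminimalNonNilpotent G) :
    Finite G ∧ (Nat.card G).primeFactors.card ≤ 3 := by
  have := finite_of_biminimalNonNilpotent (hfg := hfg) hlg hbi
  exact ⟨this, card_primeFactors_le_three hbi.1 hbi.2.2⟩
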